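/- Let P be a finite p-group admitting an automorphism φ of order p^n with exactly p^m fixed points such that φ^{p^{n−1}} has exactly p^k fixed points. Then P has a fully-invariant subgroup of index bounded in terms of (p,n,m,k) which is nilpotent of class bounded in terms of m alone. -/

import Mathlib

set_option linter.style.haveILetI false

namespace PG

section basic
open scoped commutatorElement
variable {P : Type} [Group P]

/-- subgroup generated by `p`-th powers -/
def pw (p : ℕ) (K : Subgroup P) : Subgroup P := Subgroup.closure {y | ∃ x ∈ K, y = x ^ p}

/-- normal and `φ`-invariant -/
def Adm (φ : MulAut P) (K : Subgroup P) : Prop := K.Normal ∧ ∀ x ∈ K, φ x ∈ K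

variable {p : ℕ} {φ : MulAut P} {K M N : Subgroup P}

theorem pow_mem_pw {x : P} (hx : x ∈ K) : x ^ p ∈ pw p K :=
  Subgroup.subset_closure ⟨x, hx, rfl⟩

theorem pw_le : pw p K ≤ K := by
  refine (Subgroup.closure_le _).2 ?_
  rintro _ ⟨x, hx, rfl⟩
  exact K.pow_mem hx _

theorem pw_mono (h : K ≤ M) : pw p K ≤ pw p M :=
  Subgroup.closure_mono (by rintro _ ⟨x, hx, rfl⟩; exact ⟨x, h hx, rfl⟩)

theorem pw_normal (h : K.Normal) : (pw p K).Normal := by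
  constructor
  intro n hn g
  induction hn using Subgroup.closure_induction with
  | mem x hx =>
    obtain ⟨y, hy, rfl⟩ := hx
    rw [← conj_pow]
    exact pow_mem_pw (h.conj_mem y hy g)
  | one => simp [one_mem]
  | mul x y _ _ hx hy =>
    have : g * (x * y) * g⁻¹ = (g * x * g⁻¹) * (g * y * g⁻¹) := by group
    rw [this]; exact mul_mem hx hy
  | inv x _ hx =>
    have : g * x⁻¹ * g⁻¹ = (g * x * g⁻¹)⁻¹ := by group
    rw [this]; exact inv_mem hx

theorem map_mem_pw {f : P →* P} (h : ∀ x ∈ K, f x ∈ K) : ∀ x ∈ pw p K, f x ∈ pw p K := by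
  intro x hx
  induction hx using Subgroup.closure_induction with
  | mem x hx =>
    obtain ⟨y, hy, rfl⟩ := hx
    rw [map_pow]
    exact pow_mem_pw (h y hy)
  | one => simp [one_mem]
  | mul x y _ _ hx hy => rw [map_mul]; exact mul_mem hx hy
  | inv x _ hx => rw [map_inv]; exact inv_mem hx

theorem Adm.pw (h : Adm φ K) : Adm φ (pw p K) :=
  ⟨pw_normal h.1, map_mem_pw (f := φ.toMonoidHom) h.2⟩

theorem Adm.pwi (h : Adm φ K) (i : ℕ) : Adm φ ((PG.pw p)^[i] K) := by
  induction i with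
  | zero => exact h
  | succ i ih => rw [Function.iterate_succ_apply']; exact ih.pw

theorem pwi_le (i : ℕ) : (pw p)^[i] K ≤ K := by
  induction i with
  | zero => exact le_rfl
  | succ i ih => rw [Function.iterate_succ_apply']; exact pw_le.trans ih

theorem pwi_mono (i : ℕ) (h : K ≤ M) : (pw p)^[i] K ≤ (pw p)^[i] M := by
  induction i with
  | zero => exact h
  | succ i ih => rw [Function.iterate_succ_apply', Function.iterate_succ_apply']; exact pw_mono ih

theorem pwi_add (i j : ℕ) : (pw p)^[i] ((pw p)^[j] K) = (pw p)^[i + j] K :=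
  (Function.iterate_add_apply _ _ _ _).symm

theorem pwi_anti {i j : ℕ} (h : i ≤ j) : (pw p)^[j] K ≤ (pw p)^[i] K := by
  obtain ⟨l, rfl⟩ := Nat.exists_eq_add_of_le h
  rw [add_comm, ← pwi_add]; exact pwi_le _

theorem pwi_succ (i : ℕ) : (pw p)^[i+1] K = pw p ((pw p)^[i] K) :=
  Function.iterate_succ_apply' _ _ _

theorem pow_mem_pwi {x : P} (i : ℕ) (hx : x ∈ K) : x ^ (p ^ i) ∈ (pw p)^[i] K := by
  induction i with
  | zero => simpa
  | succ i ih => rw [pwi_succ, pow_succ, pow_mul]; exact pow_mem_pw ih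

theorem pow_mem_pwi' {x : P} (i : ℕ) {j : ℕ} (hx : x ∈ (pw p)^[j] K) :
    x ^ (p ^ i) ∈ (pw p)^[i + j] K := by
  rw [← pwi_add]; exact pow_mem_pwi i hx

theorem Adm.comm (h : Adm φ K) (h' : Adm φ M) : Adm φ ⁅K, M⁆ := by
  have := h.1
  have := h'.1
  refine ⟨inferInstance, ?_⟩
  intro x hx
  have : ⁅K, M⁆.map φ.toMonoidHom ≤ ⁅K, M⁆ := by
    rw [Subgroup.map_commutator]
    refine Subgroup.commutator_mono ?_ ?_
    · rintro _ ⟨y, hy, rfl⟩; exact h.2 y hy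
    · rintro _ ⟨y, hy, rfl⟩; exact h'.2 y hy
  exact this ⟨x, hx, rfl⟩

theorem Adm.sup (h : Adm φ K) (h' : Adm φ M) : Adm φ (K ⊔ M) := by
  have := h.1
  have := h'.1
  refine ⟨inferInstance, ?_⟩
  intro x hx
  have : (K ⊔ M).map φ.toMonoidHom ≤ K ⊔ M := by
    rw [Subgroup.map_sup]
    refine sup_le_sup ?_ ?_
    · rintro _ ⟨y, hy, rfl⟩; exact h.2 y hy
    · rintro _ ⟨y, hy, rfl⟩; exact h'.2 y hy
  exact this ⟨x, hx, rfl⟩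

/-- powers are multiplicative modulo commutators -/
theorem mk_mul_pow {T : Subgroup P} [T.Normal] (hT : ⁅K, K⁆ ≤ T) {x y : P} (hx : x ∈ K) (hy : y ∈ K)
    (n : ℕ) : (((x * y) ^ n : P) : P ⧸ T) = ((x ^ n * y ^ n : P) : P ⧸ T) := by
  have hc : Commute (x : P ⧸ T) (y : P ⧸ T) := by
    have : ⁅x, y⁆ ∈ T := hT (Subgroup.commutator_mem_commutator hx hy)
    rw [← QuotientGroup.eq_one_iff, commutatorElement_def] at this
    simp only [QuotientGroup.mk_mul, QuotientGroup.mk_inv] at this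
    rw [← commutatorElement_def, commutatorElement_eq_one_iff_commute] at this
    exact this
  simp only [QuotientGroup.mk_mul, QuotientGroup.mk_pow]
  exact hc.mul_pow n

theorem mk_eq_of_mem {T : Subgroup P} {x y : P} : ((x : P ⧸ T) = (y : P ⧸ T)) ↔ x⁻¹ * y ∈ T :=
  QuotientGroup.eq

theorem mk_eq_mono {T T' : Subgroup P} (h : T ≤ T') {x y : P} (hxy : (x : P ⧸ T) = (y : P ⧸ T)) :
    (x : P ⧸ T') = (y : P ⧸ T') := by
  rw [QuotientGroup.eq] at *
  exact h hxy

theorem mem_iff_of_mk_eq {T T' : Subgroup P} (h : T ≤ T') {x y : P} (hxy : (x : P ⧸ T) = (y : P ⧸ T)) :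
    x ∈ T' ↔ y ∈ T' := by
  rw [QuotientGroup.eq] at *
  have := h hxy
  constructor
  · intro hx; simpa using mul_mem hx this
  · intro hx; simpa using mul_mem hx (inv_mem this)

/-- nongenerator lemma -/
theorem nongen [Finite P] (hp : p.Prime) (hP : IsPGroup p P) {X T : Subgroup P} (hT : T.Normal)
    (h : X ≤ T ⊔ pw p X) : X ≤ T := by
  by_contra hne
  have := Fact.mk hp
  -- the subgroup T ⊓ X of X
  have hlt : T.subgroupOf X ≠ ⊤ := fun h' => hne (Subgroup.subgroupOf_eq_top.1 h')
  obtain ⟨A, hA, hTA⟩ := (eq_top_or_exists_le_coatom (T.subgroupOf X)).resolve_left hlt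
  have hX : IsPGroup p X := hP.to_subgroup X
  have : Group.IsNilpotent X := hX.isNilpotent
  have hAn : A.Normal := Subgroup.NormalizerCondition.normal_of_coatom A
    (Group.normalizerCondition_of_isNilpotent) hA
  have hidx : ∀ x : X, x ^ p ∈ A := by
    intro x
    by_contra hx
    have h1 : A ⊔ Subgroup.zpowers (x ^ p) = ⊤ := by
      refine hA.2 _ (lt_of_le_of_ne le_sup_left ?_)
      intro heq
      exact hx (heq ▸ (le_sup_right : _ ≤ A ⊔ _) (Subgroup.mem_zpowers _))
    -- x ∈ A ⊔ zpowers (x^p)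
    have h2 : (x : X ⧸ A) ∈ Subgroup.zpowers ((x : X ⧸ A) ^ p) := by
      have : x ∈ A ⊔ Subgroup.zpowers (x ^ p) := h1 ▸ Subgroup.mem_top x
      have h3 := Subgroup.mem_map_of_mem (QuotientGroup.mk' A) this
      rw [Subgroup.map_sup, MonoidHom.map_zpowers] at h3
      simpa using h3
    obtain ⟨k, hk⟩ := h2
    have hk' : (x : X ⧸ A) ^ ((p : ℤ) * k - 1) = 1 := by
      rw [zpow_sub, zpow_mul, zpow_natCast, zpow_one]
      simp only at hk
      rw [hk]; simp
    obtain ⟨e, he⟩ := (hX.to_quotient A) (x : X ⧸ A)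
    have hcop : IsCoprime ((p : ℤ) ^ e) ((p : ℤ) * k - 1) := by
      apply IsCoprime.pow_left
      exact ⟨k, -1, by ring⟩
    obtain ⟨a, b, hab⟩ := hcop
    have h5 : (x : X ⧸ A) = 1 := by
      rw [← zpow_one (x : X ⧸ A), ← hab, zpow_add, mul_comm a, mul_comm b, zpow_mul, zpow_mul, hk']
      have : (x : X ⧸ A) ^ ((p : ℤ) ^ e) = 1 := by exact_mod_cast he
      rw [this]; simp
    rw [QuotientGroup.eq_one_iff] at h5
    exact hx (A.pow_mem h5 _)
  have hle : X ≤ T ⊓ X ⊔ pw p X := by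
    intro x hx
    have := hT
    obtain ⟨t, ht, y, hy, rfl⟩ := Subgroup.mem_sup_of_normal_left.1 (h hx)
    refine Subgroup.mul_mem_sup ⟨ht, ?_⟩ hy
    have := mul_mem hx (inv_mem (pw_le hy))
    simpa using this
  have : X ≤ A.map X.subtype := by
    refine hle.trans (sup_le ?_ ?_)
    · rintro x ⟨hx1, hx2⟩
      exact ⟨⟨x, hx2⟩, hTA (by simpa [Subgroup.mem_subgroupOf] using hx1), rfl⟩
    · refine (Subgroup.closure_le _).2 ?_
      rintro _ ⟨x, hx, rfl⟩
      exact ⟨⟨x, hx⟩ ^ p, hidx _, rfl⟩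
  apply hA.1
  rw [eq_top_iff]
  rintro ⟨x, hx⟩ _
  obtain ⟨y, hy, hxy⟩ := this hx
  have : y = ⟨x, hx⟩ := Subtype.ext hxy
  exact this ▸ hy

end basic
end PG
namespace PG
section env
open scoped commutatorElement
variable {P : Type} [Group P]

structure Env (p w : ℕ) (φ : MulAut P) (G0 : Subgroup P) : Prop where
  fin : Finite P
  hp : p.Prime
  hP : IsPGroup p P
  adm0 : Adm φ G0
  nice : ∀ K, Adm φ K → ⁅K, G0⁆ ≤ (pw p)^[w + 1] K

/-- admissible subgroup of `G0` -/
def Good (φ : MulAut P) (G0 K : Subgroup P) : Prop := Adm φ K ∧ K ≤ G0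

variable {p w : ℕ} {φ : MulAut P} {G0 K M N : Subgroup P}

theorem Good.pwi (h : Good φ G0 K) (i : ℕ) : Good φ G0 ((pw p)^[i] K) :=
  ⟨h.1.pwi i, (pwi_le i).trans h.2⟩

theorem Good.pw (h : Good φ G0 K) : Good φ G0 (pw p K) := h.pwi 1

theorem comm_le_left (h : K.Normal) : ⁅K, M⁆ ≤ K := by
  have := Subgroup.commutator_le_left K M
  exact this

theorem Good.comm (h : Good φ G0 K) (h' : Adm φ M) : Good φ G0 ⁅K, M⁆ :=
  ⟨h.1.comm h', (comm_le_left h.1.1).trans h.2⟩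

namespace Env

theorem cc (E : Env p w φ G0) (h : Good φ G0 K) : ⁅K, K⁆ ≤ (PG.pw p)^[w + 1] K :=
  (Subgroup.commutator_mono le_rfl h.2).trans (E.nice K h.1)

theorem mulpow (E : Env p w φ G0) (h : Good φ G0 K) (i : ℕ) {x y : P} (hx : x ∈ K) (hy : y ∈ K) :
    (((x * y) ^ (p ^ i) : P) : P ⧸ (PG.pw p)^[w + i] K) = ((x ^ (p ^ i) * y ^ (p ^ i) : P)) := by
  induction i with
  | zero => simp
  | succ i ih =>
    have hN := (h.pwi (p := p) (w + (i + 1))).1.1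
    rw [QuotientGroup.eq] at ih
    set t := ((x * y) ^ (p ^ i))⁻¹ * (x ^ (p ^ i) * y ^ (p ^ i)) with ht
    have hxi : x ^ (p ^ i) ∈ (PG.pw p)^[i] K := pow_mem_pwi i hx
    have hyi : y ^ (p ^ i) ∈ (PG.pw p)^[i] K := pow_mem_pwi i hy
    have hti : t ∈ (PG.pw p)^[i] K := pwi_anti (by omega) ih
    have heq : (x * y) ^ (p ^ i) = x ^ (p ^ i) * y ^ (p ^ i) * t⁻¹ := by rw [ht]; group
    have hcc : ⁅(PG.pw p)^[i] K, (PG.pw p)^[i] K⁆ ≤ (PG.pw p)^[w + (i + 1)] K := by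
      refine (E.cc (h.pwi i)).trans ?_
      rw [pwi_add]
      exact pwi_anti (by omega)
    have htp : t⁻¹ ^ p ∈ (PG.pw p)^[w + (i + 1)] K := by
      rw [← add_assoc, pwi_succ]; exact pow_mem_pw (inv_mem ih)
    rw [pow_succ, pow_mul, heq, mk_mul_pow hcc (mul_mem hxi hyi) (inv_mem hti), QuotientGroup.mk_mul,
      mk_mul_pow hcc hxi hyi, (QuotientGroup.eq_one_iff (t⁻¹ ^ p)).2 htp, mul_one, pow_mul, pow_mul]

theorem rep (E : Env p w φ G0) (h : Good φ G0 K) (i : ℕ) {y : P} (hy : y ∈ (PG.pw p)^[i] K) :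
    ∃ x ∈ K, ((x ^ (p ^ i) : P) : P ⧸ (PG.pw p)^[w + i] K) = (y : P) := by
  induction i generalizing y with
  | zero => exact ⟨y, hy, by simp⟩
  | succ i ih =>
    have hN := (h.pwi (p := p) (w + (i + 1))).1.1
    rw [pwi_succ] at hy
    have hcc : ⁅(PG.pw p)^[i] K, (PG.pw p)^[i] K⁆ ≤ (PG.pw p)^[w + (i + 1)] K := by
      refine (E.cc (h.pwi i)).trans ?_
      rw [pwi_add]
      exact pwi_anti (by omega)
    have key : ∃ z ∈ (PG.pw p)^[i] K, ((z ^ p : P) : P ⧸ (PG.pw p)^[w + (i+1)] K) = (y : P) := by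
      induction hy using Subgroup.closure_induction with
      | mem x hx =>
        obtain ⟨z, hz, rfl⟩ := hx
        exact ⟨z, hz, rfl⟩
      | one => exact ⟨1, one_mem _, by simp⟩
      | mul x y _ _ hx hy =>
        obtain ⟨a, ha, ha'⟩ := hx
        obtain ⟨b, hb, hb'⟩ := hy
        refine ⟨a * b, mul_mem ha hb, ?_⟩
        rw [mk_mul_pow hcc ha hb, QuotientGroup.mk_mul, ha', hb', QuotientGroup.mk_mul]
      | inv x _ hx =>
        obtain ⟨a, ha, ha'⟩ := hx
        refine ⟨a⁻¹, inv_mem ha, ?_⟩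
        rw [inv_pow, QuotientGroup.mk_inv, ha', QuotientGroup.mk_inv]
    obtain ⟨z, hz, hzy⟩ := key
    obtain ⟨x, hx, hxz⟩ := ih hz
    refine ⟨x, hx, ?_⟩
    rw [← hzy]
    rw [QuotientGroup.eq] at hxz
    set t := (x ^ (p ^ i))⁻¹ * z with ht
    have : z = x ^ (p ^ i) * t := by rw [ht]; group
    have htp : t ^ p ∈ (PG.pw p)^[w + (i + 1)] K := by
      rw [← add_assoc, pwi_succ]; exact pow_mem_pw hxz
    rw [this, mk_mul_pow hcc (pow_mem_pwi i hx) (pwi_anti (by omega) hxz), QuotientGroup.mk_mul,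
      (QuotientGroup.eq_one_iff (t ^ p)).2 htp, mul_one, pow_succ, pow_mul]

end Env

theorem mk_comm_pow {T : Subgroup P} [T.Normal] (hT : ⁅⁅N, M⁆, N⁆ ≤ T) {x y : P} (hx : x ∈ N)
    (hy : y ∈ M) (n : ℕ) : ((⁅x ^ n, y⁆ : P) : P ⧸ T) = ((⁅x, y⁆ ^ n : P) : P ⧸ T) := by
  have hc : Commute ((⁅x, y⁆ : P) : P ⧸ T) (x : P ⧸ T) := by
    have : ⁅⁅x, y⁆, x⁆ ∈ T := hT (Subgroup.commutator_mem_commutator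
      (Subgroup.commutator_mem_commutator hx hy) hx)
    rw [← QuotientGroup.eq_one_iff, commutatorElement_def _ x] at this
    simp only [QuotientGroup.mk_mul, QuotientGroup.mk_inv] at this
    rw [← commutatorElement_def, commutatorElement_eq_one_iff_commute] at this
    exact this
  have key : ∀ n : ℕ, (x : P ⧸ T) ^ n * (y : P ⧸ T) * ((x : P ⧸ T) ^ n)⁻¹ =
      ((⁅x, y⁆ : P) : P ⧸ T) ^ n * (y : P ⧸ T) := by
    intro n
    induction n with
    | zero => simp
    | succ n ih =>
      have h1 : ((⁅x, y⁆ : P) : P ⧸ T) * (y : P ⧸ T) = x * y * (x : P ⧸ T)⁻¹ := by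
        rw [commutatorElement_def]; simp
      calc (x : P ⧸ T) ^ (n+1) * (y : P ⧸ T) * ((x : P ⧸ T) ^ (n+1))⁻¹
          = x * (x ^ n * (y : P ⧸ T) * ((x : P ⧸ T) ^ n)⁻¹) * (x : P ⧸ T)⁻¹ := by
            rw [pow_succ']; group
        _ = x * ((⁅x, y⁆ : P) : P ⧸ T) ^ n * y * (x : P ⧸ T)⁻¹ := by rw [ih]; group
        _ = ((⁅x, y⁆ : P) : P ⧸ T) ^ n * (x * y * (x : P ⧸ T)⁻¹) := by
            rw [← (hc.pow_left n).eq]; group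
        _ = _ := by rw [← h1, pow_succ, mul_assoc]
  rw [commutatorElement_def (x ^ n)]
  simp only [QuotientGroup.mk_mul, QuotientGroup.mk_inv, QuotientGroup.mk_pow, key n]
  group

theorem comm_closure_le {S : Set P} {T : Subgroup P} (hT : T.Normal)
    (h : ∀ x ∈ S, ∀ y ∈ M, ⁅x, y⁆ ∈ T) : ⁅Subgroup.closure S, M⁆ ≤ T := by
  rw [Subgroup.commutator_le]
  intro x hx y hy
  have key : ∀ x y : P, ⁅x, y⁆ ∈ T ↔ (x : P ⧸ T) * y = y * x := by
    intro x y
    rw [← QuotientGroup.eq_one_iff, commutatorElement_def]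
    simp only [QuotientGroup.mk_mul, QuotientGroup.mk_inv]
    rw [← commutatorElement_def, commutatorElement_eq_one_iff_mul_comm]
  rw [key]
  induction hx using Subgroup.closure_induction with
  | mem x hx => exact (key _ _).1 (h x hx y hy)
  | one => simp
  | mul a b _ _ ha hb =>
    rw [QuotientGroup.mk_mul, mul_assoc, hb, ← mul_assoc, ha, mul_assoc]
  | inv a _ ha =>
    rw [QuotientGroup.mk_inv]
    exact (Commute.inv_left (show Commute (a : P ⧸ T) y from ha)).eq

namespace Env

/-- interchange -/
theorem pw_comm (E : Env p w φ G0) (hw : 1 ≤ w) (hN : Good φ G0 N) (hM : Adm φ M) :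
    ⁅PG.pw p N, M⁆ = PG.pw p ⁅N, M⁆ := by
  have hK := hN.comm hM
  have hTle : ⁅⁅N, M⁆, N⁆ ≤ (PG.pw p)^[2] ⁅N, M⁆ :=
    ((Subgroup.commutator_mono le_rfl hN.2).trans (E.nice _ hK.1)).trans (pwi_anti (by omega))
  have hcc : ⁅⁅N, M⁆, ⁅N, M⁆⁆ ≤ (PG.pw p)^[2] ⁅N, M⁆ :=
    (E.cc hK).trans (pwi_anti (by omega))
  have n2 : ((PG.pw p)^[2] ⁅N, M⁆).Normal := (hK.1.pwi 2).1
  have n1 : (PG.pw p ⁅N, M⁆).Normal := (hK.1.pw).1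
  have nT : (⁅PG.pw p N, M⁆).Normal := (hN.pw.comm hM).1.1
  apply le_antisymm
  · refine comm_closure_le n1 ?_
    rintro _ ⟨x, hx, rfl⟩ y hy
    have h1 := mk_comm_pow hTle hx hy p
    refine (mem_iff_of_mk_eq (T' := (PG.pw p)^[1] ⁅N, M⁆) (pwi_anti (i := 1) (by omega)) h1).2 ?_
    exact pow_mem_pw (Subgroup.commutator_mem_commutator hx hy)
  · have := E.fin
    apply nongen E.hp E.hP nT
    refine (Subgroup.closure_le _).2 ?_
    rintro _ ⟨z, hz, rfl⟩
    have n3 : (⁅PG.pw p N, M⁆ ⊔ PG.pw p (PG.pw p ⁅N, M⁆)).Normal :=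
      ((hN.pw.comm hM).1.sup (hK.1.pwi 2)).1
    have hle : (PG.pw p)^[2] ⁅N, M⁆ ≤ ⁅PG.pw p N, M⁆ ⊔ PG.pw p (PG.pw p ⁅N, M⁆) := le_sup_right
    show z ^ p ∈ ⁅PG.pw p N, M⁆ ⊔ PG.pw p (PG.pw p ⁅N, M⁆)
    suffices hs : z ∈ ⁅N, M⁆ ∧ z ^ p ∈ ⁅PG.pw p N, M⁆ ⊔ PG.pw p (PG.pw p ⁅N, M⁆) from hs.2
    rw [Subgroup.commutator_def] at hz
    induction hz using Subgroup.closure_induction with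
    | mem x hx =>
      obtain ⟨a, ha, b, hb, rfl⟩ := hx
      refine ⟨Subgroup.commutator_mem_commutator ha hb, ?_⟩
      have h1 := mk_comm_pow hTle ha hb p
      rw [← mem_iff_of_mk_eq hle h1]
      exact le_sup_left (a := ⁅PG.pw p N, M⁆) (Subgroup.commutator_mem_commutator (pow_mem_pw ha) hb)
    | one => exact ⟨one_mem _, by simp [one_mem]⟩
    | mul a b _ _ ha hb =>
      refine ⟨mul_mem ha.1 hb.1, ?_⟩
      rw [mem_iff_of_mk_eq hle (mk_mul_pow hcc ha.1 hb.1 p)]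
      exact mul_mem ha.2 hb.2
    | inv a _ ha => exact ⟨inv_mem ha.1, by rw [inv_pow]; exact inv_mem ha.2⟩

theorem pwi_comm (E : Env p w φ G0) (hw : 1 ≤ w) (hN : Good φ G0 N) (hM : Adm φ M) (i : ℕ) :
    ⁅(PG.pw p)^[i] N, M⁆ = (PG.pw p)^[i] ⁅N, M⁆ := by
  induction i with
  | zero => rfl
  | succ i ih => rw [pwi_succ, pwi_succ, E.pw_comm hw (hN.pwi i) hM, ih]

theorem comm_pwi (E : Env p w φ G0) (hw : 1 ≤ w) (hN : Adm φ N) (hM : Good φ G0 M) (i : ℕ) :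
    ⁅N, (PG.pw p)^[i] M⁆ = (PG.pw p)^[i] ⁅N, M⁆ := by
  rw [Subgroup.commutator_comm, E.pwi_comm hw hM hN, Subgroup.commutator_comm]

theorem commpow (E : Env p w φ G0) (hw : 1 ≤ w) (hK : Good φ G0 K) {W : ℕ} (hW : w + 1 ≤ W)
    (hKW : ⁅K, K⁆ ≤ (PG.pw p)^[W] K) {x y : P} (hx : x ∈ K) (hy : y ∈ K) (i : ℕ) :
    ((⁅x ^ (p ^ i), y⁆ : P) : P ⧸ (PG.pw p)^[W + i + w] K) = ((⁅x, y⁆ ^ (p ^ i) : P)) := by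
  induction i with
  | zero => simp
  | succ i ih =>
    have hT := (hK.pwi (p := p) (W + (i + 1) + w)).1.1
    have hxi : x ^ (p ^ i) ∈ (PG.pw p)^[i] K := pow_mem_pwi i hx
    have h1 : ⁅⁅(PG.pw p)^[i] K, K⁆, (PG.pw p)^[i] K⁆ ≤ (PG.pw p)^[W + (i+1) + w] K := by
      rw [E.pwi_comm hw hK hK.1, E.pwi_comm hw (hK.comm hK.1) (hK.pwi i).1,
        E.comm_pwi hw (hK.comm hK.1).1 hK, pwi_add]
      refine (pwi_mono _ (Subgroup.commutator_mono hKW le_rfl)).trans ?_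
      rw [E.pwi_comm hw hK hK.1, pwi_add]
      refine (pwi_mono _ hKW).trans ?_
      rw [pwi_add]
      exact pwi_anti (by omega)
    have h2 := mk_comm_pow h1 hxi hy p
    rw [pow_succ, pow_mul, h2, pow_mul]
    have hWi : Good φ G0 ((PG.pw p)^[W + i] K) := hK.pwi _
    have hcc : ⁅(PG.pw p)^[W + i] K, (PG.pw p)^[W + i] K⁆ ≤ (PG.pw p)^[W + (i+1) + w] K := by
      refine (E.cc hWi).trans ?_
      rw [pwi_add]
      exact pwi_anti (by omega)
    have ha : ⁅x, y⁆ ^ p ^ i ∈ (PG.pw p)^[W + i] K := by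
      rw [add_comm]
      exact pow_mem_pwi' i (hKW (Subgroup.commutator_mem_commutator hx hy))
    rw [QuotientGroup.eq] at ih
    set t := (⁅x ^ (p ^ i), y⁆)⁻¹ * ⁅x, y⁆ ^ (p ^ i) with ht
    have heq : ⁅x ^ (p ^ i), y⁆ = ⁅x, y⁆ ^ (p ^ i) * t⁻¹ := by rw [ht]; group
    have htp : t⁻¹ ^ p ∈ (PG.pw p)^[W + (i + 1) + w] K := by
      have : W + (i + 1) + w = (W + i + w) + 1 := by omega
      rw [this, pwi_succ]; exact pow_mem_pw (inv_mem ih)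
    rw [heq, mk_mul_pow hcc ha (inv_mem (pwi_anti (by omega) ih)), QuotientGroup.mk_mul,
      (QuotientGroup.eq_one_iff (t⁻¹ ^ p)).2 htp, mul_one]

end Env

/-- uniformity up to depth `a` -/
def Unif (p : ℕ) (K : Subgroup P) (a : ℕ) : Prop :=
  ∀ i, i + 1 < a → ∀ x ∈ (pw p)^[i] K, x ^ p ∈ (pw p)^[i + 2] K → x ∈ (pw p)^[i + 1] K

theorem Unif.mono {a b : ℕ} (h : Unif p K a) (hb : b ≤ a) : Unif p K b :=
  fun i hi => h i (by omega)

theorem Unif.root {a : ℕ} (h : Unif p K a) {e b : ℕ} (hab : e + b ≤ a) {x : P} (hx : x ∈ K)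
    (hxe : x ^ (p ^ e) ∈ (pw p)^[e + b] K) : x ∈ (pw p)^[b] K := by
  have key : ∀ i ≤ b, x ∈ (pw p)^[i] K := by
    intro i hi
    induction i with
    | zero => exact hx
    | succ i ih =>
      have hxi := ih (by omega)
      have : ∀ l j, l + j = e → x ^ (p ^ l) ∈ (pw p)^[i + l + 1] K := by
        intro l j
        induction j generalizing l with
        | zero =>
          rintro rfl
          exact pwi_anti (by omega) hxe
        | succ j ihj =>
          intro hlj
          have h1 := ihj (l + 1) (by omega)
          apply h (i + l) (by omega)
          · rw [add_comm]; exact pow_mem_pwi' l hxi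
          · rw [← pow_mul, ← pow_succ]
            exact h1
      simpa using this 0 e (by omega)
  exact key b le_rfl

theorem Unif.root_sub {a : ℕ} (h : Unif p K a) {e b : ℕ} (hab : e + b ≤ a) {X : Subgroup P}
    (hX : X ≤ K) (hXe : (pw p)^[e] X ≤ (pw p)^[e + b] K) : X ≤ (pw p)^[b] K :=
  fun _ hx => h.root hab (hX hx) (hXe (pow_mem_pwi e hx))

theorem Unif.pwi {a t : ℕ} (h : Unif p K a) : Unif p ((pw p)^[t] K) (a - t) := by
  intro i hi x hx hxp
  rw [pwi_add] at *
  have := h (i + t) (by omega) x hx (by convert hxp using 2; omega)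
  convert this using 2; omega

theorem Env.unif_trans (E : Env p w φ G0) {K' : Subgroup P} (hK' : Good φ G0 K')
    {c1 a : ℕ} (hc : c1 + 1 ≤ w) (h1 : (PG.pw p)^[c1] K ≤ K') (h2 : K' ≤ K) (hu : Unif p K a) :
    Unif p K' (a - c1) := by
  intro i hi x hx hxp
  obtain ⟨y, hy, hyx⟩ := E.rep hK' i hx
  obtain ⟨z, hz, hzx⟩ := E.rep hK' (i + 2) hxp
  have n1 := (hK'.pwi (p := p) (w + (i + 1))).1.1
  have hT : (PG.pw p)^[w + (i + 2)] K' ≤ (PG.pw p)^[w + (i + 1)] K' := pwi_anti (by omega)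
  -- y^(p^(i+1)) ≡ x^p
  have hyx' : ((y ^ (p ^ (i + 1)) : P) : P ⧸ (PG.pw p)^[w + (i+1)] K') = ((x ^ p : P)) := by
    rw [QuotientGroup.eq] at hyx
    set t := (y ^ (p ^ i))⁻¹ * x with ht
    have hxe : x = y ^ (p ^ i) * t := by rw [ht]; group
    have hcc : ⁅(PG.pw p)^[i] K', (PG.pw p)^[i] K'⁆ ≤ (PG.pw p)^[w + (i + 1)] K' := by
      refine (E.cc (hK'.pwi i)).trans ?_
      rw [pwi_add]
      exact pwi_anti (by omega)
    have htp : t ^ p ∈ (PG.pw p)^[w + (i + 1)] K' := by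
      rw [← add_assoc, pwi_succ]; exact pow_mem_pw hyx
    rw [hxe, mk_mul_pow hcc (pow_mem_pwi i hy) (pwi_anti (by omega) hyx), QuotientGroup.mk_mul,
      (QuotientGroup.eq_one_iff (t ^ p)).2 htp, mul_one, pow_succ, pow_mul]
  have hzy := hyx'.trans (mk_eq_mono hT hzx).symm
  have hmul := E.mulpow hK' (i + 1) (inv_mem (K'.pow_mem hz p)) hy
  have hmem : ((z ^ p)⁻¹ * y) ^ (p ^ (i + 1)) ∈ (PG.pw p)^[w + (i + 1)] K' := by
    rw [← QuotientGroup.eq_one_iff, hmul, QuotientGroup.mk_mul, hzy, inv_pow, ← pow_mul,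
      show p * p ^ (i + 1) = p ^ (i + 2) by ring, ← QuotientGroup.mk_mul]
    simp
  have hroot : (z ^ p)⁻¹ * y ∈ (PG.pw p)^[c1 + 1] K := by
    refine hu.root (e := i + 1) (by omega) (mul_mem (inv_mem (K.pow_mem (h2 hz) p)) (h2 hy)) ?_
    exact pwi_mono _ h2 (pwi_anti (by omega) hmem)
  have hyp : y ∈ PG.pw p K' := by
    have h3 : (z ^ p)⁻¹ * y ∈ PG.pw p K' := by
      rw [pwi_succ] at hroot
      exact pw_mono h1 hroot
    simpa using mul_mem (pow_mem_pw hz : z ^ p ∈ PG.pw p K') h3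
  rw [← mem_iff_of_mk_eq (T' := (PG.pw p)^[i + 1] K') (pwi_anti (by omega)) hyx]
  have := pow_mem_pwi (p := p) i hyp
  exact this

end env
end PG
namespace PG
section core
variable {P : Type} [Group P] {p w : ℕ} {φ : MulAut P} {G0 K M N G : Subgroup P}

/-- iterated commutator `[T, G, ..., G]` -/
def itc (G T : Subgroup P) : ℕ → Subgroup P
  | 0 => T
  | n + 1 => ⁅itc G T n, G⁆

theorem itc_mono {T T' : Subgroup P} (h : T ≤ T') (n : ℕ) : itc G T n ≤ itc G T' n := by
  induction n with
  | zero => exact h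
  | succ n ih => exact Subgroup.commutator_mono ih le_rfl

theorem itc_itc {T : Subgroup P} (m n : ℕ) : itc G (itc G T m) n = itc G T (m + n) := by
  induction n with
  | zero => rfl
  | succ n ih => rw [itc, ih]; rfl

theorem lcs_eq (n : ℕ) : Subgroup.lowerCentralSeries G n = itc G G n := by
  induction n with
  | zero => rfl
  | succ n ih => rw [Subgroup.lowerCentralSeries_succ, ih]; rfl

theorem itc_anti {m n : ℕ} (h : m ≤ n) : itc G G n ≤ itc G G m := by
  rw [← lcs_eq, ← lcs_eq]; exact Subgroup.lowerCentralSeries_antitone _ h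

theorem Good.itc {T : Subgroup P} (h : Good φ G0 T) (hG : Adm φ G) (n : ℕ) :
    Good φ G0 (itc G T n) := by
  induction n with
  | zero => exact h
  | succ n ih => exact ih.comm hG

theorem itc_both_mono (h : G ≤ K) (n : ℕ) : itc G G n ≤ itc K K n := by
  induction n with
  | zero => exact h
  | succ n ih => exact Subgroup.commutator_mono ih h

namespace Env

theorem itc_pwi (E : Env p w φ G0) (hw : 1 ≤ w) {T : Subgroup P} (hT : Good φ G0 T)
    (hG : Adm φ G) (i n : ℕ) : itc G ((PG.pw p)^[i] T) n = (PG.pw p)^[i] (itc G T n) := by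
  induction n with
  | zero => rfl
  | succ n ih => rw [itc, ih, E.pwi_comm hw (hT.itc hG n) hG]; rfl

theorem lcs_pwi (E : Env p w φ G0) (hw : 1 ≤ w) (hG : Good φ G0 G) (a n : ℕ) :
    itc ((PG.pw p)^[a] G) ((PG.pw p)^[a] G) n = (PG.pw p)^[a * (n + 1)] (itc G G n) := by
  induction n with
  | zero => simp [itc]
  | succ n ih =>
    rw [itc, ih, E.comm_pwi hw ((hG.itc hG.1 n).pwi _).1 hG, E.pwi_comm hw (hG.itc hG.1 n) hG.1,
      pwi_add]
    congr 1
    ring_nf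

theorem lcs_mul (E : Env p w φ G0) (hw : 1 ≤ w) (hG : Good φ G0 G) {c b : ℕ}
    (h : itc G G c ≤ (PG.pw p)^[b] G) (l : ℕ) : itc G G (c * l) ≤ (PG.pw p)^[b * l] G := by
  induction l with
  | zero => exact le_rfl
  | succ l ih =>
    rw [Nat.mul_succ, ← itc_itc]
    refine (itc_mono ih c).trans ?_
    rw [E.itc_pwi hw hG hG.1]
    refine (pwi_mono _ h).trans ?_
    rw [pwi_add]
    exact le_rfl

/-- the Lie step, as a property -/
def _root_.PG.StepD (p w s c : ℕ) (φ : MulAut P) (G0 : Subgroup P) : Prop :=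
  ∀ (K : Subgroup P) (W A : ℕ), Good φ G0 K → ⁅K, K⁆ ≤ (PG.pw p)^[W] K → w + 1 ≤ W →
    Unif p K A → 2 * W + s ≤ A → ∃ K', Good φ G0 K' ∧ (PG.pw p)^[c - 1] K ≤ K' ∧ K' ≤ K ∧
      ⁅K', K'⁆ ≤ (PG.pw p)^[W + c] K'

theorem iter (E : Env p w φ G0) {s c : ℕ} (hD : StepD p w s c φ G0) (hsw : s ≤ w) (hcw : c ≤ w)
    (hc : 2 ≤ c) (hG : Good φ G0 G) {a : ℕ} (hu : Unif p G a) (j : ℕ)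
    (hj : 3 * (w + 1) + 3 * c * j ≤ a) :
    ∃ K, Good φ G0 K ∧ (PG.pw p)^[j * (c - 1)] G ≤ K ∧ K ≤ G ∧
      ⁅K, K⁆ ≤ (PG.pw p)^[w + 1 + j * c] K ∧ Unif p K (a - j * (c - 1)) := by
  induction j with
  | zero => exact ⟨G, hG, by simp, le_rfl, by simpa using E.cc hG, by simpa using hu⟩
  | succ j ih =>
    obtain ⟨K, hK, h1, h2, h3, h4⟩ := ih (by nlinarith)
    obtain ⟨d, rfl⟩ : ∃ d, c = d + 1 := ⟨c - 1, by omega⟩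
    simp only [Nat.add_sub_cancel] at *
    have e1 : j * (d + 1) = j * d + j := by ring
    have e2 : (j + 1) * (d + 1) = j * d + j + d + 1 := by ring
    have e3 : (j + 1) * d = j * d + d := by ring
    have e4 : 3 * (d + 1) * (j + 1) = 3 * (j * d) + 3 * d + 3 * j + 3 := by ring
    rw [e1] at h3
    rw [e4] at hj
    obtain ⟨K', g1, g2, g3, g4⟩ := hD K _ _ hK h3 (by omega) h4 (by omega)
    simp only [Nat.add_sub_cancel] at *
    refine ⟨K', g1, ?_, g3.trans h2, ?_, ?_⟩
    · rw [e3, add_comm, ← pwi_add]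
      exact (pwi_mono _ h1).trans g2
    · rw [e2]; convert g4 using 2; omega
    · rw [e3, ← Nat.sub_sub]
      exact E.unif_trans g1 (by omega) g2 g3 h4

theorem core (E : Env p w φ G0) {s c : ℕ} (hD : StepD p w s c φ G0) (hsw : s ≤ w) (hcw : c ≤ w)
    (hc : 2 ≤ c) (hG : Good φ G0 G) {a : ℕ} (hu : Unif p G a) :
    itc G G (c * (3 * c)) ≤ (PG.pw p)^[a] G := by
  have hw : 1 ≤ w := by omega
  by_cases ha : a < 3 * c * (w + 1)
  · have h1 : itc G G 1 ≤ (PG.pw p)^[w + 1] G := E.cc hG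
    have h2 := E.lcs_mul hw hG h1 (3 * c)
    refine (itc_anti ?_).trans (h2.trans (pwi_anti ?_))
    · nlinarith
    · nlinarith
  · push Not at ha
    set j := (a - 3 * c * (w + 1)) / (3 * c) with hj
    have hj1 : 3 * c * j ≤ a - 3 * c * (w + 1) := Nat.mul_div_le _ _
    have hj2 : a - 3 * c * (w + 1) < 3 * c * j + 3 * c := by
      have := Nat.lt_mul_div_succ (a - 3 * c * (w + 1)) (show 0 < 3 * c by omega)
      rw [← hj] at this
      linarith
    have hcw3 : 3 * (w + 1) ≤ 3 * c * (w + 1) := by nlinarith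
    obtain ⟨K, hK, h1, h2, h3, h4⟩ := E.iter hD hsw hcw hc hG hu j (by omega)
    obtain ⟨d, rfl⟩ : ∃ d, c = d + 1 := ⟨c - 1, by omega⟩
    simp only [Nat.add_sub_cancel] at *
    have e1 : j * (d + 1) = j * d + j := by ring
    have e5 : 3 * (d + 1) * j = 3 * (j * d) + 3 * j := by ring
    have e6 : 3 * (d + 1) * (w + 1) = 3 * (d * (w + 1)) + 3 * (w + 1) := by ring
    clear_value j
    clear hj
    rw [e6] at ha hj1 hj2 hcw3
    rw [e5] at hj1 hj2
    have hKG : ⁅K, G⁆ ≤ (PG.pw p)^[w + 1 + j] K := by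
      refine h4.root_sub (e := j * d) (by omega) (comm_le_left hK.1.1) ?_
      rw [← E.comm_pwi hw hK.1 hG]
      refine (Subgroup.commutator_mono le_rfl h1).trans (h3.trans ?_)
      rw [e1]
      exact pwi_anti (by omega)
    have hit : ∀ l, itc G K l ≤ (PG.pw p)^[(w + 1 + j) * l] K := by
      intro l
      induction l with
      | zero => exact le_rfl
      | succ l ih =>
        refine (Subgroup.commutator_mono ih le_rfl).trans ?_
        rw [E.pwi_comm hw hK hG.1]
        refine (pwi_mono _ hKG).trans ?_
        rw [pwi_add]
        exact le_rfl
    have e7 : (w + 1 + j) * (d + 1) = j * d + (d * (w + 1) + (w + 1) + j) := by ring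
    have hb : itc G G (d + 1) ≤ (PG.pw p)^[d * (w + 1) + (w + 1) + j] G := by
      refine hu.root_sub (e := j * d) (by omega) ?_ ?_
      · exact itc_anti (Nat.zero_le _)
      · rw [← E.itc_pwi hw hG hG.1]
        refine (itc_mono h1 _).trans ((hit _).trans ?_)
        rw [e7]
        exact pwi_mono _ h2
    refine (E.lcs_mul hw hG hb (3 * (d + 1))).trans (pwi_anti ?_)
    have : 1 ≤ d := by omega
    have h9 : 1 ≤ d * (w + 1) := Nat.mul_pos (by omega) (by omega)
    have h10 : (d * (w + 1) + (w + 1) + j) * (3 * (d + 1)) ≥ 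
      3 * (j * d) + 3 * j + 3 * (d + 1) + (3 * (d * (w + 1)) + 3 * (w + 1)) := by
      nlinarith
    omega

end Env
end core
end PG
namespace PG
section quo
open scoped commutatorElement
variable {P : Type} [Group P] {p w : ℕ} {φ : MulAut P} {G0 K M N G T : Subgroup P}

/-- `U` is (via `q`) an additive copy of `K / T` -/
structure Quo (K T : Subgroup P) {U : Type} [AddCommGroup U] (q : P → U) : Prop where
  add : ∀ x ∈ K, ∀ y ∈ K, q (x * y) = q x + q y
  surj : ∀ u, ∃ x ∈ K, q x = u
  ker : ∀ x ∈ K, q x = 0 ↔ x ∈ T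

theorem exists_quo (hT : T.Normal) (h : ⁅K, K⁆ ≤ T) :
    ∃ (U : Type) (_ : AddCommGroup U) (q : P → U), Quo K T q := by
  classical
  let H := K.map (QuotientGroup.mk' T)
  let cg : CommGroup H :=
    { (inferInstance : Group H) with
      mul_comm := by
        rintro ⟨_, x, hx, rfl⟩ ⟨_, y, hy, rfl⟩
        apply Subtype.ext
        simp only [Subgroup.coe_mul]
        have : ⁅x, y⁆ ∈ T := h (Subgroup.commutator_mem_commutator hx hy)
        rw [← QuotientGroup.eq_one_iff, commutatorElement_def] at this
        simp only [QuotientGroup.mk_mul, QuotientGroup.mk_inv] at this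
        rw [← commutatorElement_def, commutatorElement_eq_one_iff_mul_comm] at this
        exact this }
  refine ⟨Additive H, inferInstance, fun x => if hx : x ∈ K then
    Additive.ofMul ⟨QuotientGroup.mk' T x, Subgroup.mem_map_of_mem _ hx⟩ else 0, ?_, ?_, ?_⟩
  · intro x hx y hy
    simp only [hx, hy, mul_mem, dif_pos]
    rfl
  · intro u
    obtain ⟨_, x, hx, rfl⟩ := u
    exact ⟨x, hx, dif_pos hx⟩
  · intro x hx
    simp only [hx, dif_pos]
    have he := QuotientGroup.eq_one_iff (N := T) x
    refine Iff.trans ?_ he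
    constructor
    · intro h; exact congrArg Subtype.val (show _ = (1 : H) from h)
    · intro h; exact Subtype.ext h

namespace Quo
variable {U V : Type} [AddCommGroup U] [AddCommGroup V] {q : P → U} {r : P → V}

theorem one (h : Quo K T q) : q 1 = 0 := by
  have := h.add 1 (one_mem _) 1 (one_mem _)
  simpa using this

theorem inv (h : Quo K T q) {x : P} (hx : x ∈ K) : q x⁻¹ = - q x := by
  have := h.add x hx x⁻¹ (inv_mem hx)
  rw [mul_inv_cancel, h.one] at this
  exact (neg_eq_of_add_eq_zero_right this.symm).symm

theorem pow (h : Quo K T q) {x : P} (hx : x ∈ K) (n : ℕ) : q (x ^ n) = n • q x := by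
  induction n with
  | zero => simp [h.one]
  | succ n ih => rw [pow_succ, h.add _ (K.pow_mem hx n) _ hx, ih, succ_nsmul]

theorem eq_iff (h : Quo K T q) {x y : P} (hx : x ∈ K) (hy : y ∈ K) :
    q x = q y ↔ (x : P ⧸ T) = (y : P ⧸ T) := by
  rw [QuotientGroup.eq, ← h.ker _ (mul_mem (inv_mem hx) hy), h.add _ (inv_mem hx) _ hy, h.inv hx,
    neg_add_eq_zero]

theorem finite [Finite P] (h : Quo K T q) : Finite U := 
  Finite.of_surjective q (fun u => (h.surj u).imp fun _ hx => hx.2)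

theorem lift (h : Quo K T q) (g : P → V) (hg : ∀ x ∈ K, ∀ y ∈ K, g (x * y) = g x + g y)
    (hT : ∀ x ∈ K, x ∈ T → g x = 0) : ∃ F : U →+ V, ∀ x ∈ K, F (q x) = g x := by
  choose s hs hqs using h.surj
  have g1 : g 1 = 0 := by simpa using hg 1 (one_mem _) 1 (one_mem _)
  have ginv : ∀ x ∈ K, g x⁻¹ = - g x := by
    intro x hx
    have := hg x hx x⁻¹ (inv_mem hx)
    rw [mul_inv_cancel, g1] at this
    exact (neg_eq_of_add_eq_zero_right this.symm).symm
  have key : ∀ x ∈ K, ∀ y ∈ K, q x = q y → g x = g y := by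
    intro x hx y hy hxy
    have hm : x⁻¹ * y ∈ K := mul_mem (inv_mem hx) hy
    have h1 : x⁻¹ * y ∈ T := by
      rw [← h.ker _ hm, h.add _ (inv_mem hx) _ hy, h.inv hx, hxy]; simp
    have h2 := hT _ hm h1
    rw [hg _ (inv_mem hx) _ hy, ginv _ hx, neg_add_eq_zero] at h2
    exact h2
  refine ⟨AddMonoidHom.mk' (fun u => g (s u)) ?_, ?_⟩
  · intro u v
    rw [← hg _ (hs u) _ (hs v)]
    apply key _ (hs _) _ (mul_mem (hs _) (hs _))
    rw [h.add _ (hs _) _ (hs _), hqs, hqs, hqs]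
  · intro x hx
    exact key _ (hs _) _ hx (hqs _)

theorem endo (h : Quo K T q) (f : P →* P) (hK : ∀ x ∈ K, f x ∈ K) (hT : ∀ x ∈ T, f x ∈ T) :
    ∃ F : U →+ U, ∀ x ∈ K, F (q x) = q (f x) := by
  apply h.lift
  · intro x hx y hy; rw [map_mul, h.add _ (hK _ hx) _ (hK _ hy)]
  · intro x hx hxT
    rw [h.ker _ (hK _ hx)]; exact hT _ hxT

theorem card_fix [Finite P] (h : Quo K T q) (hTK : T ≤ K) (hTn : T.Normal) (f : P →* P)
    (hT : ∀ x ∈ T, f x ∈ T)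
    {F : U →+ U} (hF : ∀ x ∈ K, F (q x) = q (f x)) (hfK : ∀ x ∈ K, f x ∈ K) :
    Nat.card {u : U // F u = u} ≤ Nat.card {x : P // f x = x} := by
  classical
  have := h.finite
  choose s hs hqs using h.surj
  -- inject Fix(U) × T into Y, Y into Fix × T
  let Y := {x : P // x ∈ K ∧ x⁻¹ * f x ∈ T}
  have c1 : Nat.card ({u : U // F u = u} × T) ≤ Nat.card Y := by
    refine Nat.card_le_card_of_injective (fun z => ⟨s z.1.1 * z.2.1, mul_mem (hs _) (hTK z.2.2), ?_⟩) ?_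
    · have h1 : q (f (s z.1.1)) = q (s z.1.1) := by
        rw [← hF _ (hs _), hqs, z.1.2]
      rw [h.eq_iff (hfK _ (hs _)) (hs _), ← QuotientGroup.mk'_apply, ← QuotientGroup.mk'_apply] at h1
      have h2 : (z.2.1 : P ⧸ T) = 1 := (QuotientGroup.eq_one_iff _).2 z.2.2
      have h3 : (f z.2.1 : P ⧸ T) = 1 := (QuotientGroup.eq_one_iff _).2 (hT _ z.2.2)
      rw [← QuotientGroup.eq_one_iff, map_mul]
      simp only [QuotientGroup.mk'_apply] at h1
      simp [h1, h2, h3]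
    · rintro ⟨⟨u, hu⟩, ⟨t, ht⟩⟩ ⟨⟨u', hu'⟩, ⟨t', ht'⟩⟩ heq
      have heq : s u * t = s u' * t' := congrArg Subtype.val heq
      have h2 : u = u' := by
        have := congrArg q heq
        rw [h.add _ (hs _) _ (hTK ht), h.add _ (hs _) _ (hTK ht'), hqs, hqs,
          (h.ker _ (hTK ht)).2 ht, (h.ker _ (hTK ht')).2 ht'] at this
        simpa using this
      subst h2
      simp at heq
      subst heq
      rfl
  have c2 : Nat.card Y ≤ Nat.card ({x : P // f x = x} × T) := by
    have hex : ∀ t : P, (∃ y : Y, y.1⁻¹ * f y.1 = t) → ∃ y : Y, y.1⁻¹ * f y.1 = t := fun _ h => h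
    let r : P → P := fun t => if ht : ∃ y : Y, y.1⁻¹ * f y.1 = t then ht.choose.1 else 1
    have hr : ∀ y : Y, (r (y.1⁻¹ * f y.1))⁻¹ * f (r (y.1⁻¹ * f y.1)) = y.1⁻¹ * f y.1 := by
      intro y
      have ht : ∃ y' : Y, y'.1⁻¹ * f y'.1 = y.1⁻¹ * f y.1 := ⟨y, rfl⟩
      have : r (y.1⁻¹ * f y.1) = ht.choose.1 := dif_pos ht
      rw [this]
      exact ht.choose_spec
    refine Nat.card_le_card_of_injective
      (fun y => (⟨y.1 * (r (y.1⁻¹ * f y.1))⁻¹, ?_⟩, ⟨y.1⁻¹ * f y.1, y.2.2⟩)) ?_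
    · have h0 := hr y
      set z := r (y.1⁻¹ * f y.1)
      have : f z = z * (y.1⁻¹ * f y.1) := by rw [← h0]; group
      rw [map_mul, map_inv, this]; group
    · intro y y' heq
      simp only [Prod.mk.injEq, Subtype.mk.injEq] at heq
      obtain ⟨e1, e2⟩ := heq
      rw [e2] at e1
      exact Subtype.ext (mul_right_cancel e1)
  have := c1.trans c2
  rw [Nat.card_prod, Nat.card_prod] at this
  exact Nat.le_of_mul_le_mul_right this Nat.card_pos

end Quo

theorem card_ker_eq_coker {U : Type*} [AddCommGroup U] [Finite U] (f : U →+ U) :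
    Nat.card f.ker = Nat.card (U ⧸ f.range) := by
  have h1 := f.ker.card_eq_card_quotient_mul_card_addSubgroup
  have h2 := f.range.card_eq_card_quotient_mul_card_addSubgroup
  have h3 : Nat.card (U ⧸ f.ker) = Nat.card f.range :=
    Nat.card_congr (QuotientAddGroup.quotientKerEquivRange f).toEquiv
  rw [h1, h3, mul_comm] at h2
  exact Nat.eq_of_mul_eq_mul_right Nat.card_pos h2

theorem nsmul_descent {U : Type*} [AddCommGroup U] {p e : ℕ} (he : ∀ u : U, p ^ e • u = 0)
    (V : Set U) (hV : ∀ v ∈ V, ∃ v' ∈ V, v = p • v') : ∀ v ∈ V, v = 0 := by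
  have : ∀ j, ∀ v ∈ V, ∃ v' ∈ V, v = p ^ j • v' := by
    intro j
    induction j with
    | zero => intro v hv; exact ⟨v, hv, by simp⟩
    | succ j ih =>
      intro v hv
      obtain ⟨v', hv', rfl⟩ := ih v hv
      obtain ⟨v'', hv'', rfl⟩ := hV v' hv'
      exact ⟨v'', hv'', by rw [smul_smul, pow_succ]⟩
  intro v hv
  obtain ⟨v', -, rfl⟩ := this e v hv
  exact he _

/-- Lemma A -/
theorem lemmaA {U U' : Type*} [AddCommGroup U] [AddCommGroup U'] [Finite U] [Finite U']
    {p m S N : ℕ} (hS : S = m + 1) (h : U →+ U') (hsurj : Function.Surjective h)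
    (π : U →+ U) (π' : U' →+ U') (hπ : ∀ u, h (π u) = π' (h u)) (hpS : ∀ u : U, p ^ S • u = 0)
    (hom : ∀ j ≤ S, ∀ u : U', p ^ j • u = 0 → ∃ v, u = p ^ (S - j) • v)
    (hk : ∀ u, π' u = 0 → p ^ m • u = 0) (hnil : ∀ u, ∃ v, π^[N] u = p • v)
    (hne : ∃ u, u ≠ 0 ∧ h u = 0) : Nat.card π'.ker < Nat.card π.ker := by
  rw [card_ker_eq_coker, card_ker_eq_coker]
  by_contra hlt
  push Not at hlt
  let f : U ⧸ π.range →+ U' ⧸ π'.range := QuotientAddGroup.map _ _ h (by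
    rintro _ ⟨u, rfl⟩; exact ⟨h u, (hπ u).symm⟩)
  have hf : Function.Surjective f := by
    intro u
    obtain ⟨u, rfl⟩ := QuotientAddGroup.mk_surjective u
    obtain ⟨v, rfl⟩ := hsurj u
    exact ⟨(v : U ⧸ π.range), rfl⟩
  have hinj : Function.Injective f := by
    have := (Nat.bijective_iff_surjective_and_card f).2 ⟨hf, le_antisymm hlt (Nat.card_le_card_of_surjective f hf)⟩
    exact this.1
  have hV : ∀ v, h v = 0 → ∃ u, v = π u := by
    intro v hv
    have : f v = 0 := by
      show ((h v : U') : U' ⧸ π'.range) = 0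
      rw [hv]; rfl
    have h2 := hinj (this.trans (map_zero f).symm)
    rw [QuotientAddGroup.eq_zero_iff] at h2
    obtain ⟨u, hu⟩ := h2
    exact ⟨u, hu.symm⟩
  have hV2 : ∀ v, h v = 0 → ∃ v' u, h v' = 0 ∧ v = π v' + p • u := by
    intro v hv
    obtain ⟨u, rfl⟩ := hV v hv
    rw [hπ] at hv
    obtain ⟨u1, hu1⟩ := hom m (by omega) (h u) (hk _ hv)
    obtain ⟨u2, rfl⟩ := hsurj u1
    have hSm : S - m = 1 := by omega
    rw [hSm, pow_one] at hu1
    refine ⟨u - p • u2, π u2, ?_, ?_⟩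
    · rw [map_sub, map_nsmul, hu1, sub_self]
    · rw [map_sub, map_nsmul]; simp
  have hV3 : ∀ N v, h v = 0 → ∃ v' u, h v' = 0 ∧ v = π^[N] v' + p • u := by
    intro N
    induction N with
    | zero => intro v hv; exact ⟨v, 0, hv, by simp⟩
    | succ N ih =>
      intro v hv
      obtain ⟨v', u, hv', rfl⟩ := hV2 v hv
      obtain ⟨v'', u', hv'', rfl⟩ := ih v' hv'
      refine ⟨v'', π u' + u, hv'', ?_⟩
      rw [Function.iterate_succ_apply', map_add, map_nsmul, smul_add, add_assoc]
  have hV4 : ∀ v, h v = 0 → ∃ v', h v' = 0 ∧ v = p • v' := by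
    intro v hv
    obtain ⟨v', u, hv', rfl⟩ := hV3 N v hv
    obtain ⟨u', hu'⟩ := hnil v'
    rw [hu', ← smul_add] at hv ⊢
    rw [map_nsmul] at hv
    obtain ⟨y, hy⟩ := hom 1 (by omega) (h (u' + u)) (by rw [pow_one]; exact hv)
    obtain ⟨y, rfl⟩ := hsurj y
    refine ⟨u' + u - p ^ (S - 1) • y, by rw [map_sub, map_nsmul, hy, sub_self], ?_⟩
    rw [smul_sub (r := p), smul_smul, ← pow_succ', Nat.sub_add_cancel (by omega), hpS, sub_zero]
  obtain ⟨u, hu, hu0⟩ := hne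
  exact hu (nsmul_descent hpS {v | h v = 0} hV4 u hu0)

end quo
end PG
namespace PG

theorem nilp {U : Type*} [AddCommGroup U] {p n : ℕ} (hp : p.Prime) (F : U →+ U)
    (hF : ∀ u, F^[p ^ n] u = u) (u : U) :
    ∃ v, (F - AddMonoidHom.id U : U →+ U)^[p ^ n] u = p • v := by
  let f : AddMonoid.End U := F
  have hf : f ^ (p ^ n) = 1 := by
    ext u
    rw [AddMonoid.End.coe_pow]
    exact hF u
  obtain ⟨r, h1⟩ := (Commute.one_right (f - 1)).exists_add_pow_prime_pow_eq hp n
  rw [sub_add_cancel, hf, one_pow] at h1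
  have h2 : (f - 1) ^ p ^ n = - ((p : AddMonoid.End U) * ((f - 1) * 1 * r)) := by
    have : (1 : AddMonoid.End U) = (f - 1) ^ p ^ n + 1 + (p : AddMonoid.End U) * ((f - 1) * 1 * r) := by
      simpa only [mul_assoc] using h1
    have h3 : (f - 1) ^ p ^ n + (p : AddMonoid.End U) * ((f - 1) * 1 * r) = 0 := by
      have h4 := sub_eq_zero.2 this.symm
      rw [← h4]; abel
    exact eq_neg_of_add_eq_zero_left h3
  have h3 := DFunLike.congr_fun h2 u
  rw [AddMonoid.End.coe_pow] at h3
  refine ⟨-((f - 1) * 1 * r) u, ?_⟩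
  have h4 : (- ((p : AddMonoid.End U) * ((f - 1) * 1 * r))) u = p • -((f - 1) * 1 * r) u := by
    rw [smul_neg]
    show -((p : AddMonoid.End U) (((f - 1) * 1 * r) u)) = _
    rw [AddMonoid.End.natCast_apply]
  rw [← h4, ← h3]
  rfl

theorem card_pow_of_kill {U : Type*} [AddCommGroup U] [Finite U] {p e : ℕ} (hp : p.Prime)
    (h : ∀ u : U, p ^ e • u = 0) : ∃ a, Nat.card U = p ^ a := by
  have := Fact.mk hp
  have hU : IsPGroup p (Multiplicative U) := fun u => ⟨e, h u⟩
  obtain ⟨a, ha⟩ := IsPGroup.iff_card.1 hU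
  exact ⟨a, ha⟩

theorem kill_of_card {U : Type*} [AddCommGroup U] [Finite U] {p e m : ℕ} (hp : p.Prime)
    (h : ∀ u : U, p ^ e • u = 0) (hc : Nat.card U ≤ p ^ m) (u : U) : p ^ m • u = 0 := by
  obtain ⟨a, ha⟩ := card_pow_of_kill hp h
  rw [ha] at hc
  have : a ≤ m := (Nat.pow_le_pow_iff_right hp.one_lt).1 hc
  have h1 : Nat.card U • u = 0 := card_nsmul_eq_zero'
  obtain ⟨l, rfl⟩ := Nat.exists_eq_add_of_le this
  rw [pow_add, mul_comm, mul_smul, ← ha, h1, smul_zero]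

theorem card_ker_le_of_surj {U U' : Type*} [AddCommGroup U] [AddCommGroup U'] [Finite U] [Finite U']
    (h : U →+ U') (hsurj : Function.Surjective h)
    (π : U →+ U) (π' : U' →+ U') (hπ : ∀ u, h (π u) = π' (h u)) :
    Nat.card π'.ker ≤ Nat.card π.ker := by
  rw [card_ker_eq_coker, card_ker_eq_coker]
  let f : U ⧸ π.range →+ U' ⧸ π'.range := QuotientAddGroup.map _ _ h (by
    rintro _ ⟨u, rfl⟩; exact ⟨h u, (hπ u).symm⟩)
  have hf : Function.Surjective f := by
    intro u
    obtain ⟨u, rfl⟩ := QuotientAddGroup.mk_surjective u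
    obtain ⟨v, rfl⟩ := hsurj u
    exact ⟨(v : U ⧸ π.range), rfl⟩
  exact Nat.card_le_card_of_surjective f hf

section outer
variable {P : Type} [Group P] {p w : ℕ} {φ : MulAut P} {G0 K M N G T : Subgroup P}

namespace Env

theorem pwi_eq_bot (E : Env p w φ G0) (G : Subgroup P) : ∃ a, (PG.pw p)^[a] G = ⊥ := by
  have := E.fin
  induction hn : Nat.card G using Nat.strong_induction_on generalizing G with
  | _ n ih =>
    by_cases hG : G = ⊥
    · exact ⟨0, hG⟩
    · have hlt : PG.pw p G < G := by
        refine lt_of_le_of_ne pw_le fun h => hG ?_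
        have := nongen (T := ⊥) E.hp E.hP inferInstance (X := G) (by rw [h]; simp)
        exact le_bot_iff.1 this
      have hc : Nat.card (PG.pw p G) < n := by
        rw [← hn]
        exact Set.ncard_lt_ncard (s := (PG.pw p G : Set P)) (t := (G : Set P)) hlt (Set.toFinite _)
      obtain ⟨a, ha⟩ := ih _ hc _ rfl
      exact ⟨a + 1, ha⟩

/-- the `p^i`-power map between presentations -/
theorem powmap (E : Env p w φ G0) (hK : Good φ G0 K) {j i : ℕ} (hj : j ≤ w) {U U' : Type}
    [AddCommGroup U] [AddCommGroup U'] {q : P → U} {q' : P → U'} (hq : Quo K ((PG.pw p)^[j] K) q)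
    {K' : Subgroup P} (hK' : K' = (PG.pw p)^[i] K)
    (hq' : Quo K' ((PG.pw p)^[j] K') q') :
    ∃ h : U →+ U', Function.Surjective h ∧ ∀ x ∈ K, h (q x) = q' (x ^ (p ^ i)) := by
  subst hK'
  have hle : (PG.pw p)^[w + i] K ≤ (PG.pw p)^[j] ((PG.pw p)^[i] K) := by
    rw [pwi_add]; exact pwi_anti (by omega)
  obtain ⟨h, hh⟩ := hq.lift (fun x => q' (x ^ (p ^ i))) (by
    intro x hx y hy
    have hxi := pow_mem_pwi (p := p) i hx
    have hyi := pow_mem_pwi (p := p) i hy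
    rw [← hq'.add _ hxi _ hyi]
    rw [hq'.eq_iff (pow_mem_pwi i (mul_mem hx hy)) (mul_mem hxi hyi)]
    exact mk_eq_mono hle (E.mulpow hK i hx hy)) (by
    intro x hx hxT
    rw [hq'.ker _ (pow_mem_pwi i hx), pwi_add, add_comm]
    exact pow_mem_pwi' i hxT)
  refine ⟨h, ?_, hh⟩
  intro u
  obtain ⟨y, hy, rfl⟩ := hq'.surj u
  obtain ⟨x, hx, hxy⟩ := E.rep hK i hy
  refine ⟨q x, ?_⟩
  rw [hh x hx, hq'.eq_iff (pow_mem_pwi i hx) hy]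
  exact mk_eq_mono hle hxy

theorem kill {j : ℕ} {U : Type} [AddCommGroup U] {q : P → U}
    (hq : Quo K ((PG.pw p)^[j] K) q) (u : U) : p ^ j • u = 0 := by
  obtain ⟨x, hx, rfl⟩ := hq.surj u
  rw [← hq.pow hx, hq.ker _ (K.pow_mem hx _)]
  exact pow_mem_pwi j hx

theorem homog (E : Env p w φ G0) (hK : Good φ G0 K) {S : ℕ} (hS : S ≤ w) (hu : Unif p K S)
    {U : Type} [AddCommGroup U] {q : P → U}
    (hq : Quo K ((PG.pw p)^[S] K) q) (j : ℕ) (hj : j ≤ S) (u : U) (hu0 : p ^ j • u = 0) :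
    ∃ v, u = p ^ (S - j) • v := by
  obtain ⟨x, hx, rfl⟩ := hq.surj u
  rw [← hq.pow hx, hq.ker _ (K.pow_mem hx _)] at hu0
  have h1 : x ∈ (PG.pw p)^[S - j] K := hu.root (e := j) (by omega) hx (by
    convert hu0 using 2; omega)
  obtain ⟨z, hz, hzx⟩ := E.rep hK _ h1
  refine ⟨q z, ?_⟩
  rw [← hq.pow hz, eq_comm, hq.eq_iff (K.pow_mem hz _) hx]
  exact mk_eq_mono (pwi_anti (by omega)) hzx

/-- `φ` has at most `p^r` fixed points on `K / K^{p^S}` -/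
def _root_.PG.CofLe (p S : ℕ) (φ : MulAut P) (K : Subgroup P) (r : ℕ) : Prop :=
  ∃ (U : Type) (_ : AddCommGroup U) (q : P → U) (F : U →+ U), Quo K ((PG.pw p)^[S] K) q ∧
    (∀ x ∈ K, F (q x) = q (φ x)) ∧ Nat.card (F - AddMonoidHom.id U : U →+ U).ker ≤ p ^ r

theorem quo_exists (E : Env p w φ G0) (hK : Good φ G0 K) {S : ℕ} (hS : S ≤ w) :
    ∃ (U : Type) (_ : AddCommGroup U) (q : P → U) (F : U →+ U), Quo K ((PG.pw p)^[S] K) q ∧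
    (∀ x ∈ K, F (q x) = q (φ x)) := by
  obtain ⟨U, i, q, hq⟩ := exists_quo (K := K) (hK.1.pwi (p := p) S).1
    ((E.cc hK).trans (pwi_anti (by omega)))
  obtain ⟨F, hF⟩ := hq.endo φ.toMonoidHom hK.1.2 (hK.1.pwi S).2
  exact ⟨U, i, q, F, hq, hF⟩

theorem ker_card_fix {U : Type} [AddCommGroup U] (F : U →+ U) :
    Nat.card (F - AddMonoidHom.id U : U →+ U).ker = Nat.card {u : U // F u = u} := by
  refine Nat.card_congr (Equiv.subtypeEquivRight ?_)
  intro u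
  rw [AddMonoidHom.mem_ker, AddMonoidHom.sub_apply, AddMonoidHom.id_apply, sub_eq_zero]

theorem fix_le (E : Env p w φ G0) (hK : Good φ G0 K) {m S : ℕ}
    (hm : Nat.card {x // φ x = x} ≤ p ^ m) {U : Type} [AddCommGroup U] {q : P → U} {F : U →+ U}
    (hq : Quo K ((PG.pw p)^[S] K) q) (hF : ∀ x ∈ K, F (q x) = q (φ x)) :
    Nat.card (F - AddMonoidHom.id U : U →+ U).ker ≤ p ^ m := by
  have := E.fin
  rw [ker_card_fix]
  exact (hq.card_fix (pwi_le S) (hK.1.pwi S).1 φ.toMonoidHom (hK.1.pwi S).2 hF hK.1.2).trans hm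

theorem cofLe_m (E : Env p w φ G0) (hK : Good φ G0 K) {m S : ℕ} (hS : S ≤ w)
    (hm : Nat.card {x // φ x = x} ≤ p ^ m) : CofLe p S φ K m := by
  obtain ⟨U, i, q, F, hq, hF⟩ := E.quo_exists hK hS
  exact ⟨U, i, q, F, hq, hF, E.fix_le hK hm hq hF⟩

theorem cof_comm (hK : Good φ G0 K) {i : ℕ} {U U' : Type}
    [AddCommGroup U] [AddCommGroup U'] {q : P → U} {q' : P → U'} {T : Subgroup P}
    (hq : Quo K T q) {F : U →+ U} {F' : U' →+ U'}
    (hF : ∀ x ∈ K, F (q x) = q (φ x)) (hF' : ∀ x ∈ (PG.pw p)^[i] K, F' (q' x) = q' (φ x))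
    {h : U →+ U'} (hh : ∀ x ∈ K, h (q x) = q' (x ^ (p ^ i))) (u : U) :
    h ((F - AddMonoidHom.id U : U →+ U) u) = (F' - AddMonoidHom.id U' : U' →+ U') (h u) := by
  obtain ⟨x, hx, rfl⟩ := hq.surj u
  rw [AddMonoidHom.sub_apply, AddMonoidHom.sub_apply, AddMonoidHom.id_apply, AddMonoidHom.id_apply,
    map_sub, hF _ hx, hh _ hx, hh _ (hK.1.2 x hx), hF' _ (pow_mem_pwi i hx), map_pow]

theorem cofLe_pwi (E : Env p w φ G0) (hK : Good φ G0 K) {r S : ℕ} (hS : S ≤ w)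
    (h : CofLe p S φ K r) (i : ℕ) : CofLe p S φ ((PG.pw p)^[i] K) r := by
  have := E.fin
  obtain ⟨U, _, q, F, hq, hF, hc⟩ := h
  obtain ⟨U', _, q', F', hq', hF'⟩ := E.quo_exists (hK.pwi (p := p) i) hS
  obtain ⟨h, hs, hh⟩ := E.powmap hK hS hq rfl hq'
  have := hq.finite
  have := hq'.finite
  exact ⟨U', _, q', F', hq', hF', (card_ker_le_of_surj h hs _ _
    (cof_comm hK hq hF hF' hh)).trans hc⟩

theorem F_iter {U : Type} [AddCommGroup U] {q : P → U} {T : Subgroup P} (hK : Adm φ K)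
    (hq : Quo K T q) {F : U →+ U} (hF : ∀ x ∈ K, F (q x) = q (φ x)) {l : ℕ} (hφ : φ ^ l = 1)
    (u : U) : F^[l] u = u := by
  obtain ⟨x, hx, rfl⟩ := hq.surj u
  have : ∀ l, (φ ^ l) x ∈ K ∧ F^[l] (q x) = q ((φ ^ l) x) := by
    intro l
    induction l with
    | zero => simp [hx]
    | succ l ih =>
      rw [Function.iterate_succ_apply', ih.2, hF _ ih.1, pow_succ']
      exact ⟨hK.2 _ ih.1, rfl⟩
  rw [(this l).2, hφ]; rfl

theorem cof_drop (E : Env p w φ G0) (hK : Good φ G0 K) {m n r S i : ℕ} (hS : S ≤ w)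
    (hSm : S = m + 1) (hm : Nat.card {x // φ x = x} ≤ p ^ m) (hφ : φ ^ (p ^ n) = 1)
    (h : CofLe p S φ K r) (hu : Unif p K S) (hu' : Unif p ((PG.pw p)^[i] K) S)
    {y : P} (hy : y ∈ K) (hy1 : y ∉ PG.pw p K) (hyi : y ^ (p ^ i) ∈ (PG.pw p)^[i + 1] K) :
    ∃ r', r = r' + 1 ∧ CofLe p S φ ((PG.pw p)^[i] K) r' := by
  have := E.fin
  obtain ⟨U, _, q, F, hq, hF, hc⟩ := h
  obtain ⟨U', _, q', F', hq', hF'⟩ := E.quo_exists (hK.pwi (p := p) i) hS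
  obtain ⟨h, hs, hh⟩ := E.powmap hK hS hq rfl hq'
  have := hq.finite
  have := hq'.finite
  have hlt : Nat.card (F' - AddMonoidHom.id U' : U' →+ U').ker <
      Nat.card (F - AddMonoidHom.id U : U →+ U).ker := by
    refine lemmaA (p := p) (m := m) (S := S) (N := p ^ n) hSm h hs _ _
      (cof_comm hK hq hF hF' hh)
      (kill hq) (E.homog (hK.pwi i) hS hu' hq') ?_ (nilp E.hp F (F_iter hK.1 hq hF hφ)) ?_
    · intro u hu0
      have := kill_of_card (U := (F' - AddMonoidHom.id U' : U' →+ U').ker) (e := S) E.hp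
        (fun u => Subtype.ext (kill hq' u.1)) (E.fix_le (hK.pwi i) hm hq' hF') ⟨u, hu0⟩
      exact congrArg Subtype.val this
    · refine ⟨q (y ^ (p ^ (S - 1))), ?_, ?_⟩
      · rw [Ne, hq.ker _ (K.pow_mem hy _)]
        intro hmem
        apply hy1
        refine hu.root (e := S - 1) (b := 1) (by omega) hy ?_
        convert hmem using 2; omega
      · rw [hh _ (K.pow_mem hy _), hq'.ker _ (pow_mem_pwi i (K.pow_mem hy _)), pwi_add,
          ← pow_mul, mul_comm, pow_mul]
        have := pow_mem_pwi' (S - 1) hyi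
        convert this using 2; omega
  have hlt2 := hlt.trans_le hc
  obtain ⟨a, ha⟩ := card_pow_of_kill (U := (F' - AddMonoidHom.id U' : U' →+ U').ker) (e := S) E.hp
        (fun u => Subtype.ext (kill hq' u.1))
  rw [ha] at hlt2
  have har : a < r := (Nat.pow_lt_pow_iff_right E.hp.one_lt).1 hlt2
  refine ⟨r - 1, by omega, U', _, q', F', hq', hF', ?_⟩
  rw [ha]
  exact Nat.pow_le_pow_right E.hp.pos (by omega)

theorem card_quo {U : Type} [AddCommGroup U] {q : P → U}
    (hq : Quo K T q) : Nat.card U = T.relIndex K := by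
  rw [Subgroup.relIndex, Subgroup.index]
  symm
  refine Nat.card_congr (Equiv.ofBijective (Quotient.lift (fun x : K => q x.1) ?_) ⟨?_, ?_⟩)
  · intro a b hab
    rw [hq.eq_iff a.2 b.2, QuotientGroup.eq]
    have := QuotientGroup.leftRel_apply.1 hab
    exact this
  · intro a b
    obtain ⟨a, rfl⟩ := QuotientGroup.mk_surjective a
    obtain ⟨b, rfl⟩ := QuotientGroup.mk_surjective b
    intro hab
    have hab : q a.1 = q b.1 := hab
    rw [hq.eq_iff a.2 b.2, QuotientGroup.eq] at hab
    exact QuotientGroup.eq.2 hab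
  · intro u
    obtain ⟨x, hx, rfl⟩ := hq.surj u
    exact ⟨QuotientGroup.mk (⟨x, hx⟩ : K), rfl⟩

/-- pigeonhole -/
theorem unif_exists (E : Env p w φ G0) (hw : 1 ≤ w) {B : ℕ}
    (hB : ∀ K, Good φ G0 K → (PG.pw p K).relIndex K ≤ B) (hK : Good φ G0 K) (S : ℕ) (hS1 : 1 ≤ S) :
    ∃ i ≤ B * S, Unif p ((PG.pw p)^[i] K) S := by
  have := E.fin
  have hq : ∀ i, ∃ (U : Type) (_ : AddCommGroup U) (q : P → U) (F : U →+ U),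
    Quo ((PG.pw p)^[i] K) ((PG.pw p)^[1] ((PG.pw p)^[i] K)) q ∧
    (∀ x ∈ (PG.pw p)^[i] K, F (q x) = q (φ x)) := fun i => E.quo_exists (hK.pwi i) hw
  choose U inst q F hq _ using hq
  have hfin : ∀ i, Finite (U i) := fun i => (hq i).finite
  have hmap : ∀ i, ∃ h : U i →+ U (i+1), Function.Surjective h ∧
      ∀ x ∈ (PG.pw p)^[i] K, h (q i x) = q (i + 1) (x ^ p) := by
    intro i
    have := E.powmap (hK.pwi (p := p) i) (i := 1) hw (hq i) (K' := (PG.pw p)^[i+1] K)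
      (by rw [pwi_add, add_comm]) (hq (i+1))
    simpa using this
  choose h hs hh using hmap
  let v : ℕ → ℕ := fun i => Nat.card (U i)
  have hv : Antitone v := antitone_nat_of_succ_le fun i => Nat.card_le_card_of_surjective _ (hs i)
  have hvB : v 0 ≤ B := by
    show Nat.card (U 0) ≤ B
    rw [card_quo (hq 0)]
    exact hB K hK
  have hvpos : ∀ i, 0 < v i := fun i => Nat.card_pos
  obtain ⟨j, hjB, hj⟩ : ∃ j ≤ B, v (j * S) = v (j * S + (S - 1)) := by
    by_contra hcon
    push Not at hcon
    have : ∀ j ≤ B + 1, v (j * S) + j ≤ v 0 := by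
      intro j
      induction j with
      | zero => simp
      | succ j ih =>
        intro hj
        have h1 := ih (by omega)
        have h2 := lt_of_le_of_ne (hv (show j * S ≤ j * S + (S - 1) by omega)) (hcon j (by omega)).symm
        have h3 : v ((j + 1) * S) ≤ v (j * S + (S - 1)) := hv (by rw [add_mul]; omega)
        omega
    have := this (B + 1) le_rfl
    have := hvpos ((B + 1) * S)
    omega
  refine ⟨j * S, Nat.mul_le_mul_right _ hjB, ?_⟩
  intro i hi x hx hxp
  rw [pwi_add] at *
  set t := i + j * S with ht
  have hxp' : x ^ p ∈ (PG.pw p)^[1] ((PG.pw p)^[t + 1] K) := by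
    rw [pwi_add]; convert hxp using 2; omega
  have hgoal : (PG.pw p)^[i + 1 + j * S] K = (PG.pw p)^[1] ((PG.pw p)^[t] K) := by
    rw [pwi_add]; congr 1; omega
  rw [hgoal, ← (hq t).ker _ hx]
  have hinj : Function.Injective (h t) := by
    have e1 : v t = v (t + 1) := by
      have a1 := hv (show j * S ≤ t by omega)
      have a2 := hv (show t + 1 ≤ j * S + (S - 1) by omega)
      have a3 := hv (show t ≤ t + 1 by omega)
      omega
    exact ((Nat.bijective_iff_surjective_and_card (h t)).2 ⟨hs t, e1⟩).1
  apply hinj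
  rw [map_zero, hh t x hx, (hq (t + 1)).ker _ (by rw [pwi_succ]; exact pow_mem_pw hx)]
  exact hxp'

/-- class bound -/
def _root_.PG.gfun (C : ℕ) : ℕ → ℕ
  | 0 => C
  | r + 1 => C * (gfun C r + 1) + gfun C r

theorem _root_.PG.le_gfun (C r : ℕ) : C ≤ gfun C r := by
  cases r with
  | zero => exact le_rfl
  | succ r => rw [gfun]; nlinarith [Nat.zero_le (gfun C r)]

theorem outer (E : Env p w φ G0) {s c : ℕ} (hD : StepD p w s c φ G0) (hsw : s ≤ w) (hcw : c ≤ w)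
    (hc : 2 ≤ c) {B m n S : ℕ} (hS : S ≤ w) (hSm : S = m + 1)
    (hB : ∀ K, Good φ G0 K → (PG.pw p K).relIndex K ≤ B)
    (hm : Nat.card {x // φ x = x} ≤ p ^ m) (hφ : φ ^ (p ^ n) = 1) (r : ℕ) :
    ∀ G, Good φ G0 G → CofLe p S φ G r →
      itc ((PG.pw p)^[2 * B * S * (r + 1)] G) ((PG.pw p)^[2 * B * S * (r + 1)] G)
        (gfun (c * (3 * c)) r) = ⊥ := by
  have hw : 1 ≤ w := by omega
  have step : ∀ r G, Good φ G0 G → CofLe p S φ G r →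
      (∃ i ≤ B * S, itc ((PG.pw p)^[i] G) ((PG.pw p)^[i] G) (c * (3 * c)) = ⊥) ∨
      (∃ r', r = r' + 1 ∧ ∃ i0 ≤ B * S, ∃ i1 ≤ B * S, ∃ a,
        itc ((PG.pw p)^[i0] G) ((PG.pw p)^[i0] G) (c * (3 * c)) ≤ (PG.pw p)^[a + i0] G ∧
        CofLe p S φ ((PG.pw p)^[a + i1 + i0] G) r') := by
    intro r G hG hcof
    obtain ⟨i0, hi0, hu⟩ := E.unif_exists hw hB hG S (by omega)
    have hG1 := hG.pwi (p := p) i0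
    by_cases hall : ∀ a, Unif p ((PG.pw p)^[i0] G) a
    · left
      refine ⟨i0, hi0, ?_⟩
      obtain ⟨a, ha⟩ := E.pwi_eq_bot ((PG.pw p)^[i0] G)
      have := E.core hD hsw hcw hc hG1 (hall a)
      rw [ha] at this
      exact le_bot_iff.1 this
    · right
      push Not at hall
      classical
      obtain ⟨a, ha, hna⟩ : ∃ a, Unif p ((PG.pw p)^[i0] G) a ∧ ¬ Unif p ((PG.pw p)^[i0] G) (a + 1) := by
        by_contra hcon
        push Not at hcon
        obtain ⟨b, hb⟩ := hall
        apply hb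
        induction b with
        | zero => intro i hi; omega
        | succ b ihb =>
          apply hcon
          by_contra h
          exact h (ihb h)
      set G1 := (PG.pw p)^[i0] G with hG1d
      have haS : S ≤ a := by
        by_contra h
        exact hna (hu.mono (by omega))
      unfold Unif at hna
      push Not at hna
      obtain ⟨i, hi, x, hx, hxp, hxn⟩ := hna
      have hia : i + 1 = a := by
        by_contra h
        exact hxn (ha i (by omega) x hx hxp)
      obtain ⟨y, hy, hyx⟩ := E.rep hG1 i hx
      have hyn : y ∉ PG.pw p G1 := by
        intro h
        apply hxn
        rw [← mem_iff_of_mk_eq (T' := (PG.pw p)^[i + 1] G1) (pwi_anti (by omega)) hyx]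
        exact pow_mem_pwi (p := p) i h
      have hya : y ^ (p ^ a) ∈ (PG.pw p)^[a + 1] G1 := by
        have hN := (hG1.pwi (p := p) (a + 1)).1.1
        rw [← hia]
        rw [QuotientGroup.eq] at hyx
        set t := (y ^ (p ^ i))⁻¹ * x with ht
        have hxe : y ^ (p ^ i) = x * t⁻¹ := by rw [ht]; group
        have hcc : ⁅(PG.pw p)^[i] G1, (PG.pw p)^[i] G1⁆ ≤ (PG.pw p)^[a + 1] G1 := by
          refine (E.cc (hG1.pwi i)).trans ?_
          rw [pwi_add]
          exact pwi_anti (by omega)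
        have htp : t⁻¹ ^ p ∈ (PG.pw p)^[a + 1] G1 := by
          have := pow_mem_pwi' (p := p) 1 (inv_mem hyx)
          rw [pow_one] at this
          exact pwi_anti (by omega) this
        have h2 := mk_mul_pow hcc hx (inv_mem (pwi_anti (by omega) hyx)) p
        rw [pow_succ, pow_mul, hxe]
        rw [hia]
        rw [mem_iff_of_mk_eq le_rfl h2]
        refine mul_mem ?_ htp
        rw [← hia]; exact hxp
      obtain ⟨i1, hi1, hu1⟩ := E.unif_exists hw hB (hG1.pwi a) S (by omega)
      rw [pwi_add] at hu1
      have hcof1 := E.cofLe_pwi hG hS hcof i0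
      have hyi : y ^ (p ^ (i1 + a)) ∈ (PG.pw p)^[i1 + a + 1] G1 := by
        rw [add_comm i1 a, pow_add, pow_mul]
        have := pow_mem_pwi' i1 hya
        convert this using 2; omega
      obtain ⟨r', hr', hcof'⟩ := E.cof_drop hG1 hS hSm hm hφ hcof1 hu hu1 hy hyn hyi
      refine ⟨r', hr', i0, hi0, i1, hi1, a, ?_, ?_⟩
      · rw [← pwi_add]
        exact E.core hD hsw hcw hc hG1 ha
      · rw [hG1d, pwi_add] at hcof'
        convert hcof' using 2; omega
  induction r with
  | zero =>
    intro G hG hcof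
    rcases step 0 G hG hcof with ⟨i, hi, h⟩ | ⟨r', hr', _⟩
    · rw [eq_bot_iff, ← h]
      exact itc_both_mono (pwi_anti (by nlinarith)) _
    · omega
  | succ r ih =>
    intro G hG hcof
    rcases step (r + 1) G hG hcof with ⟨i, hi, h⟩ | ⟨r', hr', i0, hi0, i1, hi1, a, hcore, hcof'⟩
    · rw [eq_bot_iff, ← h]
      exact (itc_both_mono (pwi_anti (by nlinarith)) _).trans (itc_anti (le_gfun _ _))
    · have hrr : r' = r := by omega
      subst hrr
      have h1 := ih _ (hG.pwi _) hcof'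
      rw [pwi_add] at h1
      set τ := 2 * B * S * (r' + 1) with hτ
      set C := c * (3 * c) with hC
      set g := gfun C r' with hg
      set H := (PG.pw p)^[i1 + τ + i0] G with hH
      have hHg : Good φ G0 H := hG.pwi _
      have e1 : (PG.pw p)^[τ + (a + i1 + i0)] G = (PG.pw p)^[a] H := by
        rw [hH, pwi_add]; congr 1; omega
      rw [e1] at h1
      have h2 : itc H H C ≤ (PG.pw p)^[a] H := by
        have e2 : H = (PG.pw p)^[i1 + τ] ((PG.pw p)^[i0] G) := by rw [hH, pwi_add]
        rw [e2, E.lcs_pwi hw (hG.pwi i0), pwi_add, pwi_add]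
        refine (pwi_mono _ hcore).trans ?_
        rw [pwi_add]
        exact pwi_anti (by nlinarith [Nat.zero_le ((i1 + τ) * C)])
      have h3 := E.lcs_mul hw hHg h2 (g + 1)
      have h4 : itc H H (C * (g + 1) + g) = ⊥ := by
        rw [← itc_itc, eq_bot_iff]
        refine (itc_mono h3 g).trans ?_
        rw [E.itc_pwi hw hHg hHg.1, ← E.lcs_pwi hw hHg, h1]
      rw [gfun, eq_bot_iff, ← h4]
      refine itc_both_mono (pwi_anti ?_) _
      have : 2 * B * S * (r' + 1 + 1) = τ + 2 * (B * S) := by rw [hτ]; ring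
      omega

end Env
end outer
end PG
namespace PG
section abbound

theorem card_ker_comp {U : Type*} [AddCommGroup U] [Finite U] (f g : U →+ U) :
    Nat.card (f.comp g).ker ≤ Nat.card f.ker * Nat.card g.ker := by
  let h : (f.comp g).ker →+ f.ker :=
    (g.comp (f.comp g).ker.subtype).codRestrict f.ker (fun x => x.2)
  have h1 := h.ker.card_eq_card_quotient_mul_card_addSubgroup
  have h3 : Nat.card ((f.comp g).ker ⧸ h.ker) = Nat.card h.range :=
    Nat.card_congr (QuotientAddGroup.quotientKerEquivRange h).toEquiv
  rw [h1, h3]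
  apply Nat.mul_le_mul
  · exact Nat.card_le_card_of_injective _ Subtype.val_injective
  · refine Nat.card_le_card_of_injective (fun x => (⟨x.1.1, ?_⟩ : g.ker)) ?_
    · have := x.2
      rw [AddMonoidHom.mem_ker] at this ⊢
      exact congrArg Subtype.val this
    · intro x y hxy
      apply Subtype.ext; apply Subtype.ext
      simpa using hxy

def itHom {U : Type*} [AddCommGroup U] (f : U →+ U) : ℕ → (U →+ U)
  | 0 => AddMonoidHom.id U
  | i + 1 => (itHom f i).comp f

theorem itHom_apply {U : Type*} [AddCommGroup U] (f : U →+ U) (i : ℕ) (u : U) :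
    itHom f i u = f^[i] u := by
  induction i generalizing u with
  | zero => rfl
  | succ i ih => rw [Function.iterate_succ_apply, ← ih]; rfl

theorem card_ker_pow {U : Type*} [AddCommGroup U] [Finite U] (f : U →+ U) {b : ℕ}
    (hb : Nat.card f.ker ≤ b) (i : ℕ) :
    Nat.card (itHom f i).ker ≤ b ^ i := by
  induction i with
  | zero =>
    have : (itHom f 0).ker = ⊥ := by
      ext x; simp [AddMonoidHom.mem_ker, itHom]
    rw [this]; simp
  | succ i ih =>
    rw [pow_succ]
    exact (card_ker_comp _ _).trans (Nat.mul_le_mul ih hb)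

theorem ab_bound {U : Type*} [AddCommGroup U] [Finite U] {p n m e : ℕ} (hp : p.Prime) (F : U →+ U)
    (hF : ∀ u, F^[p ^ n] u = u) (hm : Nat.card {u // F u = u} ≤ p ^ m)
    (he : ∀ u : U, p ^ e • u = 0) : Nat.card U ≤ ((p ^ m) ^ (p ^ n)) ^ e := by
  have h1 : Nat.card (F - AddMonoidHom.id U : U →+ U).ker ≤ p ^ m := by
    refine le_trans ?_ hm
    refine Nat.card_le_card_of_injective (fun x => ⟨x.1, ?_⟩) ?_
    · exact sub_eq_zero.1 x.2
    · intro x y hxy; exact Subtype.ext (by simpa using hxy)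
  have h2 := card_ker_pow _ h1 (p ^ n)
  let P : U →+ U := nsmulAddMonoidHom p
  have hP : ∀ u, P u = p • u := fun u => rfl
  have h3 : Nat.card P.ker ≤ (p ^ m) ^ (p ^ n) := by
    refine le_trans ?_ h2
    rw [card_ker_eq_coker P, card_ker_eq_coker]
    have hle : (itHom (F - AddMonoidHom.id U : U →+ U) (p ^ n)).range ≤ P.range := by
      rintro _ ⟨u, rfl⟩
      obtain ⟨v, hv⟩ := nilp hp F hF u
      refine ⟨v, ?_⟩
      rw [hP, ← hv, itHom_apply]
    exact Nat.card_le_card_of_surjective (QuotientAddGroup.map _ _ (AddMonoidHom.id U) hle) (by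
      intro u
      obtain ⟨u, rfl⟩ := QuotientAddGroup.mk_surjective u
      exact ⟨(u : U ⧸ _), rfl⟩)
  have h4 := card_ker_pow _ h3 e
  have h5 : (itHom P e).ker = ⊤ := by
    ext u
    simp only [AddSubgroup.mem_top, iff_true, AddMonoidHom.mem_ker]
    rw [itHom_apply, ← he u]
    generalize e = e
    induction e with
    | zero => simp
    | succ i ih => rw [Function.iterate_succ_apply', ih, hP, smul_smul, pow_succ']
  rw [h5] at h4
  simpa using h4
end abbound

section maxab
variable {X : Type} [Group X]

def ABm (φ : MulAut X) (A : Subgroup X) : Prop := Adm φ A ∧ ∀ x ∈ A, ∀ y ∈ A, x * y = y * x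

instance : ((MulAut.conj : X →* MulAut X).range).Normal := by
  constructor
  rintro _ ⟨x, rfl⟩ g
  exact ⟨g x, by ext y; simp⟩

open Pointwise in
theorem exists_self_cent [Finite X] {p n : ℕ} (hp : p.Prime) (hX : IsPGroup p X) (φ : MulAut X)
    (hφ : φ ^ (p ^ n) = 1) : ∃ A : Subgroup X, ABm φ A ∧ Subgroup.centralizer (A : Set X) ≤ A := by
  have := Fact.mk hp
  obtain ⟨A, hA⟩ := Set.Finite.exists_maximal (Set.toFinite {A : Subgroup X | ABm φ A})
    ⟨⊥, ⟨inferInstance, by simp⟩, by simp⟩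
  refine ⟨A, hA.1, ?_⟩
  by_contra hC
  set C := Subgroup.centralizer (A : Set X) with hCd
  have hAn : A.Normal := hA.1.1.1
  have hφA := hA.1.1.2
  have hcn : C.Normal := Subgroup.normal_centralizer
  let Γ : Subgroup (MulAut X) := (MulAut.conj : X →* MulAut X).range ⊔ Subgroup.zpowers φ
  have hΓ : IsPGroup p Γ := by
    apply IsPGroup.to_sup_of_normal_left
    · exact hX.of_surjective MulAut.conj.rangeRestrict MulAut.conj.rangeRestrict_surjective
    · rintro ⟨y, k, rfl⟩
      refine ⟨n, Subtype.ext ?_⟩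
      simp only [Subgroup.coe_pow, Subgroup.coe_one]
      rw [← zpow_natCast, ← zpow_mul, mul_comm, zpow_mul, zpow_natCast, hφ, one_zpow]
  have hΓle : Γ ≤ MulAction.stabilizer (MulAut X) A := by
    refine sup_le ?_ ?_
    · rintro _ ⟨x, rfl⟩
      exact Subgroup.Normal.conj_smul_eq_self x A
    · rw [Subgroup.zpowers_le]
      refine Subgroup.eq_of_le_of_card_ge ?_ ?_
      · intro x hx
        obtain ⟨y, hy, rfl⟩ := hx
        exact hφA y hy
      · exact (Nat.card_congr (Subgroup.equivSMul φ A).toEquiv).le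
  have hΓA : ∀ γ ∈ Γ, ∀ a ∈ A, γ a ∈ A := by
    intro γ hγ a ha
    have h1 : γ • A = A := hΓle hγ
    rw [← h1]
    exact ⟨a, ha, rfl⟩
  have hΓC : ∀ γ ∈ Γ, ∀ a ∈ C, γ a ∈ C := by
    intro γ hγ c hc
    rw [Subgroup.mem_centralizer_iff] at hc ⊢
    intro a ha
    have := hc _ (hΓA _ (inv_mem hγ) a ha)
    have := congrArg γ this
    simpa using this
  let Y := C.map (QuotientGroup.mk' A)
  let act : MulAction Γ Y :=
    { smul := fun γ y => ⟨QuotientGroup.map A A γ.1.toMonoidHom (fun a ha => hΓA _ γ.2 a ha) y.1, by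
        obtain ⟨c, hc, h⟩ := y.2
        exact ⟨γ.1 c, hΓC _ γ.2 c hc, by rw [← h]; rfl⟩⟩
      one_smul := by
        rintro ⟨_, c, hc, rfl⟩; rfl
      mul_smul := by
        rintro γ δ ⟨_, c, hc, rfl⟩; rfl }
  have hdvd : p ∣ Nat.card Y := by
    have hY : IsPGroup p Y := (hX.to_quotient A).to_subgroup Y
    have : Nontrivial Y := by
      obtain ⟨c, hc, hcA⟩ := SetLike.not_le_iff_exists.1 hC
      refine ⟨⟨_, c, hc, rfl⟩, 1, fun h => hcA ?_⟩
      have := congrArg Subtype.val h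
      exact (QuotientGroup.eq_one_iff c).1 this
    obtain ⟨k, hk, h⟩ := hY.nontrivial_iff_card.1 this
    rw [h]; exact dvd_pow_self p hk.ne'
  have h1 : (1 : Y) ∈ MulAction.fixedPoints Γ Y := by
    intro γ
    apply Subtype.ext
    exact map_one _
  obtain ⟨⟨_, c, hc, rfl⟩, hb, hne⟩ := hΓ.exists_fixed_point_of_prime_dvd_card_of_fixed_point Y hdvd h1
  have hcA : c ∉ A := by
    intro hcA
    apply hne
    exact Subtype.ext ((QuotientGroup.eq_one_iff c).2 hcA).symm
  have hfix : ∀ γ ∈ Γ, ∃ a ∈ A, γ c = c * a := by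
    intro γ hγ
    have := congrArg Subtype.val (hb ⟨γ, hγ⟩)
    have : ((γ c : X) : X ⧸ A) = c := this
    rw [eq_comm, QuotientGroup.eq] at this
    exact ⟨_, this, by group⟩
  let B := Subgroup.closure ((A : Set X) ∪ {c})
  have hAB : A ≤ B := fun a ha => Subgroup.subset_closure (Or.inl ha)
  have hcB : c ∈ B := Subgroup.subset_closure (Or.inr rfl)
  have hinv : ∀ γ ∈ Γ, ∀ b ∈ B, γ b ∈ B := by
    intro γ hγ b hb
    have : B ≤ B.comap γ.toMonoidHom := by
      refine (Subgroup.closure_le _).2 ?_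
      rintro x (hx | rfl)
      · exact hAB (hΓA _ hγ x hx)
      · obtain ⟨a, ha, h⟩ := hfix γ hγ
        show γ x ∈ B
        rw [h]; exact mul_mem hcB (hAB ha)
    exact this hb
  have hBm : ABm φ B := by
    refine ⟨⟨⟨fun b hb x => ?_⟩, ?_⟩, ?_⟩
    · exact hinv (MulAut.conj x) (Subgroup.mem_sup_left ⟨x, rfl⟩) b hb
    · exact hinv φ (Subgroup.mem_sup_right (Subgroup.mem_zpowers φ))
    · have := Subgroup.isMulCommutative_closure (k := (A : Set X) ∪ {c}) (by
        have hc' := Subgroup.mem_centralizer_iff.1 hc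
        rintro x (hx | rfl) y (hy | rfl)
        · exact hA.1.2 x hx y hy
        · exact hc' x hx
        · exact (hc' y hy).symm
        · rfl)
      intro x hx y hy
      exact setLike_mul_comm (s := B) hx hy
  exact hcA (hA.2 hBm hAB hcB)

def Bd (p n m e : ℕ) : ℕ := ((p ^ m) ^ (p ^ n)) ^ e * (((p ^ m) ^ (p ^ n)) ^ e).factorial

theorem card_bound [Finite X] {p n m e : ℕ} (hp : p.Prime) (hX : IsPGroup p X) (φ : MulAut X)
    (hφ : φ ^ (p ^ n) = 1) (hm : Nat.card {x // φ x = x} ≤ p ^ m) (he : ∀ x : X, x ^ (p ^ e) = 1) :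
    Nat.card X ≤ Bd p n m e := by
  obtain ⟨A, hA, hC⟩ := exists_self_cent hp hX φ hφ
  have hAn : A.Normal := hA.1.1
  have hA1 : Nat.card A ≤ ((p ^ m) ^ (p ^ n)) ^ e := by
    obtain ⟨U, _, q, hq⟩ := exists_quo (K := A) (T := ⊥) inferInstance (by
      rw [Subgroup.commutator_le]
      intro x hx y hy
      rw [Subgroup.mem_bot, commutatorElement_eq_one_iff_mul_comm]
      exact hA.2 x hx y hy)
    have hfin := hq.finite
    obtain ⟨F, hF⟩ := hq.endo φ.toMonoidHom hA.1.2 (by simp)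
    have h1 := hq.card_fix bot_le inferInstance φ.toMonoidHom (by simp) hF hA.1.2
    have h2 := ab_bound (n := n) (m := m) (e := e) hp F (Env.F_iter hA.1 hq hF hφ) (h1.trans hm) (by
      intro u
      obtain ⟨x, hx, rfl⟩ := hq.surj u
      rw [← hq.pow hx, he, hq.one])
    rw [Env.card_quo hq, Subgroup.relIndex_bot_left] at h2
    exact h2
  have h2 : Nat.card (X ⧸ A) ≤ (Nat.card A).factorial := by
    let f : X →* MulAut A := MulAut.conjNormal
    have hk : f.ker ≤ A := by
      intro x hx
      apply hC
      rw [Subgroup.mem_centralizer_iff]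
      intro a ha
      have h3 := DFunLike.congr_fun (MonoidHom.mem_ker.1 hx) (⟨a, ha⟩ : A)
      have h3 := congrArg Subtype.val h3
      have h3 : x * a * x⁻¹ = a := h3
      rw [mul_inv_eq_iff_eq_mul] at h3
      exact h3.symm
    calc A.index ≤ f.ker.index := Subgroup.index_antitone hk
      _ = Nat.card f.range := Subgroup.index_ker f
      _ ≤ Nat.card (MulAut A) := Nat.card_le_card_of_injective _ Subtype.val_injective
      _ ≤ Nat.card (Equiv.Perm A) := Nat.card_le_card_of_injective _ (MulEquiv.toEquiv_injective)
      _ = _ := Nat.card_perm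
  rw [A.card_eq_card_quotient_mul_card_subgroup, mul_comm]
  exact Nat.mul_le_mul hA1 (h2.trans (Nat.factorial_le hA1))
end maxab
end PG
namespace PG
section q
open scoped commutatorElement

theorem grp_fix {G H : Type} [Group G] [Group H] [Finite G] [Finite H] (f : G →* H)
    (hf : Function.Surjective f) (α : G → G) (hα : ∀ x y, α (x * y) = α x * α y) (β : H → H)
    (h : ∀ x, f (α x) = β (f x)) :
    Nat.card {x // β x = x} ≤ Nat.card {x // α x = x} := by
  classical
  choose s hs using hf
  let Y := {x : G // x⁻¹ * α x ∈ f.ker}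
  have hα' : ∀ x, α x⁻¹ = (α x)⁻¹ := by
    intro x
    have h1 : α 1 = 1 := by simpa using hα 1 1
    have := hα x x⁻¹
    rw [mul_inv_cancel, h1] at this
    exact (inv_eq_of_mul_eq_one_right this.symm).symm
  have c1 : Nat.card ({u : H // β u = u} × f.ker) ≤ Nat.card Y := by
    refine Nat.card_le_card_of_injective (fun z => ⟨s z.1.1 * z.2.1, ?_⟩) ?_
    · have h1 : f z.2.1 = 1 := z.2.2
      rw [MonoidHom.mem_ker, map_mul, map_inv, h, map_mul, h1, mul_one, hs, z.1.2, inv_mul_cancel]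
    · rintro ⟨⟨u, hu⟩, ⟨t, ht⟩⟩ ⟨⟨u', hu'⟩, ⟨t', ht'⟩⟩ heq
      have heq : s u * t = s u' * t' := congrArg Subtype.val heq
      have h2 : u = u' := by
        have := congrArg f heq
        rw [map_mul, map_mul, MonoidHom.mem_ker.1 ht, MonoidHom.mem_ker.1 ht', hs, hs] at this
        simpa using this
      subst h2
      simp at heq
      subst heq
      rfl
  have c2 : Nat.card Y ≤ Nat.card ({x : G // α x = x} × f.ker) := by
    let r : G → G := fun t => if ht : ∃ y : Y, y.1⁻¹ * α y.1 = t then ht.choose.1 else 1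
    have hr : ∀ y : Y, (r (y.1⁻¹ * α y.1))⁻¹ * α (r (y.1⁻¹ * α y.1)) = y.1⁻¹ * α y.1 := by
      intro y
      have ht : ∃ y' : Y, y'.1⁻¹ * α y'.1 = y.1⁻¹ * α y.1 := ⟨y, rfl⟩
      have : r (y.1⁻¹ * α y.1) = ht.choose.1 := dif_pos ht
      rw [this]
      exact ht.choose_spec
    refine Nat.card_le_card_of_injective
      (fun y => (⟨y.1 * (r (y.1⁻¹ * α y.1))⁻¹, ?_⟩, ⟨y.1⁻¹ * α y.1, y.2⟩)) ?_
    · have h0 := hr y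
      set z := r (y.1⁻¹ * α y.1)
      have : α z = z * (y.1⁻¹ * α y.1) := by rw [← h0]; group
      rw [hα, hα', this]; group
    · intro y y' heq
      simp only [Prod.mk.injEq, Subtype.mk.injEq] at heq
      obtain ⟨e1, e2⟩ := heq
      rw [e2] at e1
      exact Subtype.ext (mul_right_cancel e1)
  have := c1.trans c2
  rw [Nat.card_prod, Nat.card_prod] at this
  exact Nat.le_of_mul_le_mul_right this Nat.card_pos

variable {P : Type} [Group P] {p w : ℕ} {φ : MulAut P} {K T : Subgroup P}

theorem relIndex_bound [Finite P] {n m e : ℕ} (hp : p.Prime) (hP : IsPGroup p P)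
    (hφ : φ ^ (p ^ n) = 1) (hm : Nat.card {x // φ x = x} ≤ p ^ m) (hK : Adm φ K) (hT : Adm φ T)
    (he : ∀ x ∈ K, x ^ (p ^ e) ∈ T) :
    T.relIndex K ≤ Bd p n m e := by
  have hTn := hT.1
  have : (T.subgroupOf K).Normal := inferInstance
  let α : K →* K := (φ.toMonoidHom.comp K.subtype).codRestrict K (fun x => hK.2 x.1 x.2)
  have hα : Function.Injective α := by
    intro x y hxy
    exact Subtype.ext (φ.injective (congrArg Subtype.val hxy))
  have hα2 := Finite.surjective_of_injective hα
  let β : K ⧸ T.subgroupOf K →* K ⧸ T.subgroupOf K := QuotientGroup.map _ _ α (by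
    intro x hx; exact hT.2 x.1 hx)
  have hβ : Function.Surjective β := by
    intro y
    obtain ⟨y, rfl⟩ := QuotientGroup.mk_surjective y
    obtain ⟨x, rfl⟩ := hα2 y
    exact ⟨(x : K ⧸ T.subgroupOf K), rfl⟩
  let γ : MulAut (K ⧸ T.subgroupOf K) := MulEquiv.ofBijective β
    ⟨Finite.injective_iff_surjective.2 hβ, hβ⟩
  have hpow : ∀ l, ∀ x : K, ∃ h : (φ ^ l) x.1 ∈ K,
      (γ ^ l) (x : K ⧸ T.subgroupOf K) = ((⟨_, h⟩ : K) : K ⧸ T.subgroupOf K) := by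
    intro l
    induction l with
    | zero => intro x; exact ⟨x.2, rfl⟩
    | succ l ih =>
      intro x
      obtain ⟨h1, h2⟩ := ih x
      rw [pow_succ', pow_succ']
      refine ⟨hK.2 _ h1, ?_⟩
      rw [MulAut.mul_apply, h2]; rfl
  refine card_bound (X := K ⧸ T.subgroupOf K) hp ((hP.to_subgroup K).to_quotient _) γ (n := n) (m := m) ?_ ?_ ?_
  · ext y
    obtain ⟨x, rfl⟩ := QuotientGroup.mk_surjective y
    obtain ⟨h, h2⟩ := hpow (p ^ n) x
    rw [h2]
    simp [hφ]
  · refine (grp_fix (QuotientGroup.mk' (T.subgroupOf K)) (QuotientGroup.mk'_surjective _) α (map_mul α) γ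
      (fun x => rfl)).trans (le_trans ?_ hm)
    refine Nat.card_le_card_of_injective (fun x => ⟨x.1.1, congrArg Subtype.val x.2⟩) ?_
    intro x y hxy
    have hxy : x.1.1 = y.1.1 := congrArg (fun z : {x // φ x = x} => z.1) hxy
    exact Subtype.ext (Subtype.ext hxy)
  · intro y
    obtain ⟨x, rfl⟩ := QuotientGroup.mk_surjective y
    rw [← QuotientGroup.mk_pow, QuotientGroup.eq_one_iff]
    exact he x.1 x.2

/-- verbal power subgroup -/
def vp (P : Type) [Group P] (Q : ℕ) : Subgroup P := Subgroup.closure {y | ∃ x, y = x ^ Q}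

theorem vp_map (Q : ℕ) (f : P →* P) : (vp P Q).map f ≤ vp P Q := by
  rw [vp, MonoidHom.map_closure]
  refine Subgroup.closure_mono ?_
  rintro _ ⟨_, ⟨x, rfl⟩, rfl⟩
  exact ⟨f x, by simp⟩

theorem vp_adm (Q : ℕ) : Adm φ (vp P Q) := by
  refine ⟨⟨fun b hb x => ?_⟩, fun x hx => ?_⟩
  · exact vp_map Q (MulAut.conj x).toMonoidHom ⟨b, hb, rfl⟩
  · exact vp_map Q φ.toMonoidHom ⟨x, hx, rfl⟩

theorem vp_mul_le (Q τ : ℕ) : vp P (Q * p ^ τ) ≤ (pw p)^[τ] (vp P Q) := by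
  refine (Subgroup.closure_le _).2 ?_
  rintro _ ⟨x, rfl⟩
  rw [pow_mul]
  exact pow_mem_pwi τ (Subgroup.subset_closure ⟨x, rfl⟩)

theorem vp_index [Finite P] {n m e : ℕ} (hp : p.Prime) (hP : IsPGroup p P)
    (hφ : φ ^ (p ^ n) = 1) (hm : Nat.card {x // φ x = x} ≤ p ^ m) :
    (vp P (p ^ e)).index ≤ Bd p n m e := by
  rw [← Subgroup.relIndex_top_right]
  exact relIndex_bound hp hP hφ hm ⟨inferInstance, by simp⟩ (vp_adm _)
    (fun x _ => Subgroup.subset_closure ⟨x, rfl⟩)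

def Qe (p n m w : ℕ) : ℕ := (Bd p n m (w + 1)).factorial

theorem env_exists [Finite P] {n m : ℕ} (hp : p.Prime) (hP : IsPGroup p P)
    (hφ : φ ^ (p ^ n) = 1) (hm : Nat.card {x // φ x = x} ≤ p ^ m) (w : ℕ) :
    Env p w φ (vp P (p ^ Qe p n m w)) := by
  refine ⟨inferInstance, hp, hP, vp_adm _, ?_⟩
  intro K hK
  have := Fact.mk hp
  have hT : Adm φ ((pw p)^[w + 1] K) := hK.pwi _
  set T := (pw p)^[w + 1] K
  have hb : T.relIndex K ≤ Bd p n m (w + 1) := relIndex_bound hp hP hφ hm hK hT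
    (fun x hx => pow_mem_pwi _ hx)
  have hTn := hT.1
  have hKn := hK.1
  -- action on K/T
  let f : P →* Equiv.Perm (K ⧸ T.subgroupOf K) :=
    { toFun := fun g => (QuotientGroup.congr (T.subgroupOf K) (T.subgroupOf K) (MulAut.conjNormal g) (by
        ext x
        constructor
        · rintro ⟨y, hy, rfl⟩
          exact hTn.conj_mem _ hy g
        · intro hx
          refine ⟨MulAut.conjNormal g⁻¹ x, hTn.conj_mem _ hx g⁻¹, ?_⟩
          apply Subtype.ext
          simp)).toEquiv
      map_one' := by
        ext y
        obtain ⟨x, rfl⟩ := QuotientGroup.mk_surjective y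
        show ((MulAut.conjNormal 1 x : K) : K ⧸ T.subgroupOf K) = _
        simp
      map_mul' := by
        intro g h
        ext y
        obtain ⟨x, rfl⟩ := QuotientGroup.mk_surjective y
        show ((MulAut.conjNormal (g * h) x : K) : K ⧸ T.subgroupOf K) =
          ((MulAut.conjNormal g (MulAut.conjNormal h x) : K) : K ⧸ T.subgroupOf K)
        simp }
  have hQ : vp P (p ^ Qe p n m w) ≤ f.ker := by
    refine (Subgroup.closure_le _).2 ?_
    rintro _ ⟨x, rfl⟩
    show f _ = 1
    rw [map_pow]
    obtain ⟨a, ha⟩ := hP x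
    have h1 : orderOf (f x) ∣ p ^ a := orderOf_dvd_of_pow_eq_one (by rw [← map_pow, ha, map_one])
    obtain ⟨b, hb1, hb2⟩ := (Nat.dvd_prime_pow hp).1 h1
    have h3 : orderOf (f x) ≤ Qe p n m w := by
      refine (Nat.le_of_dvd ?_ (orderOf_dvd_natCard (f x))).trans ?_
      · exact Nat.card_pos
      · rw [Nat.card_perm]; exact Nat.factorial_le hb
    rw [← orderOf_dvd_iff_pow_eq_one, hb2]
    rw [hb2] at h3
    exact pow_dvd_pow _ ((Nat.lt_pow_self hp.one_lt).le.trans h3)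
  rw [Subgroup.commutator_le]
  intro x hx g hg
  have h1 : f g⁻¹ = 1 := by rw [map_inv, MonoidHom.mem_ker.1 (hQ hg), inv_one]
  have h2 : f g = 1 := MonoidHom.mem_ker.1 (hQ hg)
  have h2 := DFunLike.congr_fun h2 ((⟨x, hx⟩ : K) : K ⧸ T.subgroupOf K)
  have h2 : ((MulAut.conjNormal g ⟨x, hx⟩ : K) : K ⧸ T.subgroupOf K) = ((⟨x, hx⟩ : K) : K ⧸ T.subgroupOf K) := h2
  rw [QuotientGroup.eq] at h2
  have h3 : (g * x * g⁻¹)⁻¹ * x ∈ T := h2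
  have h4 := hTn.conj_mem _ h3 x
  convert h4 using 1
  rw [commutatorElement_def]; group
end q
end PG
namespace PG
section lie

/-- iterated products `W·(W·(⋯V))` -/
def Cser {R V : Type*} [CommRing R] [AddCommGroup V] [Module R V] (br : V →ₗ[R] V →ₗ[R] V)
    (W : Submodule R V) : ℕ → Submodule R V
  | 0 => ⊤
  | i + 1 => Submodule.span R {z | ∃ w ∈ W, ∃ v ∈ Cser br W i, z = br w v}

section
variable {R V : Type*} [CommRing R] [AddCommGroup V] [Module R V] {br : V →ₗ[R] V →ₗ[R] V}
  {W W' : Submodule R V}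

theorem Cser_mem {i : ℕ} {w v : V} (hw : w ∈ W) (hv : v ∈ Cser br W i) : br w v ∈ Cser br W (i + 1) :=
  Submodule.subset_span ⟨w, hw, v, hv, rfl⟩

theorem Cser_anti (i : ℕ) : Cser br W (i + 1) ≤ Cser br W i := by
  induction i with
  | zero => exact le_top
  | succ i ih =>
    refine Submodule.span_mono ?_
    rintro _ ⟨w, hw, v, hv, rfl⟩
    exact ⟨w, hw, v, ih hv, rfl⟩

theorem Cser_anti' {i j : ℕ} (h : i ≤ j) : Cser br W j ≤ Cser br W i :=
  antitone_nat_of_succ_le (f := Cser br W) Cser_anti h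

theorem Cser_norm (halt : ∀ x, br x x = 0)
    (hjac : ∀ x y z, br x (br y z) = br (br x y) z + br y (br x z)) {s : V}
    (hs : ∀ w ∈ W, br s w ∈ W) (i : ℕ) : ∀ v ∈ Cser br W i, br s v ∈ Cser br W i := by
  induction i with
  | zero => intro v _; exact Submodule.mem_top
  | succ i ih =>
    intro v hv
    induction hv using Submodule.span_induction with
    | mem x hx =>
      obtain ⟨w, hw, v, hv, rfl⟩ := hx
      rw [hjac]
      exact add_mem (Cser_mem (hs w hw) hv) (Cser_mem hw (ih v hv))
    | zero => simp
    | add x y _ _ hx hy => rw [map_add]; exact add_mem hx hy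
    | smul a x _ hx => rw [map_smul]; exact Submodule.smul_mem _ _ hx

theorem skew (halt : ∀ x, br x x = 0) (x y : V) : br x y = - br y x := by
  have := halt (x + y)
  simp only [map_add, LinearMap.add_apply, halt, zero_add, add_zero] at this
  exact (eq_neg_of_add_eq_zero_right this)

theorem Cser_extend (halt : ∀ x, br x x = 0)
    (hjac : ∀ x y z, br x (br y z) = br (br x y) z + br y (br x z)) {s : V}
    (hs : ∀ w ∈ W, br s w ∈ W) {N n : ℕ} (hN : Cser br W N = ⊥) (hn : ∀ v, (br s)^[n] v = 0) :
    Cser br (W ⊔ Submodule.span R {s}) (N * n) = ⊥ := by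
  set W' := W ⊔ Submodule.span R {s}
  have hnorm := Cser_norm halt hjac hs
  have hnl : ∀ i l, ∀ v ∈ Cser br W i, (br s)^[l] v ∈ Cser br W i := by
    intro i l v hv
    induction l with
    | zero => exact hv
    | succ l ih => rw [Function.iterate_succ_apply']; exact hnorm i _ ih
  have key : ∀ i j, Cser br W' i ≤ Cser br W j → ∀ l, ∀ z ∈ Cser br W' (i + l),
      ∃ c ∈ Cser br W j, ∃ c' ∈ Cser br W (j + 1), z = (br s)^[l] c + c' := by
    intro i j hij l
    induction l with
    | zero => intro z hz; exact ⟨z, hij hz, 0, zero_mem _, by simp⟩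
    | succ l ih =>
      intro z hz
      replace hz : z ∈ Cser br W' ((i + l) + 1) := hz
      have hlin : ∀ x, (br s)^[l + 1] x = ((br s) ^ (l + 1)) x := by
        intro x; rw [Module.End.coe_pow]
      induction hz using Submodule.span_induction with
      | mem x hx =>
        obtain ⟨w, hw, v, hv, rfl⟩ := hx
        obtain ⟨c, hc, c', hc', rfl⟩ := ih v hv
        obtain ⟨w, hw1, s', hs', rfl⟩ := Submodule.mem_sup.1 hw
        obtain ⟨a, rfl⟩ := Submodule.mem_span_singleton.1 hs'
        refine ⟨a • c, Submodule.smul_mem _ _ hc, a • br s c' + br w ((br s)^[l] c + c'), ?_, ?_⟩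
        · exact add_mem (Submodule.smul_mem _ _ (hnorm _ _ hc')) (Cser_mem hw1
            (add_mem (hnl _ _ _ hc) (Cser_anti _ hc')))
        · rw [hlin, map_smul, ← hlin, Function.iterate_succ_apply']
          simp only [map_add, LinearMap.add_apply, map_smul, LinearMap.smul_apply, smul_add]
          abel
      | zero => exact ⟨0, zero_mem _, 0, zero_mem _, by rw [hlin]; simp⟩
      | add x y _ _ hx hy =>
        obtain ⟨c, hc, c', hc', rfl⟩ := hx
        obtain ⟨d, hd, d', hd', rfl⟩ := hy
        refine ⟨c + d, add_mem hc hd, c' + d', add_mem hc' hd', ?_⟩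
        simp only [hlin, map_add]; abel
      | smul a x _ hx =>
        obtain ⟨c, hc, c', hc', rfl⟩ := hx
        refine ⟨a • c, Submodule.smul_mem _ _ hc, a • c', Submodule.smul_mem _ _ hc', ?_⟩
        simp only [hlin, map_smul, smul_add]
  have : ∀ j, Cser br W' (j * n) ≤ Cser br W j := by
    intro j
    induction j with
    | zero => exact le_top
    | succ j ih =>
      intro z hz
      rw [Nat.succ_mul] at hz
      obtain ⟨c, hc, c', hc', rfl⟩ := key _ _ ih n z hz
      rw [hn, zero_add]; exact hc'
  exact eq_bot_iff.2 (hN ▸ this N)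
end

/-- Jacobson's theorem on weakly closed sets, adjoint version. -/
theorem jacobson {F V : Type*} [Field F] [AddCommGroup V] [Module F V] [FiniteDimensional F V]
    {br : V →ₗ[F] V →ₗ[F] V} (halt : ∀ x, br x x = 0)
    (hjac : ∀ x y z, br x (br y z) = br (br x y) z + br y (br x z)) (S : Set V)
    (hS : ∀ x ∈ S, ∀ y ∈ S, br x y ∈ S) (hspan : Submodule.span F S = ⊤)
    (hnil : ∀ x ∈ S, ∃ n, ∀ v, (br x)^[n] v = 0) : ∃ N, Cser br ⊤ N = ⊥ := by
  let 𝒲 : Set (Submodule F V) := {W | W ≤ Submodule.span F (S ∩ W) ∧ (∀ x ∈ W, ∀ y ∈ W, br x y ∈ W) ∧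
    ∃ N, Cser br W N = ⊥}
  have hne : 𝒲.Nonempty := by
    refine ⟨⊥, bot_le, by simp, 1, ?_⟩
    rw [eq_bot_iff]
    refine Submodule.span_le.2 ?_
    rintro _ ⟨w, hw, v, hv, rfl⟩
    rw [Submodule.mem_bot] at hw
    simp [hw]
  obtain ⟨W, hW, hmax⟩ := (wellFounded_gt (α := Submodule F V)).has_min 𝒲 hne
  suffices W = ⊤ by obtain ⟨N, hN⟩ := hW.2.2; exact ⟨N, this ▸ hN⟩
  by_contra hWt
  obtain ⟨hW1, hW2, N, hN⟩ := hW
  obtain ⟨s0, hs0, hs0W⟩ : ∃ s ∈ S, s ∉ W := by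
    by_contra hcon
    push Not at hcon
    exact hWt (eq_top_iff.2 (hspan ▸ Submodule.span_le.2 hcon))
  obtain ⟨s, hs, hsW, hst⟩ : ∃ s ∈ S, s ∉ W ∧ ∀ t ∈ S ∩ W, br t s ∈ W := by
    by_contra hcon
    push Not at hcon
    have : ∀ i, ∃ s ∈ S, s ∉ W ∧ s ∈ Cser br W i := by
      intro i
      induction i with
      | zero => exact ⟨s0, hs0, hs0W, Submodule.mem_top⟩
      | succ i ih =>
        obtain ⟨s, hs, hsW, hsi⟩ := ih
        obtain ⟨t, ht, h⟩ := hcon s hs hsW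
        exact ⟨br t s, hS _ ht.1 _ hs, h, Cser_mem ht.2 hsi⟩
    obtain ⟨s, -, hsW, h⟩ := this N
    rw [hN, Submodule.mem_bot] at h
    exact hsW (h ▸ zero_mem _)
  have hsw : ∀ w ∈ W, br s w ∈ W := by
    intro w hw
    replace hw := hW1 hw
    induction hw using Submodule.span_induction with
    | mem t ht => rw [skew halt]; exact neg_mem (hst t ht)
    | zero => simp
    | add x y _ _ hx hy => rw [map_add]; exact add_mem hx hy
    | smul a x _ hx => rw [map_smul]; exact Submodule.smul_mem _ _ hx
  obtain ⟨n, hn⟩ := hnil s hs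
  have hsW' : s ∈ W ⊔ Submodule.span F {s} :=
    Submodule.mem_sup_right (Submodule.mem_span_singleton_self s)
  refine hmax (W ⊔ Submodule.span F {s}) ⟨?_, ?_, N * n, Cser_extend halt hjac hsw hN hn⟩ ?_
  · refine sup_le ?_ ?_
    · exact hW1.trans (Submodule.span_mono (fun x hx => ⟨hx.1, Submodule.mem_sup_left hx.2⟩))
    · rw [Submodule.span_singleton_le_iff_mem]
      exact Submodule.subset_span ⟨hs, hsW'⟩
  · intro x hx y hy
    apply Submodule.mem_sup_left
    obtain ⟨w, hw, x1, hx1, rfl⟩ := Submodule.mem_sup.1 hx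
    obtain ⟨a, rfl⟩ := Submodule.mem_span_singleton.1 hx1
    obtain ⟨w', hw', y1, hy1, rfl⟩ := Submodule.mem_sup.1 hy
    obtain ⟨b, rfl⟩ := Submodule.mem_span_singleton.1 hy1
    have h3 : br w s ∈ W := by rw [skew halt]; exact neg_mem (hsw w hw)
    simp only [map_add, LinearMap.add_apply, map_smul, LinearMap.smul_apply, halt, smul_zero, add_zero]
    have h4 := hW2 _ hw _ hw'
    have h5 := W.smul_mem a (hsw _ hw')
    have h6 := W.smul_mem b h3
    exact add_mem (add_mem h4 h5) h6
  · refine lt_of_le_of_ne le_sup_left ?_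
    intro h
    exact hsW (h ▸ hsW')

end lie
end PG
namespace PG
section lie2
open Polynomial

theorem nil_alg {F V : Type*} [Field F] [IsAlgClosed F] [CharZero F] [AddCommGroup V] [Module F V]
    [FiniteDimensional F V]
    {br : V →ₗ[F] V →ₗ[F] V} (halt : ∀ x, br x x = 0)
    (hjac : ∀ x y z, br x (br y z) = br (br x y) z + br y (br x z)) {p : ℕ} (hp : p.Prime)
    (ψ : V →ₗ[F] V) (hψ : ∀ x y, ψ (br x y) = br (ψ x) (ψ y))
    (hsum : ∀ x, ∑ i ∈ Finset.range p, ψ^[i] x = 0) : ∃ N, Cser br ⊤ N = ⊥ := by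
  have hψp : ∀ x, ψ^[p] x = x := by
    intro x
    have h1 := hsum (ψ x)
    have h2 := hsum x
    have h3 := Finset.sum_range_succ' (fun i => ψ^[i] x) p
    have h4 := Finset.sum_range_succ (fun i => ψ^[i] x) p
    rw [h4] at h3
    simp only [Function.iterate_succ_apply, h1, h2, zero_add] at h3
    exact h3
  have hss : Module.End.IsSemisimple ψ := by
    refine Module.End.isSemisimple_of_squarefree_aeval_eq_zero (p := (X ^ p - 1 : F[X])) ?_ ?_
    · exact (X_pow_sub_one_separable_iff.2 (by exact_mod_cast hp.ne_zero)).squarefree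
    · ext x
      simp [Module.End.coe_pow, hψp]
  have htop := hss.iSup_eigenspace_eq_top
  let S : Set V := {x | ∃ μ : F, ψ x = μ • x}
  have hspan : Submodule.span F S = ⊤ := by
    rw [eq_top_iff, ← htop]
    refine iSup_le fun μ x hx => Submodule.subset_span ⟨μ, ?_⟩
    exact Module.End.mem_eigenspace_iff.1 hx
  have hit : ∀ (x : V) (μ : F), ψ x = μ • x → ∀ i, ψ^[i] x = μ ^ i • x := by
    intro x μ h i
    induction i with
    | zero => simp
    | succ i ih => rw [Function.iterate_succ_apply', ih, map_smul, h, smul_smul, pow_succ]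
  have hone : ∀ x, ψ x = x → x = 0 := by
    intro x hx
    have h1 := hsum x
    have h2 : ∀ i, ψ^[i] x = x := fun i => Function.iterate_fixed hx i
    simp only [h2, Finset.sum_const, Finset.card_range] at h1
    rw [← Nat.cast_smul_eq_nsmul F] at h1
    exact (smul_eq_zero.1 h1).resolve_left (by exact_mod_cast hp.ne_zero)
  have hroot : ∀ (x : V) (μ : F), x ≠ 0 → ψ x = μ • x → μ ^ p = 1 := by
    intro x μ hx h
    have := hit x μ h p
    rw [hψp] at this
    have h2 : (μ ^ p - 1) • x = 0 := by rw [sub_smul, one_smul, ← this, sub_self]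
    exact sub_eq_zero.1 ((smul_eq_zero.1 h2).resolve_right hx)
  refine jacobson halt hjac S ?_ hspan ?_
  · rintro x ⟨μ, hμ⟩ y ⟨ν, hν⟩
    refine ⟨μ * ν, ?_⟩
    rw [hψ, hμ, hν]; simp [smul_smul, mul_comm]
  · rintro x ⟨μ, hμ⟩
    refine ⟨p, fun v => ?_⟩
    by_cases hx : x = 0
    · subst hx
      obtain ⟨k, hk⟩ := Nat.exists_eq_succ_of_ne_zero hp.ne_zero
      rw [hk, Function.iterate_succ_apply']; simp
    have hμp := hroot x μ hx hμ
    have hμ1 : μ ≠ 1 := by rintro rfl; exact hx (hone x (by simpa using hμ))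
    have := Fact.mk hp
    have hprim : IsPrimitiveRoot μ p := by
      rw [IsPrimitiveRoot.iff_orderOf]
      exact orderOf_eq_prime hμp hμ1
    have hv : v ∈ Submodule.span F S := hspan ▸ Submodule.mem_top
    have hlin : ∀ x', (br x)^[p] x' = ((br x) ^ p) x' := by
      intro x'; rw [Module.End.coe_pow]
    induction hv using Submodule.span_induction with
    | mem v hv =>
      obtain ⟨ν, hν⟩ := hv
      by_cases hv0 : v = 0
      · rw [hlin, hv0, map_zero]
      have hνp := hroot v ν hv0 hν
      have hν0 : ν ≠ 0 := by rintro rfl; simp [hp.ne_zero] at hνp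
      obtain ⟨i, hi, hiν⟩ := hprim.eq_pow_of_pow_eq_one (ξ := ν⁻¹) (by rw [inv_pow, hνp, inv_one])
      have hpow : ∀ j, ψ ((br x)^[j] v) = (ν * μ ^ j) • (br x)^[j] v := by
        intro j
        induction j with
        | zero => simpa using hν
        | succ j ih =>
          rw [Function.iterate_succ_apply', hψ, ih, hμ]
          simp only [map_smul, LinearMap.smul_apply, smul_smul]
          congr 1; ring
      have h0 : (br x)^[i] v = 0 := by
        apply hone
        rw [hpow, hiν, mul_inv_cancel₀ hν0, one_smul]
      obtain ⟨k, rfl⟩ := Nat.exists_eq_add_of_le hi.le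
      rw [add_comm, Function.iterate_add_apply, h0]
      exact iterate_map_zero (br x) k
    | zero => rw [hlin, map_zero]
    | add a b _ _ ha hb => rw [hlin] at *; rw [map_add, ha, hb, add_zero]
    | smul a b _ hb => rw [hlin] at *; rw [map_smul, hb, smul_zero]


theorem nil_bc {R F Λ : Type*} [CommRing R] [Field F] [Algebra R F] [FaithfulSMul R F]
    [IsAlgClosed F] [CharZero F] [LieRing Λ] [LieAlgebra R Λ] [Module.Free R Λ] [Module.Finite R Λ]
    {p : ℕ} (hp : p.Prime) {br : Λ →ₗ[R] Λ →ₗ[R] Λ} (hb : ∀ x y : Λ, ⁅x, y⁆ = br x y)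
    (ψ : Λ →ₗ[R] Λ) (hψ : ∀ x y, ψ (br x y) = br (ψ x) (ψ y))
    (hsum : ∀ x, ∑ i ∈ Finset.range p, ψ^[i] x = 0) : ∃ N, Cser br ⊤ N = ⊥ := by
  let brV : TensorProduct R F Λ →ₗ[F] TensorProduct R F Λ →ₗ[F] TensorProduct R F Λ :=
    LinearMap.mk₂ F (fun x y => ⁅x, y⁆) (by simp) (by simp) (by simp) (by simp)
  have hbV : ∀ x y, brV x y = ⁅x, y⁆ := fun x y => rfl
  let ψV : TensorProduct R F Λ →ₗ[F] TensorProduct R F Λ := ψ.baseChange F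
  have hψt : ∀ (a : F) (x : Λ), ψV (a ⊗ₜ x) = a ⊗ₜ (ψ x) := fun a x => rfl
  have hψV : ∀ x y, ψV (brV x y) = brV (ψV x) (ψV y) := by
    intro x y
    induction x using TensorProduct.induction_on with
    | zero => simp
    | add x x' h h' => simp only [map_add, LinearMap.add_apply, h, h']
    | tmul a x =>
      induction y using TensorProduct.induction_on with
      | zero => simp
      | add x x' h h' => simp only [map_add, h, h']
      | tmul b y =>
        rw [hbV, hbV, hψt, hψt, LieAlgebra.ExtendScalars.bracket_tmul,
          LieAlgebra.ExtendScalars.bracket_tmul, hψt, hb, hb, hψ]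
  have hitV : ∀ (i : ℕ) (a : F) (x : Λ), ψV^[i] (a ⊗ₜ x) = a ⊗ₜ (ψ^[i] x) := by
    intro i a x
    induction i with
    | zero => rfl
    | succ i ih => rw [Function.iterate_succ_apply', ih, Function.iterate_succ_apply']; rfl
  have hsumV : ∀ x, ∑ i ∈ Finset.range p, ψV^[i] x = 0 := by
    intro x
    induction x using TensorProduct.induction_on with
    | zero => exact Finset.sum_eq_zero fun i _ => iterate_map_zero ψV i
    | add x y hx hy => simp only [iterate_map_add, Finset.sum_add_distrib, hx, hy, add_zero]
    | tmul a x => simp only [hitV]; rw [← TensorProduct.tmul_sum, hsum, TensorProduct.tmul_zero]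
  obtain ⟨N, hN⟩ := nil_alg (br := brV) (fun x => lie_self x)
    (fun x y z => leibniz_lie x y z) hp ψV hψV hsumV
  have hinj : Function.Injective (fun x : Λ => (1 : F) ⊗ₜ[R] x) := by
    have h1 := Module.Flat.rTensor_preserves_injective_linearMap (M := Λ) (Algebra.linearMap R F)
      (FaithfulSMul.algebraMap_injective R F)
    have h2 := h1.comp (TensorProduct.lid R Λ).symm.injective
    convert h2 using 1
    ext x
    simp
  have hmem : ∀ i, ∀ x ∈ Cser br ⊤ i, (1 : F) ⊗ₜ[R] x ∈ Cser brV ⊤ i := by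
    intro i
    induction i with
    | zero => intro x _; exact Submodule.mem_top
    | succ i ih =>
      intro x hx
      induction hx using Submodule.span_induction with
      | mem x hx =>
        obtain ⟨w, -, v, hv, rfl⟩ := hx
        have := Cser_mem (br := brV) (w := (1 : F) ⊗ₜ[R] w) (Submodule.mem_top) (ih v hv)
        rw [hbV, LieAlgebra.ExtendScalars.bracket_tmul, hb, one_mul] at this
        exact this
      | zero => simp
      | add x y _ _ hx hy => rw [TensorProduct.tmul_add]; exact add_mem hx hy
      | smul a x _ hx =>
        rw [TensorProduct.tmul_smul, ← algebraMap_smul F]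
        exact Submodule.smul_mem _ _ hx
  refine ⟨N, eq_bot_iff.2 fun x hx => ?_⟩
  have := hmem N x hx
  rw [hN, Submodule.mem_bot] at this
  exact hinj (this.trans (TensorProduct.tmul_zero _ _).symm)

theorem nil_padic {p : ℕ} [hp : Fact p.Prime] {Λ : Type*} [AddCommGroup Λ] [Module ℤ_[p] Λ]
    [Module.Free ℤ_[p] Λ] [Module.Finite ℤ_[p] Λ]
    {br : Λ →ₗ[ℤ_[p]] Λ →ₗ[ℤ_[p]] Λ} (halt : ∀ x, br x x = 0)
    (hjac : ∀ x y z, br x (br y z) = br (br x y) z + br y (br x z))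
    (ψ : Λ →ₗ[ℤ_[p]] Λ) (hψ : ∀ x y, ψ (br x y) = br (ψ x) (ψ y))
    (hsum : ∀ x, ∑ i ∈ Finset.range p, ψ^[i] x = 0) : ∃ N, Cser br ⊤ N = ⊥ := by
  let lr : LieRing Λ :=
    { bracket := fun x y => br x y
      add_lie := by intro x y z; show br (x + y) z = br x z + br y z; simp
      lie_add := by intro x y z; show br x (y + z) = br x y + br x z; simp
      lie_self := halt
      leibniz_lie := hjac }
  let la : LieAlgebra ℤ_[p] Λ := { lie_smul := by intro t x y; exact map_smul (br x) t y }
  have : CharZero (AlgebraicClosure ℚ_[p]) := algebraRat.charZero _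
  have : FaithfulSMul ℤ_[p] (AlgebraicClosure ℚ_[p]) := by
    rw [faithfulSMul_iff_algebraMap_injective, IsScalarTower.algebraMap_eq ℤ_[p] ℚ_[p]]
    exact (algebraMap ℚ_[p] _).injective.comp (IsFractionRing.injective ℤ_[p] ℚ_[p])
  exact nil_bc (R := ℤ_[p]) (F := AlgebraicClosure ℚ_[p]) (Λ := Λ) hp.out (fun x y => rfl) ψ hψ hsum
end lie2
end PG
namespace PG
section lie3
open Polynomial

variable {p : ℕ} [hp : Fact p.Prime] {Λ : Type*} [AddCommGroup Λ] [Module ℤ_[p] Λ]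

/-- isolator -/
def iso (D : Submodule ℤ_[p] Λ) : Submodule ℤ_[p] Λ where
  carrier := {x | ∃ j : ℕ, (p ^ j : ℤ_[p]) • x ∈ D}
  zero_mem' := ⟨0, by simp⟩
  add_mem' := by
    rintro x y ⟨i, hi⟩ ⟨j, hj⟩
    refine ⟨i + j, ?_⟩
    rw [smul_add]
    refine add_mem ?_ ?_
    · rw [pow_add, mul_comm, mul_smul]; exact D.smul_mem _ hi
    · rw [pow_add, mul_smul]; exact D.smul_mem _ hj
  smul_mem' := by
    rintro c x ⟨i, hi⟩
    exact ⟨i, by rw [smul_comm]; exact D.smul_mem _ hi⟩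

theorem le_iso (D : Submodule ℤ_[p] Λ) : D ≤ iso D := fun x hx => ⟨0, by simpa using hx⟩

theorem iso_iso {D : Submodule ℤ_[p] Λ} {x : Λ} {j : ℕ} (h : (p ^ j : ℤ_[p]) • x ∈ iso D) :
    x ∈ iso D := by
  obtain ⟨i, hi⟩ := h
  exact ⟨i + j, by rwa [pow_add, mul_smul]⟩

theorem iso_le_iso {D D' : Submodule ℤ_[p] Λ} (h : D ≤ iso D') : iso D ≤ iso D' := by
  rintro x ⟨j, hj⟩
  exact iso_iso (h hj)

theorem iso_bot [Module.IsTorsionFree ℤ_[p] Λ] : iso (⊥ : Submodule ℤ_[p] Λ) = ⊥ := by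
  rw [eq_bot_iff]
  rintro x ⟨j, hj⟩
  have hp0 : (p ^ j : ℤ_[p]) ≠ 0 := pow_ne_zero _ (by exact_mod_cast hp.out.ne_zero)
  exact (smul_eq_zero.1 ((Submodule.mem_bot _).1 hj)).resolve_left hp0

theorem aeval_inv {φ : Λ →ₗ[ℤ_[p]] Λ} {D : Submodule ℤ_[p] Λ} (h : ∀ x ∈ D, φ x ∈ D)
    (q : ℤ_[p][X]) : ∀ x ∈ D, aeval φ q x ∈ D := by
  induction q using Polynomial.induction_on' with
  | add a b ha hb =>
    intro x hx; rw [map_add]; exact add_mem (ha x hx) (hb x hx)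
  | monomial k a =>
    intro x hx
    rw [aeval_monomial]
    simp only [Module.End.mul_apply, Module.algebraMap_end_apply]
    refine D.smul_mem _ ?_
    induction k with
    | zero => simpa using hx
    | succ k ih => rw [pow_succ']; exact h _ ih

theorem class_bound [Module.Free ℤ_[p] Λ] [Module.Finite ℤ_[p] Λ]
    {br : Λ →ₗ[ℤ_[p]] Λ →ₗ[ℤ_[p]] Λ} (halt : ∀ x, br x x = 0)
    (hjac : ∀ x y z, br x (br y z) = br (br x y) z + br y (br x z))
    (φ : Λ →ₗ[ℤ_[p]] Λ) (hφ : ∀ x y, φ (br x y) = br (φ x) (φ y)) {n m : ℕ}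
    (hn : ∀ x, φ^[p ^ (n + 1)] x = x) (hfix : ∀ x, φ^[p ^ n] x = x → x = 0)
    (r : Fin (p ^ m) → Λ) (hr : ∀ x, ∃ j y z, x = r j + (φ y - y) + (p : ℤ_[p]) • z) :
    Cser br ⊤ m = ⊥ := by
  have hnE : φ ^ p ^ (n + 1) = 1 := by ext x; simp [Module.End.coe_pow, hn]
  set ψ := φ ^ p ^ n with hψd
  have hψp : ψ ^ p = 1 := by rw [hψd, ← pow_mul, ← pow_succ, hnE]
  have hψbr : ∀ x y, ψ (br x y) = br (ψ x) (ψ y) := by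
    rw [hψd]
    generalize p ^ n = k
    induction k with
    | zero => intro x y; simp
    | succ k ih => intro x y; simp only [pow_succ', Module.End.mul_apply, ih, hφ]
  have hsumE : ∑ i ∈ Finset.range p, ψ ^ i = 0 := by
    ext x
    have : ψ ((∑ i ∈ Finset.range p, ψ ^ i) x) = (∑ i ∈ Finset.range p, ψ ^ i) x := by
      rw [← Module.End.mul_apply, Finset.mul_sum]
      have h3 := Finset.sum_range_succ' (fun i => ψ ^ i) p
      have h4 := Finset.sum_range_succ (fun i => ψ ^ i) p
      rw [h4, hψp, pow_zero, add_left_inj] at h3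
      rw [h3]
      simp only [pow_succ']
    exact hfix _ (by rw [← Module.End.coe_pow]; exact this)
  obtain ⟨N, hN⟩ := nil_padic halt hjac ψ hψbr (fun x => by
    have := LinearMap.congr_fun hsumE x
    simpa [Module.End.coe_pow] using this)
  -- polynomials
  obtain ⟨g, hg⟩ : ∃ g : ℤ_[p][X], (p : Module.End ℤ_[p] Λ) = aeval φ ((X - 1) * g) := by
    have h1 : (X - C 1 : ℤ_[p][X]) ∣ C (p : ℤ_[p]) - ∑ i ∈ Finset.range p, (X ^ p ^ n) ^ i := by
      rw [dvd_iff_isRoot]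
      simp [eval_finsetSum]
    obtain ⟨g, hg⟩ := h1
    refine ⟨g, ?_⟩
    rw [C_1] at hg
    rw [← hg]
    simp only [map_sub, map_sum, map_pow, aeval_X]
    rw [← hψd, hsumE]
    simp
  obtain ⟨h, hh⟩ : ∃ h : ℤ_[p][X], aeval φ ((X - 1 : ℤ_[p][X]) ^ p ^ (n + 1)) =
      aeval φ ((p : ℤ_[p][X]) * h) := by
    obtain ⟨h, hh⟩ := (Commute.all (X - 1 : ℤ_[p][X]) 1).exists_add_pow_prime_pow_eq hp.out (n + 1)
    refine ⟨-(((X - 1) * 1) * h), ?_⟩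
    have h1 : (X - 1 : ℤ_[p][X]) ^ p ^ (n + 1) =
        (X ^ p ^ (n + 1) - 1) + (p : ℤ_[p][X]) * -(((X - 1) * 1) * h) := by
      rw [sub_add_cancel] at hh
      rw [hh]; ring
    rw [h1, map_add, map_sub, map_pow, aeval_X, hnE]
    simp
  set D : ℕ → Submodule ℤ_[p] Λ := fun i => iso (Cser br ⊤ i) with hD
  have hCinv : ∀ i, ∀ x ∈ Cser br ⊤ i, φ x ∈ Cser br ⊤ i := by
    intro i
    induction i with
    | zero => intro x _; exact Submodule.mem_top
    | succ i ih =>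
      intro x hx
      induction hx using Submodule.span_induction with
      | mem x hx =>
        obtain ⟨w, -, v, hv, rfl⟩ := hx
        rw [hφ]
        exact Cser_mem Submodule.mem_top (ih v hv)
      | zero => simp
      | add x y _ _ hx hy => rw [map_add]; exact add_mem hx hy
      | smul a x _ hx => rw [map_smul]; exact Submodule.smul_mem _ _ hx
  have hDinv : ∀ i, ∀ x ∈ D i, φ x ∈ D i := by
    rintro i x ⟨j, hj⟩
    exact ⟨j, by rw [← map_smul]; exact hCinv i _ hj⟩
  have hDanti : ∀ i, D (i + 1) ≤ D i := fun i =>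
    iso_le_iso ((Cser_anti i).trans (le_iso _))
  set π : Module.End ℤ_[p] Λ := φ - 1 with hπ
  have hπa : aeval φ (X - 1 : ℤ_[p][X]) = π := by simp [hπ]
  have hπD : ∀ i x, π x ∈ D i → x ∈ D i := by
    intro i x hx
    refine iso_iso (j := 1) ?_
    have h1 : (p ^ 1 : ℤ_[p]) • x = aeval φ g (π x) := by
      rw [mul_comm, map_mul, hπa] at hg
      have := LinearMap.congr_fun hg x
      rw [Module.End.mul_apply] at this
      rw [← this]
      simp [Nat.cast_smul_eq_nsmul]
    rw [h1]
    exact aeval_inv (hDinv i) g _ hx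
  have hstep : ∀ i, D i ≤ D (i + 1) ⊔ LinearMap.range π → D i ≤ D (i + 1) := by
    intro i hi
    have h1 : ∀ k, ∀ x ∈ D i, ∃ y ∈ D (i + 1), ∃ z ∈ D i, x = y + (π ^ k) z := by
      intro k
      induction k with
      | zero => intro x hx; exact ⟨0, zero_mem _, x, hx, by simp⟩
      | succ k ih =>
        intro x hx
        obtain ⟨y, hy, z, hz, rfl⟩ := ih x hx
        obtain ⟨y', hy', _, ⟨z', rfl⟩, rfl⟩ := Submodule.mem_sup.1 (hi hz)
        refine ⟨y + (π ^ k) y', add_mem hy ?_, z', ?_, ?_⟩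
        · rw [← hπa, ← map_pow]; exact aeval_inv (hDinv _) _ _ hy'
        · apply hπD
          have := sub_mem hz (hDanti i hy')
          simpa using this
        · rw [map_add, pow_succ, Module.End.mul_apply, add_assoc]
    refine Submodule.le_of_le_smul_of_le_jacobson_bot (I := Ideal.span {(p : ℤ_[p])})
      (IsNoetherian.noetherian _) ?_ ?_
    · rw [IsLocalRing.jacobson_eq_maximalIdeal _ bot_ne_top, PadicInt.maximalIdeal_eq_span_p]
    · intro x hx
      obtain ⟨y, hy, z, hz, rfl⟩ := h1 (p ^ (n + 1)) x hx
      refine add_mem (Submodule.mem_sup_left hy) (Submodule.mem_sup_right ?_)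
      rw [← hπa, ← map_pow, hh, map_mul, map_natCast, Module.End.mul_apply]
      have : (p : Module.End ℤ_[p] Λ) (aeval φ h z) = (p : ℤ_[p]) • aeval φ h z := by
        simp [Nat.cast_smul_eq_nsmul]
      rw [this]
      exact Submodule.smul_mem_smul (Ideal.mem_span_singleton_self _) (aeval_inv (hDinv i) _ _ hz)
  have hstab : ∀ i, D i ≤ D (i + 1) → D i = ⊥ := by
    intro i hi
    have h1 : ∀ j, D i ≤ D (i + j) := by
      intro j
      induction j with
      | zero => exact le_rfl
      | succ j ih =>
        refine hi.trans (iso_le_iso ?_)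
        refine Submodule.span_le.2 ?_
        rintro _ ⟨w, -, v, hv, rfl⟩
        obtain ⟨a, ha⟩ := ih (le_iso _ hv)
        exact ⟨a, by rw [← map_smul]; exact Cser_mem (i := i + j) Submodule.mem_top ha⟩
    rw [eq_bot_iff]
    refine (h1 N).trans ?_
    have h2 : Cser br ⊤ (i + N) = ⊥ := eq_bot_iff.2 (hN ▸ Cser_anti' (by omega))
    simp only [hD, h2, iso_bot, le_refl]
  -- counting
  have hpπ : ∀ z : Λ, (p : ℤ_[p]) • z ∈ LinearMap.range π := by
    intro z
    rw [map_mul, hπa] at hg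
    have := LinearMap.congr_fun hg z
    rw [Module.End.mul_apply] at this
    refine ⟨_, this.symm.trans ?_⟩
    simp [Nat.cast_smul_eq_nsmul]
  let Q := Λ ⧸ LinearMap.range π
  have hsurj : Function.Surjective (fun j => (LinearMap.range π).mkQ (r j)) := by
    intro y
    obtain ⟨x, rfl⟩ := Submodule.mkQ_surjective _ y
    obtain ⟨j, y, z, hx⟩ := hr x
    refine ⟨j, ?_⟩
    rw [hx]
    refine ((Submodule.Quotient.eq _).2 ?_)
    have : r j - (r j + (φ y - y) + (p : ℤ_[p]) • z) = -(π y) - (p : ℤ_[p]) • z := by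
      simp only [hπ, LinearMap.sub_apply, Module.End.one_apply]; abel
    rw [this]
    exact sub_mem (neg_mem ⟨y, rfl⟩) (hpπ z)
  have hQf : Finite Q := Finite.of_surjective _ hsurj
  have hQc : Nat.card Q ≤ p ^ m := by
    have := Nat.card_le_card_of_surjective _ hsurj
    simpa using this
  let E : ℕ → Submodule ℤ_[p] Q := fun i => (D i).map (LinearMap.range π).mkQ
  have hEc : ∀ i, ∃ a, Nat.card (E i) = p ^ a := by
    intro i
    refine card_pow_of_kill (e := 1) hp.out ?_
    rintro ⟨u, hu⟩
    obtain ⟨x, rfl⟩ := Submodule.mkQ_surjective _ u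
    refine Subtype.ext ?_
    have h1 := (Submodule.Quotient.mk_eq_zero _).2 (hpπ x)
    rw [pow_one]
    rw [Nat.cast_smul_eq_nsmul] at h1
    exact h1
  choose a ha using hEc
  have hlt : ∀ i, D i ≠ ⊥ → a (i + 1) < a i := by
    intro i hi
    have h1 : E (i + 1) < E i := by
      refine lt_of_le_of_ne (Submodule.map_mono (hDanti i)) fun heq => hi (hstab i (hstep i ?_))
      have := congrArg (Submodule.comap (LinearMap.range π).mkQ) heq
      simp only [E, Submodule.comap_map_eq, Submodule.ker_mkQ] at this
      rw [this]; exact le_sup_left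
    have h2 : Nat.card (E (i + 1)) < Nat.card (E i) := by
      exact Set.Finite.card_lt_card (Set.toFinite _) h1
    rw [ha, ha] at h2
    exact (Nat.pow_lt_pow_iff_right hp.out.one_lt).1 h2
  by_contra hne
  have hne' : ∀ i ≤ m, D i ≠ ⊥ := by
    intro i hi h0
    refine hne (eq_bot_iff.2 ?_)
    exact (Cser_anti' hi).trans ((le_iso _).trans h0.le)
  have hdesc : ∀ i ≤ m + 1, a i + i ≤ a 0 := by
    intro i
    induction i with
    | zero => intro _; simp
    | succ i ih => intro hi; have := hlt i (hne' i (by omega)); have := ih (by omega); omega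
  have h0 : a 0 ≤ m := by
    have : Nat.card (E 0) ≤ p ^ m := (Nat.card_le_card_of_injective _ (Subtype.val_injective)).trans hQc
    rw [ha] at this
    exact (Nat.pow_le_pow_iff_right hp.out.one_lt).1 this
  have := hdesc (m + 1) le_rfl
  omega
end lie3
end PG
namespace PG
section cpt
open Filter Topology

variable {p : ℕ} [hp : Fact p.Prime] {d : ℕ}

/-- bracket from structure constants -/
noncomputable def brF (b : Fin d → Fin d → Fin d → ℤ_[p]) (x y : Fin d → ℤ_[p]) : Fin d → ℤ_[p] :=
  ∑ i, ∑ j, (x i * y j) • b i j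

/-- map from a matrix -/
noncomputable def phF (a : Fin d → Fin d → ℤ_[p]) (x : Fin d → ℤ_[p]) : Fin d → ℤ_[p] := ∑ i, x i • a i

/-- iterated product -/
def prF {L : Type*} (br : L → L → L) (xs : ℕ → L) : ℕ → L
  | 0 => xs 0
  | i + 1 => br (xs (i + 1)) (prF br xs i)

/-- congruence lattice -/
def Ip (p : ℕ) [Fact p.Prime] (d t : ℕ) : Set (Fin d → ℤ_[p]) := {v | ∀ l, (p : ℤ_[p]) ^ t ∣ v l}

theorem dvd_clopen (t : ℕ) : IsClopen {z : ℤ_[p] | (p : ℤ_[p]) ^ t ∣ z} := by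
  have : {z : ℤ_[p] | (p : ℤ_[p]) ^ t ∣ z} = Metric.closedBall 0 ((p : ℝ) ^ (-t : ℤ)) := by
    ext z
    rw [Set.mem_ofPred_eq, mem_closedBall_zero_iff, PadicInt.norm_le_pow_iff_mem_span_pow,
      Ideal.mem_span_singleton]
  rw [this]
  refine IsUltrametricDist.isClopen_closedBall _ ?_
  have : (p : ℝ) ≠ 0 := by exact_mod_cast hp.out.ne_zero
  exact zpow_ne_zero _ this

theorem dvd_all {z : ℤ_[p]} (h : ∀ t, (p : ℤ_[p]) ^ t ∣ z) : z = 0 := by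
  by_contra hz
  have h1 := h (z.valuation + 1)
  rw [← Ideal.mem_span_singleton, PadicInt.mem_span_pow_iff_le_valuation z hz] at h1
  omega

theorem Ip_clopen (t : ℕ) : IsClopen (Ip p d t) := by
  have : Ip p d t = ⋂ l, (fun v : Fin d → ℤ_[p] => v l) ⁻¹' {z | (p : ℤ_[p]) ^ t ∣ z} := by
    ext v; simp [Ip]
  rw [this]
  exact isClopen_iInter_of_finite fun l => (dvd_clopen t).preimage (continuous_apply l)

theorem Ip_all {v : Fin d → ℤ_[p]} (h : ∀ t, v ∈ Ip p d t) : v = 0 :=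
  funext fun l => dvd_all fun t => h t l

theorem Ip_anti {s t : ℕ} (h : t ≤ s) {v : Fin d → ℤ_[p]} (hv : v ∈ Ip p d s) : v ∈ Ip p d t :=
  fun l => (pow_dvd_pow _ h).trans (hv l)

section
variable {U : Filter ℕ} {b : ℕ → Fin d → Fin d → Fin d → ℤ_[p]} {b' : Fin d → Fin d → Fin d → ℤ_[p]}
  {a : ℕ → Fin d → Fin d → ℤ_[p]} {a' : Fin d → Fin d → ℤ_[p]} {x y : ℕ → Fin d → ℤ_[p]}
  {x' y' : Fin d → ℤ_[p]}

theorem brF_t (hb : Tendsto b U (𝓝 b')) (hx : Tendsto x U (𝓝 x')) (hy : Tendsto y U (𝓝 y')) :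
    Tendsto (fun s => brF (b s) (x s) (y s)) U (𝓝 (brF b' x' y')) := by
  unfold brF
  refine tendsto_finsetSum _ fun i _ => tendsto_finsetSum _ fun j _ => ?_
  exact ((tendsto_pi_nhds.1 hx i).mul (tendsto_pi_nhds.1 hy j)).smul
    (tendsto_pi_nhds.1 (tendsto_pi_nhds.1 hb i) j)

theorem phF_t (ha : Tendsto a U (𝓝 a')) (hx : Tendsto x U (𝓝 x')) :
    Tendsto (fun s => phF (a s) (x s)) U (𝓝 (phF a' x')) := by
  unfold phF
  refine tendsto_finsetSum _ fun i _ => ?_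
  exact (tendsto_pi_nhds.1 hx i).smul (tendsto_pi_nhds.1 ha i)

theorem phF_it (ha : Tendsto a U (𝓝 a')) (hx : Tendsto x U (𝓝 x')) (k : ℕ) :
    Tendsto (fun s => (phF (a s))^[k] (x s)) U (𝓝 ((phF a')^[k] x')) := by
  induction k with
  | zero => exact hx
  | succ k ih => simp only [Function.iterate_succ_apply']; exact phF_t ha ih

theorem prF_t (hb : Tendsto b U (𝓝 b')) {xs : ℕ → ℕ → Fin d → ℤ_[p]} {xs' : ℕ → Fin d → ℤ_[p]}
    (hx : Tendsto xs U (𝓝 xs')) (i : ℕ) :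
    Tendsto (fun s => prF (brF (b s)) (xs s) i) U (𝓝 (prF (brF b') xs' i)) := by
  have h : ∀ i, Tendsto (fun s => xs s i) U (𝓝 (xs' i)) := fun i => tendsto_pi_nhds.1 hx i
  induction i with
  | zero => exact h 0
  | succ i ih => exact brF_t hb (h _) ih

theorem Ip_lim [U.NeBot] (hU : U ≤ atTop) (hx : Tendsto x U (𝓝 x'))
    (h : ∀ s, x s ∈ Ip p d s) : x' = 0 := by
  refine Ip_all fun t => ?_
  refine (Ip_clopen t).1.mem_of_tendsto hx ?_
  filter_upwards [hU (eventually_ge_atTop t)] with s hs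
  exact Ip_anti hs (h s)

end

theorem ulim {X : Type*} [TopologicalSpace X] [CompactSpace X] (U : Ultrafilter ℕ) (f : ℕ → X) :
    ∃ x, Tendsto f U (𝓝 x) := by
  obtain ⟨x, -, hx⟩ := isCompact_univ.ultrafilter_le_nhds (U.map f) (by simp)
  exact ⟨x, hx⟩

/-- the bilinear map -/
noncomputable def brL (b : Fin d → Fin d → Fin d → ℤ_[p]) :
    (Fin d → ℤ_[p]) →ₗ[ℤ_[p]] (Fin d → ℤ_[p]) →ₗ[ℤ_[p]] (Fin d → ℤ_[p]) :=
  LinearMap.mk₂ ℤ_[p] (brF b)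
    (by intro x x' y; simp [brF, add_mul, add_smul, Finset.sum_add_distrib])
    (by intro c x y; simp [brF, Finset.smul_sum, smul_smul, mul_assoc])
    (by intro x x' y; simp [brF, mul_add, add_smul, Finset.sum_add_distrib])
    (by intro c x y; simp [brF, Finset.smul_sum, smul_smul, mul_left_comm])

/-- the linear map -/
noncomputable def phL (a : Fin d → Fin d → ℤ_[p]) : (Fin d → ℤ_[p]) →ₗ[ℤ_[p]] (Fin d → ℤ_[p]) where
  toFun := phF a
  map_add' x y := by simp [phF, add_smul, Finset.sum_add_distrib]
  map_smul' c x := by simp [phF, Finset.smul_sum, smul_smul]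

/-- the conditions -/
structure Cnd (n m k s : ℕ) (b : Fin d → Fin d → Fin d → ℤ_[p]) (a : Fin d → Fin d → ℤ_[p])
    (r : Fin (p ^ m) → Fin d → ℤ_[p]) : Prop where
  h1 : ∀ x, brF b x x ∈ Ip p d s
  h2 : ∀ x y z, brF b x (brF b y z) - (brF b (brF b x y) z + brF b y (brF b x z)) ∈ Ip p d s
  h3 : ∀ x y, phF a (brF b x y) - brF b (phF a x) (phF a y) ∈ Ip p d s
  h4 : ∀ x, (phF a)^[p ^ (n + 1)] x - x ∈ Ip p d s
  h5 : ∀ t ≤ s, ∀ v, (phF a)^[p ^ n] v - v ∈ Ip p d t → (p ^ k : ℤ_[p]) • v ∈ Ip p d t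
  h6 : ∀ x, ∃ j y, x - r j - (phF a y - y) ∈ Ip p d 1

theorem cpt1 (n m k d c : ℕ) : ∃ s0, ∀ s ≥ s0, ∀ b a r, Cnd (p := p) (d := d) n m k s b a r →
    ∀ xs, prF (brF b) xs m ∈ Ip p d c := by
  by_contra hcon
  push Not at hcon
  choose s hs b a r hC xs hxs using hcon
  obtain ⟨U, hU⟩ : ∃ U : Ultrafilter ℕ, (U : Filter ℕ) ≤ atTop := ⟨Ultrafilter.of atTop, Ultrafilter.of_le _⟩
  obtain ⟨b', hb⟩ := ulim U b
  obtain ⟨a', ha⟩ := ulim U a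
  obtain ⟨r', hr⟩ := ulim U r
  obtain ⟨xs', hx⟩ := ulim U xs
  have T : ∀ x : Fin d → ℤ_[p], Tendsto (fun _ : ℕ => x) U (𝓝 x) := fun x => tendsto_const_nhds
  have halt : ∀ x, brL b' x x = 0 := by
    intro x
    exact Ip_lim hU (brF_t hb (T x) (T x)) fun i => Ip_anti (hs i) ((hC i).h1 x)
  have hjac : ∀ x y z, brL b' x (brL b' y z) = brL b' (brL b' x y) z + brL b' y (brL b' x z) := by
    intro x y z
    refine sub_eq_zero.1 (Ip_lim hU ((brF_t hb (T x) (brF_t hb (T y) (T z))).sub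
      ((brF_t hb (brF_t hb (T x) (T y)) (T z)).add (brF_t hb (T y) (brF_t hb (T x) (T z)))))
      fun i => Ip_anti (hs i) ((hC i).h2 x y z))
  have hφ : ∀ x y, phL a' (brL b' x y) = brL b' (phL a' x) (phL a' y) := by
    intro x y
    refine sub_eq_zero.1 (Ip_lim hU ((phF_t ha (brF_t hb (T x) (T y))).sub
      (brF_t hb (phF_t ha (T x)) (phF_t ha (T y)))) fun i => Ip_anti (hs i) ((hC i).h3 x y))
  have hn : ∀ x, (phL a')^[p ^ (n + 1)] x = x := by
    intro x
    exact sub_eq_zero.1 (Ip_lim hU ((phF_it ha (T x) _).sub (T x))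
      fun i => Ip_anti (hs i) ((hC i).h4 x))
  have hfix : ∀ x, (phL a')^[p ^ n] x = x → x = 0 := by
    intro x hxx
    have h0 := (phF_it ha (T x) (p ^ n)).sub (T x)
    have h1 : (phF a')^[p ^ n] x - x = 0 := sub_eq_zero.2 hxx
    rw [h1] at h0
    have h2 : (p ^ k : ℤ_[p]) • x = 0 := by
      refine Ip_all fun t => ?_
      have h3 : ∀ᶠ i in (U : Filter ℕ), (phF (a i))^[p ^ n] x - x ∈ Ip p d t :=
        h0.eventually_mem ((Ip_clopen t).2.mem_nhds (by intro l; simp))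
      obtain ⟨i, hi, hi'⟩ := (h3.and (hU (eventually_ge_atTop t))).exists
      exact (hC i).h5 t (hi'.trans (hs i)) x hi
    have hp0 : (p ^ k : ℤ_[p]) ≠ 0 := pow_ne_zero _ (by exact_mod_cast hp.out.ne_zero)
    exact (smul_eq_zero.1 h2).resolve_left hp0
  have hr' : ∀ x, ∃ j y z, x = r' j + (phL a' y - y) + (p : ℤ_[p]) • z := by
    intro x
    choose j y hjy using fun i => (hC i).h6 x
    obtain ⟨j', hj⟩ := ulim U j
    obtain ⟨y', hy⟩ := ulim U y
    have h1 : Tendsto (fun i => r i (j i)) U (𝓝 (r' j')) := by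
      have : ∀ᶠ i in (U : Filter ℕ), j i = j' := by
        have := hj.eventually_mem (isOpen_discrete {j'} |>.mem_nhds rfl)
        simpa using this
      refine (tendsto_pi_nhds.1 hr j').congr' ?_
      filter_upwards [this] with i hi
      rw [hi]
    have h2 := (Ip_clopen 1).1.mem_of_tendsto (((T x).sub h1).sub ((phF_t ha hy).sub hy))
      (Eventually.of_forall hjy)
    choose z hz using h2
    refine ⟨j', y', z, ?_⟩
    have h3 : x - r' j' - (phF a' y' - y') = (p : ℤ_[p]) • z := by
      ext l; rw [hz l, pow_one]; rfl
    rw [← h3]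
    show x = r' j' + (phF a' y' - y') + _
    abel
  have hcb := class_bound halt hjac (phL a') hφ hn hfix r' hr'
  have hpr : ∀ i, prF (brF b') xs' i ∈ Cser (brL b') ⊤ i := by
    intro i
    induction i with
    | zero => exact Submodule.mem_top
    | succ i ih => exact Cser_mem Submodule.mem_top ih
  have h0 := hpr m
  rw [hcb, Submodule.mem_bot] at h0
  have h1 := prF_t hb hx m
  rw [h0] at h1
  have h3 : ∀ᶠ i in (U : Filter ℕ), prF (brF (b i)) (xs i) m ∈ Ip p d c :=
    h1.eventually_mem ((Ip_clopen c).2.mem_nhds (by intro l; simp))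
  obtain ⟨i, hi⟩ := h3.exists
  exact hxs i hi
end cpt
end PG
namespace PG
section lat

theorem zbasis {p : ℕ} [hp : Fact p.Prime] (V : Type*) [AddCommGroup V] [Finite V] [Module (ZMod p) V] :
    ∃ d, Nonempty (Module.Basis (Fin d) (ZMod p) V) ∧ Nat.card V = p ^ d := by
  have : Module.Finite (ZMod p) V := Module.Finite.of_finite
  refine ⟨Module.finrank (ZMod p) V, ⟨Module.finBasis (ZMod p) V⟩, ?_⟩
  have := Module.natCard_eq_pow_finrank (K := ZMod p) (V := V)
  rwa [Nat.card_zmod] at this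

theorem zlift {p : ℕ} [hp : Fact p.Prime] {L : Type*} [AddCommGroup L] (V : Type*) [AddCommGroup V]
    [Finite V] [Module (ZMod p) V] (q : L →+ V) (hq : Function.Surjective q)
    (hk : ∀ u, q u = 0 ↔ ∃ v, u = p • v) :
    ∃ (d : ℕ) (l : Fin d → L), Nat.card V = p ^ d ∧
      (∀ u, ∃ (N : Fin d → ℕ) (v : L), u = ∑ i, N i • l i + p • v) ∧
      ∀ (N : Fin d → ℕ) (v : L), ∑ i, N i • l i = p • v → ∀ i, p ∣ N i := by
  obtain ⟨d, ⟨B⟩, hcard⟩ := zbasis (p := p) V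
  choose l hl using fun i => hq (B i)
  refine ⟨d, l, hcard, ?_, ?_⟩
  · intro u
    refine ⟨fun i => (B.repr (q u) i).val, ?_⟩
    have h1 : q (u - ∑ i, (B.repr (q u) i).val • l i) = 0 := by
      rw [map_sub, map_sum, sub_eq_zero]
      conv_lhs => rw [← B.sum_repr (q u)]
      refine Finset.sum_congr rfl fun i _ => ?_
      rw [map_nsmul, hl, ← Nat.cast_smul_eq_nsmul (ZMod p), ZMod.natCast_zmod_val]
    obtain ⟨v, hv⟩ := (hk _).1 h1
    exact ⟨v, by rw [← hv]; abel⟩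
  · intro N v h i
    have h1 := (hk _).2 ⟨v, h⟩
    simp only [map_sum, map_nsmul, hl, ← Nat.cast_smul_eq_nsmul (ZMod p)] at h1
    have h2 := Fintype.linearIndependent_iff.1 B.linearIndependent _ h1 i
    rwa [ZMod.natCast_eq_zero_iff] at h2

theorem lattice {p : ℕ} [hp : Fact p.Prime] {L : Type*} [AddCommGroup L] [Finite L] {s D : ℕ} (hs : 1 ≤ s)
    (kill : ∀ u : L, p ^ s • u = 0)
    (hom : ∀ j ≤ s, ∀ u : L, p ^ j • u = 0 → ∃ v, u = p ^ (s - j) • v)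
    (hD : Nat.card (L ⧸ (nsmulAddMonoidHom (α := L) p).range) ≤ D) :
    ∃ d ≤ D, ∃ f : (Fin d → ℤ_[p]) →+ L, Function.Surjective f ∧ ∀ x, f x = 0 ↔ x ∈ Ip p d s := by
  classical
  have : NeZero (p ^ s) := ⟨pow_ne_zero _ hp.out.ne_zero⟩
  let M1 : Module (ZMod (p ^ s)) L := AddCommGroup.zmodModule kill
  let M2 : Module ℤ_[p] L := Module.compHom L (PadicInt.toZModPow (p := p) s)
  have hpj : ∀ (j : ℕ) (u : L), (p ^ j : ℤ_[p]) • u = p ^ j • u := by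
    intro j u
    rw [← Nat.cast_pow, Nat.cast_smul_eq_nsmul]
  have happ : ∀ z : ℤ_[p], ∃ y, z = (z.appr s : ℤ_[p]) + p ^ s * y := by
    intro z
    obtain ⟨y, hy⟩ := Ideal.mem_span_singleton.1 (PadicInt.appr_spec s z)
    exact ⟨y, by rw [← hy]; ring⟩
  have hsm : ∀ (z : ℤ_[p]) (u : L), z • u = z.appr s • u := by
    intro z u
    obtain ⟨y, hy⟩ := happ z
    conv_lhs => rw [hy]
    rw [add_smul, mul_smul, hpj, kill, add_zero, Nat.cast_smul_eq_nsmul]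
  set T := (nsmulAddMonoidHom (α := L) p).range with hT
  have hpV : ∀ v : L ⧸ T, p • v = 0 := by
    intro v
    obtain ⟨u, rfl⟩ := QuotientAddGroup.mk_surjective v
    exact (QuotientAddGroup.eq_zero_iff (p • u)).2 ⟨u, rfl⟩
  let M3 : Module (ZMod p) (L ⧸ T) := AddCommGroup.zmodModule hpV
  obtain ⟨d, l, hcard, hgen', hind'⟩ := zlift (p := p) (L ⧸ T) (QuotientAddGroup.mk' T)
    (QuotientAddGroup.mk'_surjective T) (by
      intro u
      rw [QuotientAddGroup.mk'_apply, QuotientAddGroup.eq_zero_iff]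
      constructor
      · rintro ⟨v, hv⟩; exact ⟨v, hv.symm⟩
      · rintro ⟨v, hv⟩; exact ⟨v, hv.symm⟩)
  let f : (Fin d → ℤ_[p]) →ₗ[ℤ_[p]] L := Fintype.linearCombination ℤ_[p] l
  have hf : ∀ x, f x = ∑ i, x i • l i := fun x => Fintype.linearCombination_apply _ _ _
  have hgen : ∀ u : L, ∃ x v, u = f x + p • v := by
    intro u
    obtain ⟨N, v, h⟩ := hgen' u
    refine ⟨fun i => (N i : ℤ_[p]), v, ?_⟩
    rw [hf]
    simp only [Nat.cast_smul_eq_nsmul]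
    exact h
  have hsurj : Function.Surjective f := by
    have h1 : ∀ t, ∀ u : L, ∃ x v, u = f x + p ^ t • v := by
      intro t
      induction t with
      | zero => intro u; exact ⟨0, u, by simp⟩
      | succ t ih =>
        intro u
        obtain ⟨x, v, rfl⟩ := ih u
        obtain ⟨x', v', rfl⟩ := hgen v
        refine ⟨x + (p ^ t : ℤ_[p]) • x', v', ?_⟩
        rw [map_add, map_smul, hpj, smul_add, pow_succ, mul_smul, add_assoc]
    intro u
    obtain ⟨x, v, rfl⟩ := h1 s u
    exact ⟨x, by rw [kill, add_zero]⟩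
  have hind : ∀ x v, f x = p • v → x ∈ Ip p d 1 := by
    intro x v hx i
    rw [hf] at hx
    simp only [hsm] at hx
    have h2 := hind' _ v hx i
    obtain ⟨y, hy⟩ := happ (x i)
    rw [pow_one, hy]
    refine dvd_add ?_ ?_
    · exact_mod_cast Nat.cast_dvd_cast (α := ℤ_[p]) h2
    · exact (dvd_pow_self _ (by omega)).mul_right _
  refine ⟨d, ?_, f.toAddMonoidHom, hsurj, ?_⟩
  · rw [hcard] at hD
    exact (Nat.lt_pow_self hp.out.one_lt).le.trans hD
  · intro x
    constructor
    · intro hx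
      have hx : f x = 0 := hx
      have h1 : ∀ t ≤ s, x ∈ Ip p d t := by
        intro t
        induction t with
        | zero => intro _ l; simp
        | succ t ih =>
          intro ht
          choose y hy using ih (by omega)
          have hxy : x = (p ^ t : ℤ_[p]) • y := by ext l; rw [hy]; rfl
          rw [hxy, map_smul, hpj] at hx
          obtain ⟨v, hv⟩ := hom t (by omega) _ hx
          obtain ⟨e, he⟩ : ∃ e, s - t = e + 1 := ⟨s - t - 1, by omega⟩
          have h2 := hind y (p ^ e • v) (by rw [hv, he, pow_succ', mul_smul])
          intro l
          rw [hy l, pow_succ]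
          exact mul_dvd_mul_left _ (by simpa using h2 l)
      exact h1 s le_rfl
    · intro hx
      choose y hy using hx
      have hxy : x = (p ^ s : ℤ_[p]) • y := by ext l; rw [hy]; rfl
      show f x = 0
      rw [hxy, map_smul, hpj, kill]

theorem fixq {p : ℕ} (hp : p.Prime) {L : Type} [AddCommGroup L] [Finite L] {s k : ℕ}
    (kill : ∀ u : L, p ^ s • u = 0) (F : L →+ L)
    (hF : Nat.card (F - AddMonoidHom.id L : L →+ L).ker ≤ p ^ k) (t : ℕ) (u v : L)
    (h : F u - u = p ^ t • v) : ∃ w, p ^ k • u = p ^ t • w := by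
  set T := (nsmulAddMonoidHom (α := L) (p ^ t)).range
  let F' : L ⧸ T →+ L ⧸ T := QuotientAddGroup.map T T (F - AddMonoidHom.id L) (by
    rintro _ ⟨u, rfl⟩
    refine ⟨(F - AddMonoidHom.id L : L →+ L) u, ?_⟩
    exact (map_nsmul (F - AddMonoidHom.id L : L →+ L) (p ^ t) u).symm)
  have h1 := (card_ker_le_of_surj (QuotientAddGroup.mk' T) (QuotientAddGroup.mk'_surjective T)
    (F - AddMonoidHom.id L) F' (fun u => rfl)).trans hF
  have hker : ((u : L) : L ⧸ T) ∈ F'.ker :=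
    (QuotientAddGroup.eq_zero_iff _).2 ⟨v, h.symm⟩
  have h2 := kill_of_card (U := F'.ker) (e := s) hp (by
    rintro ⟨x, hx⟩
    obtain ⟨y, rfl⟩ := QuotientAddGroup.mk_surjective x
    refine Subtype.ext ?_
    have := congrArg (QuotientAddGroup.mk' T) (kill y)
    rw [map_nsmul, map_zero] at this
    exact this) h1 ⟨_, hker⟩
  have h3 : ((p ^ k • u : L) : L ⧸ T) = 0 := congrArg Subtype.val h2
  obtain ⟨w, hw⟩ := (QuotientAddGroup.eq_zero_iff _).1 h3
  exact ⟨w, hw.symm⟩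

theorem cpt2 {p : ℕ} (hp : p.Prime) (n m k D c : ℕ) : ∃ s0, ∀ s ≥ s0, ∀ (L : Type) [AddCommGroup L]
    [Finite L] (br : L →+ L →+ L) (F : L →+ L),
    (∀ u : L, p ^ s • u = 0) →
    (∀ j ≤ s, ∀ u : L, p ^ j • u = 0 → ∃ v, u = p ^ (s - j) • v) →
    Nat.card (L ⧸ (nsmulAddMonoidHom (α := L) p).range) ≤ D →
    (∀ x, br x x = 0) → (∀ x y z, br x (br y z) = br (br x y) z + br y (br x z)) →
    (∀ x y, F (br x y) = br (F x) (F y)) → (∀ x, F^[p ^ (n + 1)] x = x) →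
    Nat.card {x // F x = x} ≤ p ^ m → Nat.card {x // F^[p ^ n] x = x} ≤ p ^ k →
    ∀ xs, ∃ v, prF (fun x y => br x y) xs m = p ^ c • v := by
  have := Fact.mk hp
  choose S hS using fun d => cpt1 (p := p) n m k d c
  refine ⟨(∑ d ∈ Finset.range (D + 1), S d) + c + 1, ?_⟩
  intro s hs L _ _ br F kill hom hD halt hjac hF hn hm hk
  obtain ⟨d, hd, f, hsurj, hker⟩ := lattice (by omega) kill hom hD
  have hSd : S d ≤ s := by
    have := Finset.single_le_sum (f := S) (fun i _ => Nat.zero_le _) (Finset.mem_range.2 (show d < D + 1 by omega))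
    omega
  choose g hg using hsurj
  let e : Fin d → Fin d → ℤ_[p] := fun i => Pi.single i 1
  have happ : ∀ z : ℤ_[p], ∃ y, z = (z.appr s : ℤ_[p]) + p ^ s * y := by
    intro z
    obtain ⟨y, hy⟩ := Ideal.mem_span_singleton.1 (PadicInt.appr_spec s z)
    exact ⟨y, by rw [← hy]; ring⟩
  have hfs : ∀ (z : ℤ_[p]) x, f (z • x) = z.appr s • f x := by
    intro z x
    obtain ⟨y, hy⟩ := happ z
    conv_lhs => rw [hy]
    rw [add_smul, mul_smul, Nat.cast_smul_eq_nsmul, ← Nat.cast_pow, Nat.cast_smul_eq_nsmul,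
      map_add, map_nsmul, map_nsmul, kill, add_zero]
  have hx : ∀ x : Fin d → ℤ_[p], x = ∑ i, x i • e i := by
    intro x; exact pi_eq_sum_univ' x |>.trans (by simp [e])
  have hfx : ∀ x, f x = ∑ i, (x i).appr s • f (e i) := by
    intro x
    conv_lhs => rw [hx x]
    rw [map_sum]; simp only [hfs]
  let b : Fin d → Fin d → Fin d → ℤ_[p] := fun i j => g (br (f (e i)) (f (e j)))
  let a : Fin d → Fin d → ℤ_[p] := fun i => g (F (f (e i)))
  have hfb : ∀ x y, f (brF b x y) = br (f x) (f y) := by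
    intro x y
    rw [hfx x, hfx y, brF]
    simp only [map_sum, AddMonoidHom.finsetSum_apply, map_nsmul, AddMonoidHom.nsmul_apply, mul_smul, hfs, b, hg,
      Finset.smul_sum]
    rw [Finset.sum_comm]
    exact Finset.sum_congr rfl fun j _ => Finset.sum_congr rfl fun i _ => smul_comm _ _ _
  have hfa : ∀ x, f (phF a x) = F (f x) := by
    intro x
    rw [hfx x, phF]
    simp only [map_sum, map_nsmul, hfs, a, hg]
  have hfit : ∀ i x, f ((phF a)^[i] x) = F^[i] (f x) := by
    intro i x
    induction i with
    | zero => rfl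
    | succ i ih => rw [Function.iterate_succ_apply', Function.iterate_succ_apply', hfa, ih]
  have hIt : ∀ t ≤ s, ∀ x, x ∈ Ip p d t ↔ ∃ v, f x = p ^ t • v := by
    intro t ht x
    constructor
    · intro hx
      choose y hy using hx
      have hxy : x = p ^ t • y := by ext l; rw [hy]; simp
      exact ⟨f y, by rw [hxy, map_nsmul]⟩
    · rintro ⟨v, hv⟩
      have h1 : f (x - p ^ t • g v) = 0 := by rw [map_sub, map_nsmul, hg, hv, sub_self]
      have h2 := Ip_anti ht ((hker _).1 h1)
      intro l
      have h3 := h2 l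
      have h4 : x l = (x - p ^ t • g v) l + p ^ t * g v l := by simp
      rw [h4]
      exact dvd_add h3 (dvd_mul_right _ _)
  rw [← Env.ker_card_fix] at hm
  have hFit : ∀ i, ∃ Fi : L →+ L, ∀ x, Fi x = F^[i] x := by
    intro i
    induction i with
    | zero => exact ⟨AddMonoidHom.id L, fun x => rfl⟩
    | succ i ih =>
      obtain ⟨Fi, h⟩ := ih
      exact ⟨F.comp Fi, fun x => by rw [Function.iterate_succ_apply', ← h]; rfl⟩
  obtain ⟨ψ, hψ⟩ := hFit (p ^ n)
  simp only [← hψ] at hk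
  rw [← Env.ker_card_fix] at hk
  rw [card_ker_eq_coker] at hm
  obtain ⟨r, hr⟩ : ∃ r : Fin (p ^ m) → L, ∀ u, ∃ j y, u = r j + (F y - y) := by
    set T := (F - AddMonoidHom.id L : L →+ L).range
    have e1 := Finite.equivFin (L ⧸ T)
    choose t ht using fun x : L ⧸ T => QuotientAddGroup.mk_surjective x
    refine ⟨fun j => if h : j.1 < Nat.card (L ⧸ T) then t (e1.symm ⟨j.1, h⟩) else 0, fun u => ?_⟩
    refine ⟨⟨(e1 (u : L ⧸ T)).1, (e1 _).2.trans_le hm⟩, ?_⟩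
    have h1 := ht (u : L ⧸ T)
    obtain ⟨y, hy⟩ := QuotientAddGroup.eq.1 h1
    refine ⟨y, ?_⟩
    have hy : F y - y = - t (u : L ⧸ T) + u := hy
    rw [hy]
    simp
  have hC : Cnd n m k s b a (fun j => g (r j)) := by
    refine ⟨?_, ?_, ?_, ?_, ?_, ?_⟩
    · intro x; rw [← hker, hfb, halt]
    · intro x y z; rw [← hker]; simp only [map_sub, map_add, hfb]; rw [hjac, sub_self]
    · intro x y; rw [← hker]; simp only [map_sub, hfa, hfb]; rw [hF, sub_self]
    · intro x; rw [← hker, map_sub, hfit, hn, sub_self]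
    · intro t ht v hv
      obtain ⟨w, hw⟩ := (hIt t ht _).1 hv
      rw [map_sub, hfit, ← hψ] at hw
      obtain ⟨w', hw'⟩ := fixq hp kill ψ hk t _ _ hw
      refine (hIt t ht _).2 ⟨w', ?_⟩
      rw [← hw', ← Nat.cast_pow, Nat.cast_smul_eq_nsmul, map_nsmul]
    · intro x
      obtain ⟨j, y, hy⟩ := hr (f x)
      refine ⟨j, g y, Ip_anti (by omega : 1 ≤ s) ((hker _).1 ?_)⟩
      simp only [map_sub, hfa, hg]
      rw [hy]; abel
  intro xs
  have h1 := hS d s hSd b a _ hC (fun i => g (xs i))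
  have h2 : ∀ i, f (prF (brF b) (fun i => g (xs i)) i) = prF (fun x y => br x y) xs i := by
    intro i
    induction i with
    | zero => exact hg _
    | succ i ih => simp only [prF, hfb, hg, ih]
  obtain ⟨v, hv⟩ := (hIt c (by omega) _).1 h1
  exact ⟨v, by rw [← h2, hv]⟩
end lat
end PG
namespace PG
section lieM
variable {L : Type*} [AddCommGroup L]

/-- lower central series (additive) -/
def gam (br : L →+ L →+ L) : ℕ → AddSubgroup L
  | 0 => ⊤
  | i + 1 => AddSubgroup.closure {z | ∃ x, ∃ v ∈ gam br i, z = br x v}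

variable {br : L →+ L →+ L}

theorem gam_mem {i : ℕ} (x : L) {v : L} (hv : v ∈ gam br i) : br x v ∈ gam br (i + 1) :=
  AddSubgroup.subset_closure ⟨x, v, hv, rfl⟩

theorem gam_anti (i : ℕ) : gam br (i + 1) ≤ gam br i := by
  induction i with
  | zero => exact le_top
  | succ i ih =>
    refine AddSubgroup.closure_mono ?_
    rintro _ ⟨w, v, hv, rfl⟩
    exact ⟨w, v, ih hv, rfl⟩

theorem gam_anti' {i j : ℕ} (h : i ≤ j) : gam br j ≤ gam br i :=
  antitone_nat_of_succ_le (f := gam br) gam_anti h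

theorem gam_br (hjac : ∀ x y z, br x (br y z) = br (br x y) z + br y (br x z)) (i : ℕ) :
    ∀ j, ∀ u ∈ gam br i, ∀ v ∈ gam br j, br u v ∈ gam br (i + j + 1) := by
  induction i with
  | zero => intro j u _ v hv; rw [zero_add]; exact gam_mem u hv
  | succ i ih =>
    intro j u hu v hv
    induction hu using AddSubgroup.closure_induction with
    | mem u hu =>
      obtain ⟨x, u, hu, rfl⟩ := hu
      have h1 : br (br x u) v = br x (br u v) - br u (br x v) := by rw [hjac]; abel
      rw [h1]
      refine sub_mem ?_ ?_
      · have := gam_mem x (ih j u hu v hv)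
        rwa [show i + 1 + j + 1 = i + j + 1 + 1 by omega]
      · have := ih (j + 1) u hu _ (gam_mem x hv)
        rwa [show i + 1 + j + 1 = i + (j + 1) + 1 by omega]
    | zero => simp
    | add a b _ _ ha hb => rw [map_add, AddMonoidHom.add_apply]; exact add_mem ha hb
    | neg a _ ha => rw [map_neg, AddMonoidHom.neg_apply]; exact neg_mem ha

theorem prF_congr {L : Type*} {br : L → L → L} {xs ys : ℕ → L} {i : ℕ} (h : ∀ j ≤ i, xs j = ys j) :
    prF br xs i = prF br ys i := by
  induction i with
  | zero => exact h 0 le_rfl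
  | succ i ih => rw [prF, prF, h _ le_rfl, ih fun j hj => h j (by omega)]

theorem gam_prF (i : ℕ) : gam br i ≤ AddSubgroup.closure (Set.range fun xs => prF (fun x y => br x y) xs i) := by
  induction i with
  | zero => intro x _; exact AddSubgroup.subset_closure ⟨fun _ => x, rfl⟩
  | succ i ih =>
    refine (AddSubgroup.closure_le _).2 ?_
    rintro _ ⟨x, v, hv, rfl⟩
    replace hv := ih hv
    show br x v ∈ _
    induction hv using AddSubgroup.closure_induction with
    | mem v hv =>
      obtain ⟨xs, rfl⟩ := hv
      refine AddSubgroup.subset_closure ⟨fun j => if j = i + 1 then x else xs j, ?_⟩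
      show br (if i + 1 = i + 1 then x else xs (i + 1)) (prF _ _ i) = _
      rw [if_pos rfl]
      congr 1
      refine prF_congr fun j hj => ?_
      rw [if_neg (by omega)]
    | zero => simp
    | add a b _ _ ha hb => rw [map_add]; exact add_mem ha hb
    | neg a _ ha => rw [map_neg]; exact neg_mem ha

theorem gam_map {G : L →+ L} (hG : ∀ x y, G (br x y) = br (G x) (G y)) (i : ℕ) :
    ∀ u ∈ gam br i, G u ∈ gam br i := by
  induction i with
  | zero => intro u _; trivial
  | succ i ih =>
    intro u hu
    induction hu using AddSubgroup.closure_induction with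
    | mem v hv => obtain ⟨x, v, hv, rfl⟩ := hv; rw [hG]; exact gam_mem _ (ih v hv)
    | zero => simp
    | add a b _ _ ha hb => rw [map_add]; exact add_mem ha hb
    | neg a _ ha => rw [map_neg]; exact neg_mem ha

theorem lieM (hjac : ∀ x y z, br x (br y z) = br (br x y) z + br y (br x z)) {p m c : ℕ} (hc : m + 1 ≤ c)
    (hpr : ∀ xs, ∃ v, prF (fun x y => br x y) xs m = p ^ (2 * c) • v) :
    ∃ M : AddSubgroup L, (∀ u, p ^ (c - 1) • u ∈ M) ∧ (∀ x ∈ M, ∀ y ∈ M, ∃ z ∈ M, br x y = p ^ c • z) ∧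
      ∀ G : L →+ L, (∀ x y, G (br x y) = br (G x) (G y)) → ∀ x ∈ M, G x ∈ M := by
  have hgm : ∀ i, m ≤ i → ∀ u ∈ gam br i, ∃ v, u = p ^ (2 * c) • v := by
    intro i hi u hu
    have h1 := gam_prF m (gam_anti' hi hu)
    have h2 : AddSubgroup.closure (Set.range fun xs => prF (fun x y => br x y) xs m) ≤
        (nsmulAddMonoidHom (α := L) (p ^ (2 * c))).range := by
      refine (AddSubgroup.closure_le _).2 ?_
      rintro _ ⟨xs, rfl⟩
      obtain ⟨v, hv⟩ := hpr xs
      exact ⟨v, hv.symm⟩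
    obtain ⟨v, hv⟩ := h2 h1
    exact ⟨v, hv.symm⟩
  set S : Set L := {z | ∃ i < c, ∃ v ∈ gam br i, z = p ^ (c - 1 - i) • v} with hS
  have ha : ∀ u, p ^ (c - 1) • u ∈ AddSubgroup.closure S := fun u =>
    AddSubgroup.subset_closure ⟨0, by omega, u, trivial, rfl⟩
  refine ⟨AddSubgroup.closure S, ha, ?_, ?_⟩
  · intro x hx y hy
    suffices h : br x y ∈ (AddSubgroup.closure S).map (nsmulAddMonoidHom (α := L) (p ^ c)) by
      obtain ⟨z, hz, h⟩ := h
      exact ⟨z, hz, h.symm⟩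
    induction hx using AddSubgroup.closure_induction with
    | zero => simp
    | add a b _ _ ha hb => rw [map_add, AddMonoidHom.add_apply]; exact add_mem ha hb
    | neg a _ ha => rw [map_neg, AddMonoidHom.neg_apply]; exact neg_mem ha
    | mem x hx =>
      induction hy using AddSubgroup.closure_induction with
      | zero => simp
      | add a b _ _ ha hb => rw [map_add]; exact add_mem ha hb
      | neg a _ ha => rw [map_neg]; exact neg_mem ha
      | mem y hy =>
        obtain ⟨i, hi, u, hu, rfl⟩ := hx
        obtain ⟨j, hj, v, hv, rfl⟩ := hy
        have h1 := gam_br hjac i j u hu v hv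
        have h2 : br (p ^ (c - 1 - i) • u) (p ^ (c - 1 - j) • v) =
            p ^ (c - 1 - i + (c - 1 - j)) • br u v := by
          rw [map_nsmul, map_nsmul, AddMonoidHom.nsmul_apply, smul_smul, ← pow_add, add_comm]
        rw [h2]
        by_cases hij : i + j + 1 < c
        · refine ⟨p ^ (c - 1 - (i + j + 1)) • br u v, AddSubgroup.subset_closure ⟨_, hij, _, h1, rfl⟩, ?_⟩
          show p ^ c • p ^ (c - 1 - (i + j + 1)) • br u v = _
          rw [smul_smul, ← pow_add]
          congr 2; omega
        · obtain ⟨w, hw⟩ := hgm _ (by omega) _ h1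
          refine ⟨p ^ (c - 1) • p ^ (2 * c - 1 - i - j) • w, ha _, ?_⟩
          show p ^ c • p ^ (c - 1) • p ^ (2 * c - 1 - i - j) • w = _
          rw [hw, smul_smul, smul_smul, smul_smul, ← pow_add, ← pow_add, ← pow_add]
          congr 2; omega
  · intro G hG x hx
    induction hx using AddSubgroup.closure_induction with
    | zero => simp
    | add a b _ _ ha hb => rw [map_add]; exact add_mem ha hb
    | neg a _ ha => rw [map_neg]; exact neg_mem ha
    | mem x hx =>
      obtain ⟨i, hi, v, hv, rfl⟩ := hx
      rw [map_nsmul]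
      exact AddSubgroup.subset_closure ⟨i, hi, _, gam_map hG i v hv, rfl⟩

theorem cpt3 {p : ℕ} (hp : p.Prime) (n m k D : ℕ) : ∃ s0, ∀ s ≥ s0, ∀ (L : Type) [AddCommGroup L]
    [Finite L] (br : L →+ L →+ L) (F : L →+ L),
    (∀ u : L, p ^ s • u = 0) →
    (∀ j ≤ s, ∀ u : L, p ^ j • u = 0 → ∃ v, u = p ^ (s - j) • v) →
    Nat.card (L ⧸ (nsmulAddMonoidHom (α := L) p).range) ≤ D →
    (∀ x, br x x = 0) → (∀ x y z, br x (br y z) = br (br x y) z + br y (br x z)) →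
    (∀ x y, F (br x y) = br (F x) (F y)) → (∀ x, F^[p ^ (n + 1)] x = x) →
    Nat.card {x // F x = x} ≤ p ^ m → Nat.card {x // F^[p ^ n] x = x} ≤ p ^ k →
    ∃ M : AddSubgroup L, (∀ u : L, p ^ (m + 2 - 1) • u ∈ M) ∧
      (∀ x ∈ M, ∀ y ∈ M, ∃ z ∈ M, br x y = p ^ (m + 2) • z) ∧
      ∀ G : L →+ L, (∀ x y, G (br x y) = br (G x) (G y)) → ∀ x ∈ M, G x ∈ M := by
  obtain ⟨s0, hs0⟩ := cpt2 hp n m k D (2 * (m + 2))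
  refine ⟨s0, fun s hs L _ _ br F h1 h2 h3 h4 h5 h6 h7 h8 h9 => ?_⟩
  exact lieM h5 (by omega) (hs0 s hs L br F h1 h2 h3 h4 h5 h6 h7 h8 h9)
end lieM
end PG
namespace PG
section pair
open scoped commutatorElement
variable {P : Type} [Group P] {A B C T : Subgroup P} {U : Type} [AddCommGroup U] {q : P → U}

/-- commutator pairing data -/
structure Pr (A B C T : Subgroup P) {U : Type} [AddCommGroup U] (q : P → U) : Prop where
  quo : Quo C T q
  tn : T.Normal
  hAB : ⁅A, B⁆ ≤ C
  hAC : ⁅A, C⁆ ≤ T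
  hBC : ⁅B, C⁆ ≤ T

namespace Pr

theorem symm (h : Pr A B C T q) : Pr B A C T q :=
  ⟨h.quo, h.tn, by rw [Subgroup.commutator_comm]; exact h.hAB, h.hBC, h.hAC⟩

theorem mem (h : Pr A B C T q) {a b : P} (ha : a ∈ A) (hb : b ∈ B) : ⁅a, b⁆ ∈ C :=
  h.hAB (Subgroup.commutator_mem_commutator ha hb)

theorem skew (h : Pr A B C T q) {a b : P} (ha : a ∈ A) (hb : b ∈ B) : q ⁅b, a⁆ = - q ⁅a, b⁆ := by
  rw [← commutatorElement_inv, h.quo.inv (h.mem ha hb)]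

theorem conj_q (h : Pr A B C T q) {a c : P} (ha : a ∈ A) (hc : c ∈ C) (hT : T ≤ C) :
    a * c * a⁻¹ ∈ C ∧ q (a * c * a⁻¹) = q c := by
  have h1 : ⁅a, c⁆ ∈ T := h.hAC (Subgroup.commutator_mem_commutator ha hc)
  have h2 : a * c * a⁻¹ = ⁅a, c⁆ * c := by rw [commutatorElement_def]; group
  rw [h2]
  refine ⟨mul_mem (hT h1) hc, ?_⟩
  rw [h.quo.add _ (hT h1) _ hc, (h.quo.ker _ (hT h1)).2 h1, zero_add]

theorem left (h : Pr A B C T q) (hT : T ≤ C) {a a' b : P} (ha : a ∈ A) (ha' : a' ∈ A) (hb : b ∈ B) :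
    q ⁅a * a', b⁆ = q ⁅a, b⁆ + q ⁅a', b⁆ := by
  have h1 : ⁅a * a', b⁆ = a * ⁅a', b⁆ * a⁻¹ * ⁅a, b⁆ := by simp only [commutatorElement_def]; group
  have h2 := h.conj_q ha (h.mem ha' hb) hT
  rw [h1, h.quo.add _ h2.1 _ (h.mem ha hb), h2.2, add_comm]

theorem right (h : Pr A B C T q) (hT : T ≤ C) {a b b' : P} (ha : a ∈ A) (hb : b ∈ B) (hb' : b' ∈ B) :
    q ⁅a, b * b'⁆ = q ⁅a, b⁆ + q ⁅a, b'⁆ := by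
  rw [h.symm.skew (mul_mem hb hb') ha, h.symm.left hT hb hb' ha, h.symm.skew hb ha,
    h.symm.skew hb' ha]; abel

theorem right_one (h : Pr A B C T q) {a : P} : q ⁅a, (1 : P)⁆ = 0 := by
  rw [commutatorElement_one_right, h.quo.one]

theorem right_conj (h : Pr A B C T q) (hT : T ≤ C) {a b b' : P} (ha : a ∈ A) (hb : b ∈ B) (hb' : b' ∈ B) :
    q ⁅a, b * b' * b⁻¹⁆ = q ⁅a, b'⁆ := by
  have h1 := h.right hT ha hb (inv_mem hb)
  rw [mul_inv_cancel, h.right_one] at h1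
  rw [h.right hT ha (mul_mem hb hb') (inv_mem hb), h.right hT ha hb hb', add_right_comm, ← h1, zero_add]

end Pr

theorem hall_witt (x y z : P) :
    ⁅⁅x, y⁆, y * z * y⁻¹⁆ * ⁅⁅y, z⁆, z * x * z⁻¹⁆ * ⁅⁅z, x⁆, x * y * x⁻¹⁆ = 1 := by
  simp only [commutatorElement_def]; group

theorem Pr.jac {K : Subgroup P} {C' T' : Subgroup P} {U' : Type} [AddCommGroup U'] {q' : P → U'}
    (h' : Pr C K C' T' q') (hK : ⁅K, K⁆ ≤ C) (hT : T' ≤ C') {x y z : P} (hx : x ∈ K) (hy : y ∈ K) (hz : z ∈ K) :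
    q' ⁅⁅x, y⁆, z⁆ + q' ⁅⁅y, z⁆, x⁆ + q' ⁅⁅z, x⁆, y⁆ = 0 := by
  have m : ∀ {a b : P}, a ∈ K → b ∈ K → ⁅a, b⁆ ∈ C := fun ha hb =>
    hK (Subgroup.commutator_mem_commutator ha hb)
  have c : ∀ {a b : P}, a ∈ K → b ∈ K → a * b * a⁻¹ ∈ K := fun ha hb =>
    mul_mem (mul_mem ha hb) (inv_mem ha)
  have h1 := congrArg q' (hall_witt x y z)
  rw [h'.quo.add _ (mul_mem (h'.mem (m hx hy) (c hy hz)) (h'.mem (m hy hz) (c hz hx))) _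
    (h'.mem (m hz hx) (c hx hy)), h'.quo.add _ (h'.mem (m hx hy) (c hy hz)) _ (h'.mem (m hy hz) (c hz hx)),
    h'.right_conj hT (m hx hy) hy hz, h'.right_conj hT (m hy hz) hz hx,
    h'.right_conj hT (m hz hx) hx hy, h'.quo.one] at h1
  exact h1

/-- bilinear pairing on quotients -/
theorem Pr.bil {U' : Type} [AddCommGroup U'] {q' : P → U'} {K T0 : Subgroup P} (h : Pr K K C T q)
    (hT : T ≤ C) (h0 : Quo K T0 q') (hK0 : ⁅K, T0⁆ ≤ T) :
    ∃ cm : U' →+ U' →+ U, ∀ x ∈ K, ∀ y ∈ K, cm (q' x) (q' y) = q ⁅x, y⁆ := by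
  have h1 : ∀ x : P, ∃ g : U' →+ U, x ∈ K → ∀ y ∈ K, g (q' y) = q ⁅x, y⁆ := by
    intro x
    by_cases hx : x ∈ K
    · obtain ⟨g, hg⟩ := h0.lift (fun y => q ⁅x, y⁆) (fun y hy z hz => h.right hT hx hy hz)
        (fun y hy hyT => by
          have hm : ⁅x, y⁆ ∈ T := hK0 (Subgroup.commutator_mem_commutator hx hyT)
          exact (h.quo.ker _ (hT hm)).2 hm)
      exact ⟨g, fun _ => hg⟩
    · exact ⟨0, fun h => absurd h hx⟩
  choose g hg using h1
  obtain ⟨cm, hcm⟩ := h0.lift g (by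
    intro x hx y hy
    ext u
    obtain ⟨z, hz, rfl⟩ := h0.surj u
    rw [hg _ (mul_mem hx hy) z hz, AddMonoidHom.add_apply, hg x hx z hz, hg y hy z hz,
      h.left hT hx hy hz]) (by
    intro x hx hxT
    ext u
    obtain ⟨z, hz, rfl⟩ := h0.surj u
    have hm : ⁅z, x⁆ ∈ T := hK0 (Subgroup.commutator_mem_commutator hz hxT)
    rw [hg x hx z hz, h.skew hz hx, (h.quo.ker _ (hT hm)).2 hm, neg_zero]; rfl)
  exact ⟨cm, fun x hx y hy => by rw [hcm x hx, hg x hx y hy]⟩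
end pair
end PG
namespace PG
section lie
open scoped commutatorElement
variable {P : Type} [Group P] {p w : ℕ} {φ : MulAut P} {G0 K : Subgroup P}

theorem Env.lie (E : Env p w φ G0) (hw : 1 ≤ w) (hK : Good φ G0 K) {W A s : ℕ}
    (hKW : ⁅K, K⁆ ≤ (pw p)^[W] K) (hW : w + 1 ≤ W) (hu : Unif p K A) (hA : 2 * W + s ≤ A)
    (hs : s ≤ w) {U : Type} [AddCommGroup U] {q : P → U} (hq : Quo K ((pw p)^[s] K) q) :
    ∃ (U' : Type) (_ : AddCommGroup U') (q' : P → U') (h : U →+ U') (br : U →+ U →+ U),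
      Quo ((pw p)^[W] K) ((pw p)^[s + W] K) q' ∧ Function.Injective h ∧
      (∀ x ∈ K, h (q x) = q' (x ^ (p ^ W))) ∧
      (∀ x ∈ K, ∀ y ∈ K, h (br (q x) (q y)) = q' ⁅x, y⁆) ∧
      (∀ x, br x x = 0) ∧ (∀ x y z, br x (br y z) = br (br x y) z + br y (br x z)) := by
  have hKW1 : Good φ G0 ((pw p)^[W] K) := hK.pwi W
  have hKW2 : Good φ G0 ((pw p)^[W] ((pw p)^[W] K)) := hKW1.pwi W
  obtain ⟨U', i1, q', -, hq', -⟩ := E.quo_exists hKW1 hs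
  obtain ⟨U2, i2, q2, -, hq2, -⟩ := E.quo_exists hKW2 hs
  obtain ⟨h, hsur, hh⟩ := E.powmap hK hs hq rfl hq'
  obtain ⟨h2, hsur2, hh2⟩ := E.powmap hKW1 hs hq' rfl hq2
  have hinj : Function.Injective h := by
    rw [injective_iff_map_eq_zero]
    intro u hu0
    obtain ⟨x, hx, rfl⟩ := hq.surj u
    rw [hh x hx, hq'.ker _ (pow_mem_pwi W hx), pwi_add] at hu0
    rw [hq.ker x hx]
    exact hu.root (e := W) (by omega) hx (by rwa [add_comm W s])
  have hinj2 : Function.Injective h2 := by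
    rw [injective_iff_map_eq_zero]
    intro u hu0
    obtain ⟨x, hx, rfl⟩ := hq'.surj u
    rw [hh2 x hx, hq2.ker _ (pow_mem_pwi W hx), pwi_add] at hu0
    rw [hq'.ker x hx]
    exact (hu.pwi (t := W)).root (e := W) (by omega) hx (by rwa [add_comm W s])
  have T1 : (pw p)^[s] ((pw p)^[W] K) = (pw p)^[s + W] K := pwi_add ..
  have T2 : (pw p)^[s] ((pw p)^[W] ((pw p)^[W] K)) = (pw p)^[s + W + W] K := by
    rw [pwi_add, pwi_add]
  have C2 : (pw p)^[W] ((pw p)^[W] K) = (pw p)^[W + W] K := pwi_add ..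
  rw [T1] at hq'
  rw [T2, C2] at hq2
  have hc : ∀ i, ⁅K, (pw p)^[i] K⁆ ≤ (pw p)^[i + W] K := by
    intro i
    rw [E.comm_pwi hw hK.1 hK i, ← pwi_add]
    exact pwi_mono i hKW
  have hc' : ∀ i, ⁅(pw p)^[i] K, K⁆ ≤ (pw p)^[i + W] K := by
    intro i; rw [Subgroup.commutator_comm]; exact hc i
  have pr1 : Pr K K ((pw p)^[W] K) ((pw p)^[s + W] K) q' :=
    ⟨hq', (hK.1.pwi _).1, hKW, (hc W).trans (pwi_anti (by omega)), (hc W).trans (pwi_anti (by omega))⟩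
  have pr2 : Pr ((pw p)^[W] K) K ((pw p)^[W + W] K) ((pw p)^[s + W + W] K) q2 := by
    refine ⟨hq2, (hK.1.pwi _).1, hc' W, ?_, (hc (W + W)).trans (pwi_anti (by omega))⟩
    exact (Subgroup.commutator_mono (pwi_le W) le_rfl).trans ((hc (W + W)).trans (pwi_anti (by omega)))
  have le1 : (pw p)^[s + W] K ≤ (pw p)^[W] K := pwi_anti (by omega)
  have le2 : (pw p)^[s + W + W] K ≤ (pw p)^[W + W] K := pwi_anti (by omega)
  obtain ⟨cm, hcm⟩ := pr1.bil le1 hq (hc s)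
  let e := AddEquiv.ofBijective h ⟨hinj, hsur⟩
  let br : U →+ U →+ U := (AddMonoidHom.compHom e.symm.toAddMonoidHom).comp cm
  have hbr : ∀ u v, h (br u v) = cm u v := fun u v => e.apply_symm_apply (cm u v)
  have hbr' : ∀ x ∈ K, ∀ y ∈ K, h (br (q x) (q y)) = q' ⁅x, y⁆ := by
    intro x hx y hy; rw [hbr, hcm x hx y hy]
  have halt : ∀ x, br x x = 0 := by
    intro u
    obtain ⟨x, hx, rfl⟩ := hq.surj u
    apply hinj
    rw [hbr' x hx x hx, commutatorElement_self, hq'.one, map_zero]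
  have hskew : ∀ u v, br u v = - br v u := by
    intro u v
    have := halt (u + v)
    simp only [map_add, AddMonoidHom.add_apply, halt, zero_add, add_zero] at this
    rw [eq_neg_iff_add_eq_zero]; rw [← this]; abel
  have hJ : ∀ x ∈ K, ∀ y ∈ K, ∀ z ∈ K, h2 (h (br (br (q x) (q y)) (q z))) = q2 ⁅⁅x, y⁆, z⁆ := by
    intro x hx y hy z hz
    obtain ⟨a, ha, hqa⟩ := hq.surj (br (q x) (q y))
    have mxy : ⁅x, y⁆ ∈ (pw p)^[W] K := pr1.mem hx hy
    have maz : ⁅a, z⁆ ∈ (pw p)^[W] K := pr1.mem ha hz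
    rw [← hqa, hbr' a ha z hz, hh2 _ maz]
    have h1 : q' (a ^ (p ^ W)) = q' ⁅x, y⁆ := by rw [← hh a ha, hqa, hbr' x hx y hy]
    have mA : a ^ (p ^ W) ∈ (pw p)^[W] K := pow_mem_pwi W ha
    have mt : (⁅x, y⁆)⁻¹ * a ^ (p ^ W) ∈ (pw p)^[s + W] K := by
      rw [← hq'.ker _ (mul_mem (inv_mem mxy) mA), hq'.add _ (inv_mem mxy) _ mA, hq'.inv mxy, h1]; simp
    have h3 : q2 ⁅a ^ (p ^ W), z⁆ = q2 ⁅⁅x, y⁆, z⁆ := by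
      have := pr2.left le2 mxy (le1 mt) hz
      rw [mul_inv_cancel_left] at this
      have mm : ⁅(⁅x, y⁆)⁻¹ * a ^ (p ^ W), z⁆ ∈ (pw p)^[s + W + W] K :=
        hc' (s + W) (Subgroup.commutator_mem_commutator mt hz)
      rw [this, (hq2.ker _ (le2 mm)).2 mm, add_zero]
    rw [← h3]
    have h4 := E.commpow hw hK hW hKW ha hz W
    have := (hK.1.pwi (p := p) (s + W + W)).1
    symm
    have m5 : ⁅a, z⁆ ^ (p ^ W) ∈ (pw p)^[W + W] K := pow_mem_pwi' W maz
    rw [hq2.eq_iff (pr2.mem mA hz) m5]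
    exact mk_eq_mono (pwi_anti (by omega)) h4
  refine ⟨U', i1, q', h, br, hq', hinj, hh, hbr', halt, ?_⟩
  intro u v t
  obtain ⟨x, hx, rfl⟩ := hq.surj u
  obtain ⟨y, hy, rfl⟩ := hq.surj v
  obtain ⟨z, hz, rfl⟩ := hq.surj t
  have hj := pr2.jac hKW le2 hx hy hz
  rw [← hJ x hx y hy z hz, ← hJ y hy z hz x hx, ← hJ z hz x hx y hy, ← map_add, ← map_add, ← map_add,
    ← map_add] at hj
  have h5 := (injective_iff_map_eq_zero h).1 hinj _ ((injective_iff_map_eq_zero h2).1 hinj2 _ hj)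
  rw [hskew (q x) (br (q y) (q z)), hskew (q y) (br (q x) (q z)), hskew (q x) (q z), map_neg,
    AddMonoidHom.neg_apply, neg_neg, neg_eq_iff_add_eq_zero, ← h5]
  abel
end lie
end PG
namespace PG
section stepd
open scoped commutatorElement
variable {P : Type} [Group P] {p w : ℕ} {φ : MulAut P} {G0 K : Subgroup P}

theorem map_mem_pwi {f : P →* P} (h : ∀ x ∈ K, f x ∈ K) (i : ℕ) :
    ∀ x ∈ (pw p)^[i] K, f x ∈ (pw p)^[i] K := by
  induction i with
  | zero => exact h
  | succ i ih => rw [pwi_succ]; exact map_mem_pw ih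

theorem br_hom {W s : ℕ} {U U' : Type} [AddCommGroup U] [AddCommGroup U'] {q : P → U} {q' : P → U'}
    (hKW : ⁅K, K⁆ ≤ (pw p)^[W] K)
    (hq : Quo K ((pw p)^[s] K) q) {h : U →+ U'} {br : U →+ U →+ U}
    (hq' : Quo ((pw p)^[W] K) ((pw p)^[s + W] K) q') (hinj : Function.Injective h)
    (hh : ∀ x ∈ K, h (q x) = q' (x ^ (p ^ W)))
    (hbr : ∀ x ∈ K, ∀ y ∈ K, h (br (q x) (q y)) = q' ⁅x, y⁆)
    {f : P →* P} (hf : ∀ x ∈ K, f x ∈ K) {G : U →+ U} (hG : ∀ x ∈ K, G (q x) = q (f x)) (u v : U) :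
    G (br u v) = br (G u) (G v) := by
  obtain ⟨x, hx, rfl⟩ := hq.surj u
  obtain ⟨y, hy, rfl⟩ := hq.surj v
  obtain ⟨b, hb, hqb⟩ := hq.surj (br (q x) (q y))
  have mxy : ⁅x, y⁆ ∈ (pw p)^[W] K := hKW (Subgroup.commutator_mem_commutator hx hy)
  have mb : b ^ (p ^ W) ∈ (pw p)^[W] K := pow_mem_pwi W hb
  have h1 : q' (b ^ (p ^ W)) = q' ⁅x, y⁆ := by rw [← hh b hb, hqb, hbr x hx y hy]
  have mt : (⁅x, y⁆)⁻¹ * b ^ (p ^ W) ∈ (pw p)^[s + W] K := by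
    rw [← hq'.ker _ (mul_mem (inv_mem mxy) mb), hq'.add _ (inv_mem mxy) _ mb, hq'.inv mxy, h1]; simp
  apply hinj
  have m1 := map_mem_pwi hf W _ mxy
  have m2 := map_mem_pwi hf W _ mb
  rw [← hqb, hG b hb, hG x hx, hG y hy, hh _ (hf b hb), hbr _ (hf x hx) _ (hf y hy), ← map_pow,
    ← map_commutatorElement]
  symm
  have h2 := map_mem_pwi hf (s + W) _ mt
  rw [map_mul, map_inv, ← hq'.ker _ (mul_mem (inv_mem m1) m2), hq'.add _ (inv_mem m1) _ m2,
    hq'.inv m1, neg_add_eq_zero] at h2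
  exact h2

theorem Env.card_modp (E : Env p w φ G0) (hw : 1 ≤ w) (hK : Good φ G0 K) {s : ℕ}
    (hs : 1 ≤ s) (hsw : s ≤ w) {U : Type} [AddCommGroup U] {q : P → U} (hq : Quo K ((pw p)^[s] K) q) :
    Nat.card (U ⧸ (nsmulAddMonoidHom (α := U) p).range) ≤ (pw p K).relIndex K := by
  have := E.fin
  obtain ⟨U1, _, q1, -, hq1, -⟩ := E.quo_exists hK hw
  obtain ⟨g, hg⟩ := hq1.lift (fun x => (QuotientAddGroup.mk' (nsmulAddMonoidHom (α := U) p).range) (q x))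
    (fun x hx y hy => by simp only [hq.add x hx y hy, map_add]) (fun x hx hxT => by
      rw [QuotientAddGroup.mk'_apply, QuotientAddGroup.eq_zero_iff]
      obtain ⟨z, hz, hzx⟩ := E.rep hK 1 hxT
      refine ⟨q z, ?_⟩
      rw [nsmulAddMonoidHom_apply, ← hq.pow hz, hq.eq_iff (K.pow_mem hz _) hx]
      rw [pow_one] at hzx
      have := (hK.1.pwi (p := p) s).1
      exact mk_eq_mono (pwi_anti (by omega)) hzx)
  have := hq1.finite
  rw [show (pw p K).relIndex K = Nat.card U1 from (Env.card_quo hq1).symm]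
  apply Nat.card_le_card_of_surjective g
  intro y
  obtain ⟨u, rfl⟩ := QuotientAddGroup.mk'_surjective _ y
  obtain ⟨x, hx, rfl⟩ := hq.surj u
  exact ⟨q1 x, hg x hx⟩

theorem stepD (n m k B : ℕ) (hp : p.Prime) : ∃ s0, ∀ s ≥ s0, 2 * (m + 2) ≤ s → ∀ w ≥ s,
    ∀ (P : Type) [Group P] (φ : MulAut P) (G0 : Subgroup P), Env p w φ G0 →
    (∀ K, Good φ G0 K → (pw p K).relIndex K ≤ B) →
    φ ^ (p ^ (n + 1)) = 1 → Nat.card {x // φ x = x} ≤ p ^ m →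
    Nat.card {x // (φ ^ (p ^ n)) x = x} ≤ p ^ k → StepD p w s (m + 2) φ G0 := by
  obtain ⟨s0, hs0⟩ := cpt3 hp n m k B
  refine ⟨s0, fun s hs hsc w hsw P _ φ G0 E hB hφ hm hk => ?_⟩
  intro K W A hK hKW hW hu hA
  have hw : 1 ≤ w := by omega
  have := E.fin
  obtain ⟨L, _, q, F, hq, hF⟩ := E.quo_exists hK hsw
  obtain ⟨U', _, q', h, br, hq', hinj, hh, hbr, halt, hjac⟩ := E.lie hw hK hKW hW hu hA hsw hq
  have := hq.finite
  have hTn := (hK.1.pwi (p := p) s).1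
  have hit : ∀ l, ∀ x ∈ K, (φ ^ l) x ∈ K ∧ F^[l] (q x) = q ((φ ^ l) x) := by
    intro l x hx
    induction l with
    | zero => simp [hx]
    | succ l ih =>
      rw [pow_succ', MulAut.mul_apply, Function.iterate_succ_apply', ih.2, hF _ ih.1]
      exact ⟨hK.1.2 _ ih.1, rfl⟩
  have hφn : ∀ x ∈ K, (φ ^ (p ^ n)).toMonoidHom x ∈ K := fun x hx => (hit (p ^ n) x hx).1
  obtain ⟨Fn, hFn⟩ := hq.endo (φ ^ (p ^ n)).toMonoidHom hφn (map_mem_pwi hφn s)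
  have hFn' : ∀ u, Fn u = F^[p ^ n] u := by
    intro u
    obtain ⟨x, hx, rfl⟩ := hq.surj u
    rw [hFn x hx, (hit _ x hx).2]; rfl
  have ck : Nat.card {x // F^[p ^ n] x = x} ≤ p ^ k := by
    simp only [← hFn']
    exact (hq.card_fix (pwi_le s) hTn _ (map_mem_pwi hφn s) hFn hφn).trans hk
  have cm : Nat.card {x // F x = x} ≤ p ^ m :=
    (hq.card_fix (pwi_le s) hTn φ.toMonoidHom (hK.1.pwi s).2 hF hK.1.2).trans hm
  obtain ⟨M, hM1, hM2, hM3⟩ := hs0 s hs L br F (Env.kill hq) (E.homog hK hsw (hu.mono (by omega)) hq)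
    ((E.card_modp hw hK (by omega) hsw hq).trans (hB K hK)) halt hjac
    (br_hom (f := φ.toMonoidHom) hKW hq hq' hinj hh hbr hK.1.2 hF) (Env.F_iter hK.1 hq hF hφ) cm ck
  let K' : Subgroup P :=
    { carrier := {x | x ∈ K ∧ q x ∈ M}
      mul_mem' := fun {a b} ha hb => ⟨mul_mem ha.1 hb.1, by
        rw [hq.add _ ha.1 _ hb.1]; exact add_mem ha.2 hb.2⟩
      one_mem' := ⟨one_mem _, by rw [hq.one]; exact zero_mem _⟩
      inv_mem' := fun {a} ha => ⟨inv_mem ha.1, by rw [hq.inv ha.1]; exact neg_mem ha.2⟩ }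
  have hK' : K' ≤ K := fun x hx => hx.1
  have hinv : ∀ f : P →* P, (∀ x ∈ K, f x ∈ K) → ∀ x ∈ K', f x ∈ K' := by
    intro f hf x hx
    obtain ⟨G, hG⟩ := hq.endo f hf (map_mem_pwi hf s)
    refine ⟨hf _ hx.1, ?_⟩
    rw [← hG x hx.1]
    exact hM3 G (br_hom hKW hq hq' hinj hh hbr hf hG) _ hx.2
  have hle : (pw p)^[m + 2 - 1] K ≤ K' := by
    intro x hx
    have hxK := pwi_le _ hx
    refine ⟨hxK, ?_⟩
    obtain ⟨z, hz, hzx⟩ := E.rep hK _ hx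
    have : q (z ^ (p ^ (m + 2 - 1))) = q x := by
      rw [hq.eq_iff (K.pow_mem hz _) hxK]
      exact mk_eq_mono (pwi_anti (by omega)) hzx
    rw [← this, hq.pow hz]; exact hM1 _
  have hgood : Good φ G0 K' := by
    refine ⟨⟨⟨fun x hx g => ?_⟩, hinv φ.toMonoidHom hK.1.2⟩, hK'.trans hK.2⟩
    exact hinv (MulAut.conj g).toMonoidHom (fun y hy => hK.1.1.conj_mem y hy g) x hx
  refine ⟨K', hgood, hle, hK', ?_⟩
  rw [Subgroup.commutator_le]
  intro x hx y hy
  obtain ⟨u, hu, hxy⟩ := hM2 _ hx.2 _ hy.2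
  obtain ⟨z, hz, rfl⟩ := hq.surj u
  have mxy : ⁅x, y⁆ ∈ (pw p)^[W] K := hKW (Subgroup.commutator_mem_commutator hx.1 hy.1)
  have hzc := K.pow_mem hz (p ^ (m + 2))
  have h1 : q' ((z ^ (p ^ (m + 2))) ^ (p ^ W)) = q' ⁅x, y⁆ := by
    rw [← hh _ hzc, hq.pow hz, ← hxy, hbr x hx.1 y hy.1]
  have mz : (z ^ (p ^ (m + 2))) ^ (p ^ W) ∈ (pw p)^[W] K := pow_mem_pwi W hzc
  have mt : ((z ^ (p ^ (m + 2))) ^ (p ^ W))⁻¹ * ⁅x, y⁆ ∈ (pw p)^[s + W] K := by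
    rw [← hq'.ker _ (mul_mem (inv_mem mz) mxy), hq'.add _ (inv_mem mz) _ mxy, hq'.inv mz, h1]; simp
  have : ⁅x, y⁆ = ((z ^ (p ^ (m + 2))) ^ (p ^ W)) * (((z ^ (p ^ (m + 2))) ^ (p ^ W))⁻¹ * ⁅x, y⁆) := by
    group
  rw [this]
  refine mul_mem ?_ ?_
  · rw [← pow_mul, ← pow_add, add_comm (m + 2)]
    exact pow_mem_pwi _ ⟨hz, hu⟩
  · have h2 := pwi_mono (p := p) (W + (m + 2)) hle
    rw [pwi_add] at h2
    exact h2 (pwi_anti (by omega) mt)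
end stepd
end PG
namespace PG
theorem final_succ (p n m k : ℕ) (hp : p.Prime) : ∃ b : ℕ, ∀ (P : Type) [Group P] [Finite P],
    IsPGroup p P → ∀ φ : MulAut P, φ ^ (p ^ (n + 1)) = 1 → Nat.card {x : P // φ x = x} ≤ p ^ m →
      Nat.card {x : P // (φ ^ (p ^ n)) x = x} ≤ p ^ k →
      ∃ H : Subgroup P, (∀ f : P →* P, H.map f ≤ H) ∧ H.index ≤ b ∧
        itc H H (gfun ((m + 2) * (3 * (m + 2))) m) = ⊥ := by
  obtain ⟨s0, hs0⟩ := stepD n m k (Bd p (n + 1) m 1) hp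
  obtain ⟨s, hs1, hs2⟩ : ∃ s, s0 ≤ s ∧ 2 * (m + 2) ≤ s :=
    ⟨max s0 (2 * (m + 2)), le_max_left _ _, le_max_right _ _⟩
  refine ⟨Bd p (n + 1) m (Qe p (n + 1) m s + 2 * (Bd p (n + 1) m 1) * (m + 1) * (m + 1)), ?_⟩
  intro P _ _ hP φ hφ hm hk
  have E := env_exists (φ := φ) hp hP hφ hm s
  have hB : ∀ K, Good φ (vp P (p ^ Qe p (n + 1) m s)) K → (pw p K).relIndex K ≤ Bd p (n + 1) m 1 := by
    intro K hK
    exact relIndex_bound hp hP hφ hm hK.1 hK.1.pw (fun x hx => by rw [pow_one]; exact pow_mem_pw hx)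
  have hD := hs0 s hs1 hs2 s le_rfl P φ _ E hB hφ hm hk
  have hG : Good φ (vp P (p ^ Qe p (n + 1) m s)) (vp P (p ^ Qe p (n + 1) m s)) := ⟨E.adm0, le_rfl⟩
  have := E.outer hD le_rfl (by omega) (by omega) (S := m + 1) (by omega) rfl hB hm hφ m _ hG
    (E.cofLe_m hG (by omega) hm)
  refine ⟨_, vp_map _, vp_index hp hP hφ hm, ?_⟩
  rw [← le_bot_iff, ← this, pow_add]
  exact itc_both_mono (vp_mul_le _ _) _
end PG

theorem stmt12 : ∃ (g : ℕ → ℕ) (F : ℕ → ℕ → ℕ → ℕ → ℕ),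
    ∀ (p n m k : ℕ), p.Prime →
    ∀ (P : Type) [Group P] [Finite P], (∃ e : ℕ, Nat.card P = p ^ e) →
    ∀ φ : MulAut P, orderOf φ = p ^ n →
      Nat.card {x : P // φ x = x} = p ^ m →
      Nat.card {x : P // (φ ^ (p ^ (n - 1))) x = x} = p ^ k →
      ∃ H : Subgroup P, (∀ f : P →* P, H.map f ≤ H) ∧
        H.index ≤ F p n m k ∧ lowerCentralSeries H (g m) = ⊥ := by
  have key : ∀ p n m k : ℕ, ∃ b : ℕ, p.Prime →
    ∀ (P : Type) [Group P] [Finite P], (∃ e : ℕ, Nat.card P = p ^ e) →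
    ∀ φ : MulAut P, orderOf φ = p ^ n →
      Nat.card {x : P // φ x = x} = p ^ m →
      Nat.card {x : P // (φ ^ (p ^ (n - 1))) x = x} = p ^ k →
      ∃ H : Subgroup P, (∀ f : P →* P, H.map f ≤ H) ∧
        H.index ≤ b ∧ PG.itc H H (PG.gfun ((m + 2) * (3 * (m + 2))) m) = ⊥ := by
    intro p n m k
    by_cases hp : p.Prime
    swap
    · exact ⟨0, fun h => absurd h hp⟩
    cases n with
    | zero =>
      refine ⟨p ^ m, fun _ P _ _ _ φ hφ hm _ => ⟨⊥, by simp, ?_, ?_⟩⟩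
      · rw [pow_zero, orderOf_eq_one_iff] at hφ
        subst hφ
        rw [Subgroup.index_bot, ← hm]
        exact Nat.card_le_card_of_injective (fun x => ⟨x, rfl⟩) (fun a b h => congrArg Subtype.val h)
      · rw [← le_bot_iff]
        exact PG.itc_anti (Nat.zero_le _)
    | succ n =>
      obtain ⟨b, hb⟩ := PG.final_succ p n m k hp
      refine ⟨b, fun _ P _ _ hP φ hφ hm hk => ?_⟩
      obtain ⟨e, he⟩ := hP
      exact hb P (IsPGroup.of_card he) φ (by rw [← hφ]; exact pow_orderOf_eq_one φ) hm.le hk.le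
  choose b hb using key
  refine ⟨fun m => PG.gfun ((m + 2) * (3 * (m + 2))) m, b, ?_⟩
  intro p n m k hp P _ _ hP φ h1 h2 h3
  obtain ⟨H, hH1, hH2, hH3⟩ := hb p n m k hp P hP φ h1 h2 h3
  refine ⟨H, hH1, hH2, ?_⟩
  rw [← hH3]
  exact PG.lcs_eq _
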